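/- arXiv:2404.04371 — 3 statements merged into one kernel-verified Lean document; each statement's English description precedes it below -/
import Mathlib

section
/- Let L be a quadratic imaginary extension of a totally real number field L⁺, let n ≥ 1, r ≥ 1, and let k₁,…,k_r be positive integers with each k_i ≥ n and k = k₁ + … + k_r. Let v be a positive integer divisible by (|μ(L)|/2)·[O_L^× : μ(L)·O_{L⁺}^×], where μ(L) is the group of roots of unity of L. If F₁,…,F_r are scalar-valued Hermitian modular forms of weights k₁,…,k_r respectively, all of level Γ, and Q ∈ H_{n,v}(k₁,…,k_r), then the function Z ↦ Q(∂/∂Z)( F₁(Z₁)···F_r(Z_r) )|_{Z₁=…=Z_r=Z} is a scalar-valued Hermitian modular form of weight k + 2v and level Γ. -/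
noncomputable section

/-- The ring of integers of a subfield `L ⊆ ℂ`: elements of `L` integral over `ℤ`. -/
def OL (L : Subfield ℂ) : Subring ℂ := (integralClosure ℤ ℂ).toSubring ⊓ L.toSubring

lemma OL_mono {Lp L : Subfield ℂ} (h : Lp ≤ L) : OL Lp ≤ OL L := by
  intro x hx
  rw [OL, Subring.mem_inf] at hx ⊢
  exact ⟨hx.1, h hx.2⟩

/-- `K` is totally real: every embedding `K →+* ℂ` has real image. -/
def TotallyReal (K : Subfield ℂ) : Prop := ∀ φ : K →+* ℂ, ∀ x : K, (φ x).im = 0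

/-- `K` is totally imaginary: no embedding `K →+* ℂ` has real image. -/
def TotallyImaginary (K : Subfield ℂ) : Prop := ∀ φ : K →+* ℂ, ∃ x : K, (φ x).im ≠ 0

/-- `L/L⁺` is a quadratic imaginary extension of a totally real number field, i.e. a CM
field: `L⁺ ≤ L`, `L⁺` totally real, `L` totally imaginary, `L` is a number field, and
`[L : ℚ] = 2 [L⁺ : ℚ]` (equivalently `[L : L⁺] = 2`). -/
def IsCMExtension (Lp L : Subfield ℂ) : Prop :=
  Lp ≤ L ∧ TotallyReal Lp ∧ TotallyImaginary L ∧
    FiniteDimensional ℚ L ∧ Module.finrank ℚ L = 2 * Module.finrank ℚ Lp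

/-- The divisibility condition on the degree `v`:
`(|μ(L)|/2)·[O_L^× : μ(L)·O_{L⁺}^×]` divides `v`, where `μ(L)`, the group of roots of unity
of `L`, is the torsion subgroup of `(O_L)ˣ`. -/
def WeightCond (Lp L : Subfield ℂ) (h : Lp ≤ L) (v : ℕ) : Prop :=
  (Nat.card (CommGroup.torsion (OL L)ˣ) / 2) *
      (CommGroup.torsion (OL L)ˣ ⊔
        (Units.map (Subring.inclusion (OL_mono h)).toMonoidHom).range).index ∣ v

noncomputable section

open Matrix
open scoped ComplexOrder

/-- Index of the variables of `r`-tuples of `n × n` complex matrices: the coordinate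
`(i, s, t)` is the `(s,t)` entry of the `i`-th matrix. -/
abbrev MIdx (n r : ℕ) := Fin r × Fin n × Fin n

/-- The `i`-th matrix of a point `z ∈ ℂ^{MIdx n r}`. -/
def toMat {n r : ℕ} (z : MIdx n r → ℂ) (i : Fin r) : Matrix (Fin n) (Fin n) ℂ :=
  Matrix.of fun s t => z (i, s, t)

/-- A square matrix as a point of `ℂ^{Fin n × Fin n}`. -/
def ofSq {n : ℕ} (Z : Matrix (Fin n) (Fin n) ℂ) : Fin n × Fin n → ℂ := fun p => Z p.1 p.2

/-- A point of `ℂ^{Fin n × Fin n}` as a square matrix. -/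
def toSq {n : ℕ} (z : Fin n × Fin n → ℂ) : Matrix (Fin n) (Fin n) ℂ :=
  Matrix.of fun s t => z (s, t)

/-- The Hermitian upper half-space
`H_n = {Z ∈ M_{n,n}(ℂ) : (Z − Z*)/(2i) is positive definite}`. -/
def UpperHalf (n : ℕ) : Set (Matrix (Fin n) (Fin n) ℂ) :=
  {Z | ((2 * Complex.I)⁻¹ • (Z - Zᴴ)).PosDef}

/-- The matrix `J = ((0, −i·1_n), (i·1_n, 0))`. -/
def Jmat (n : ℕ) : Matrix (Fin n ⊕ Fin n) (Fin n ⊕ Fin n) ℂ :=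
  Matrix.fromBlocks 0 (-(Complex.I • 1)) (Complex.I • 1) 0

/-- Membership in the unitary group `U(n,n) = {γ : γ* J γ = J}`. -/
def InUnitary (n : ℕ) (γ : Matrix (Fin n ⊕ Fin n) (Fin n ⊕ Fin n) ℂ) : Prop :=
  γᴴ * Jmat n * γ = Jmat n

/-- The action `γ·Z = (AZ + B)(CZ + D)⁻¹` of `U(n,n)` on `H_n`, where
`γ = ((A,B),(C,D))` in block form. -/
def actU {n : ℕ} (γ : Matrix (Fin n ⊕ Fin n) (Fin n ⊕ Fin n) ℂ)
    (Z : Matrix (Fin n) (Fin n) ℂ) : Matrix (Fin n) (Fin n) ℂ :=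
  (γ.toBlocks₁₁ * Z + γ.toBlocks₁₂) * (γ.toBlocks₂₁ * Z + γ.toBlocks₂₂)⁻¹

/-- The automorphy factor `det(CZ + D)`. -/
def autFactor {n : ℕ} (γ : Matrix (Fin n ⊕ Fin n) (Fin n ⊕ Fin n) ℂ)
    (Z : Matrix (Fin n) (Fin n) ℂ) : ℂ :=
  (γ.toBlocks₂₁ * Z + γ.toBlocks₂₂).det

/-- The partial derivative `∂F/∂z_j` of a function of several complex variables. -/
def pd {ι : Type} [Fintype ι] [DecidableEq ι] (j : ι) (F : (ι → ℂ) → ℂ) : (ι → ℂ) → ℂ :=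
  fun z => fderiv ℂ F z (Pi.single j 1)

/-- The operator `(∂/∂Z_i)_{s,t} = ∂/∂z^{(i)}_{t,s}` attached to the variable `(i,(s,t))`
(note the transpose). -/
def pdT {n r : ℕ} (q : MIdx n r) : ((MIdx n r → ℂ) → ℂ) → ((MIdx n r → ℂ) → ℂ) :=
  pd (q.1, q.2.2, q.2.1)

/-- The iterated differential operator attached to a monomial exponent `d`. -/
def monOp {n r : ℕ} (d : MIdx n r →₀ ℕ) : ((MIdx n r → ℂ) → ℂ) → ((MIdx n r → ℂ) → ℂ) :=
  (Finset.univ : Finset (MIdx n r)).toList.foldr (fun j g => (pdT j)^[d j] ∘ g) id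

/-- The differential operator `Q(∂/∂Z₁, …, ∂/∂Z_r)` attached to a polynomial `Q` in the
entries of `r` matrices. -/
def polyDOp {n r : ℕ} (Q : MvPolynomial (MIdx n r) ℂ) (F : (MIdx n r → ℂ) → ℂ)
    (z : MIdx n r → ℂ) : ℂ :=
  ∑ d ∈ Q.support, MvPolynomial.coeff d Q * monOp d F z

/-- Column indices of an `n × (k₁ + ⋯ + k_r)` matrix split into blocks of `k i` columns. -/
abbrev ColIdx (r : ℕ) (k : Fin r → ℕ) := (i : Fin r) × Fin (k i)

/-- Variables for polynomials `P(X,Y)` in the entries of two `n × (k₁ + ⋯ + k_r)` matrices. -/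
abbrev PVars (n r : ℕ) (k : Fin r → ℕ) := (Fin n × ColIdx r k) ⊕ (Fin n × ColIdx r k)

/-- The polynomial `P(X,Y) = Q(X₁ ᵗY₁, …, X_r ᵗY_r)` associated to `Q(R₁, …, R_r)`. -/
def toP {n r : ℕ} (k : Fin r → ℕ) (Q : MvPolynomial (MIdx n r) ℂ) :
    MvPolynomial (PVars n r k) ℂ :=
  MvPolynomial.aeval
    (fun q : MIdx n r =>
      ∑ u : Fin (k q.1),
        MvPolynomial.X (Sum.inl (q.2.1, ⟨q.1, u⟩)) *
          MvPolynomial.X (Sum.inr (q.2.2, ⟨q.1, u⟩))) Q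

/-- `P` is pluriharmonic if `Δ_{s,t}P = Σ_u ∂²P/(∂x_{s,u}∂y_{t,u}) = 0` for all `s, t`. -/
def Pluriharmonic {n r : ℕ} {k : Fin r → ℕ} (P : MvPolynomial (PVars n r k) ℂ) : Prop :=
  ∀ s t : Fin n,
    ∑ u : ColIdx r k,
      MvPolynomial.pderiv (Sum.inl (s, u)) (MvPolynomial.pderiv (Sum.inr (t, u)) P) = 0

/-- Membership in `H_{n,v}(k₁, …, k_r)`: `Q` is homogeneous of degree `v`, i.e.
`Q(A R₁ ᵗB, …, A R_r ᵗB) = det(A)^v det(B)^v Q(R₁, …, R_r)` for all invertible `A, B`, and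
the associated polynomial `P(X,Y) = Q(X₁ ᵗY₁, …, X_r ᵗY_r)` is pluriharmonic. -/
def MemH (n v r : ℕ) (k : Fin r → ℕ) (Q : MvPolynomial (MIdx n r) ℂ) : Prop :=
  (∀ A B : Matrix (Fin n) (Fin n) ℂ, IsUnit A.det → IsUnit B.det →
    MvPolynomial.aeval
        (fun q : MIdx n r =>
          ∑ p : Fin n, ∑ q' : Fin n,
            MvPolynomial.C (A q.2.1 p * B q.2.2 q') * MvPolynomial.X (q.1, p, q')) Q =
      MvPolynomial.C (A.det ^ v * B.det ^ v) * Q) ∧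
  Pluriharmonic (toP k Q)

/-- The point of `ℂ^{MIdx n r}` given by `r` copies of a single matrix `Z`. -/
def diagPt {n r : ℕ} (Z : Matrix (Fin n) (Fin n) ℂ) : MIdx n r → ℂ :=
  fun p => Z p.2.1 p.2.2

/-- A scalar-valued Hermitian modular form of level `Γ` and weight `k`: a holomorphic
function `F : H_n → ℂ` with `F(Z) = det(CZ+D)^{−k} F(γ·Z)` for all `γ = ((A,B),(C,D)) ∈ Γ`. -/
def IsHMF (n : ℕ) (Γ : Set (Matrix (Fin n ⊕ Fin n) (Fin n ⊕ Fin n) ℂ)) (k : ℤ)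
    (F : (Fin n × Fin n → ℂ) → ℂ) : Prop :=
  DifferentiableOn ℂ F {z | toSq z ∈ UpperHalf n} ∧
    ∀ γ ∈ Γ, ∀ z : Fin n × Fin n → ℂ, toSq z ∈ UpperHalf n →
      F z = autFactor γ (toSq z) ^ (-k) * F (ofSq (actU γ (toSq z)))

/-- `Γ` is a congruence subgroup of `U(n,n)(O_L)`: a subgroup consisting of matrices in
`U(n,n)` with entries in `O_L`, containing a principal congruence subgroup
`{γ ∈ U(n,n)(O_L) : γ ≡ 1 mod N}` for some `N > 0`. -/
def IsCongruenceSubgroup (n : ℕ) (L : Subfield ℂ)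
    (Γ : Set (Matrix (Fin n ⊕ Fin n) (Fin n ⊕ Fin n) ℂ)) : Prop :=
  (∀ γ ∈ Γ, InUnitary n γ ∧ ∀ p q, γ p q ∈ OL L) ∧
    (1 : Matrix (Fin n ⊕ Fin n) (Fin n ⊕ Fin n) ℂ) ∈ Γ ∧
    (∀ γ ∈ Γ, ∀ δ ∈ Γ, γ * δ ∈ Γ) ∧ (∀ γ ∈ Γ, γ⁻¹ ∈ Γ) ∧
    ∃ N : ℕ, 0 < N ∧
      ∀ γ : Matrix (Fin n ⊕ Fin n) (Fin n ⊕ Fin n) ℂ,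
        InUnitary n γ → (∀ p q, γ p q ∈ OL L) →
        (∀ p q, ∃ a ∈ OL L,
          γ p q - (1 : Matrix (Fin n ⊕ Fin n) (Fin n ⊕ Fin n) ℂ) p q = (N : ℂ) * a) →
        γ ∈ Γ

open Filter Topology in
lemma hol_aux {E : Type*} [NormedAddCommGroup E] [NormedSpace ℂ E] [FiniteDimensional ℂ E]
    {f : E → ℂ} {z : E} (hf : ∀ᶠ w in 𝓝 z, DifferentiableAt ℂ f w) (v : E) :
    DifferentiableAt ℂ (fun w => fderiv ℂ f w v) z := by
  classical
  let _ : MeasurableSpace E := borel E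
  have : BorelSpace E := ⟨rfl⟩
  have hc : ContinuousAt f z := hf.self_of_nhds.continuousAt
  have h1 : ∀ᶠ w in 𝓝 z, DifferentiableAt ℂ f w ∧ dist (f w) (f z) < 1 :=
    hf.and (hc.eventually (Metric.ball_mem_nhds _ one_pos))
  obtain ⟨e, he, hball⟩ := Metric.eventually_nhds_iff_ball.1 h1
  set ε := e / 4 with hε
  have hε0 : 0 < ε := by positivity
  set ρ := ε / (‖v‖ + 1) with hρ
  have hv1 : 0 < ‖v‖ + 1 := by positivity
  have hρ0 : 0 < ρ := by positivity
  have hρv : ρ * ‖v‖ ≤ ε := by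
    rw [hρ, div_mul_eq_mul_div, div_le_iff₀ hv1]
    nlinarith
  have hmem : ∀ w ∈ Metric.ball z ε, ∀ ζ : ℂ, ‖ζ‖ ≤ ρ → w + ζ • v ∈ Metric.ball z (2 * ε) := by
    intro w hw ζ hζ
    rw [mem_ball_iff_norm] at hw ⊢
    have : ‖ζ • v‖ ≤ ε := by
      rw [norm_smul]; exact (mul_le_mul_of_nonneg_right hζ (norm_nonneg _)).trans hρv
    calc ‖w + ζ • v - z‖ = ‖(w - z) + ζ • v‖ := by congr 1; abel
      _ ≤ _ := norm_add_le _ _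
      _ < 2 * ε := by linarith
  have hd : ∀ w ∈ Metric.ball z (2 * ε), DifferentiableAt ℂ f w := fun w hw =>
    (hball w (Metric.ball_subset_ball (by linarith) hw)).1
  have hb : ∀ w ∈ Metric.ball z (2 * ε), ‖fderiv ℂ f w‖ ≤ 2 / ε := by
    intro w hw
    have hsub : Metric.ball w ε ⊆ Metric.ball z e := by
      apply Metric.ball_subset_ball'
      rw [Metric.mem_ball] at hw
      linarith
    apply Complex.norm_fderiv_le_div_of_mapsTo_ball (R₁ := ε) (R₂ := 2) _ _ hε0
    · intro x hx
      exact (hball x (hsub hx)).1.differentiableWithinAt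
    · intro x hx
      have a1 := (hball x (hsub hx)).2
      have a2 := (hball w (hsub (Metric.mem_ball_self hε0))).2
      rw [Metric.mem_closedBall]
      have := dist_triangle_right (f x) (f w) (f z)
      linarith
  -- Cauchy formula
  have key : ∀ w ∈ Metric.ball z ε, fderiv ℂ f w v =
      (2 * Real.pi * Complex.I : ℂ)⁻¹ • ∮ ζ in C(0, ρ), (1 / (ζ - 0) ^ 2) • f (w + ζ • v) := by
    intro w hw
    have hdif : ∀ ζ : ℂ, ‖ζ‖ ≤ ρ → DifferentiableAt ℂ (fun ζ : ℂ => f (w + ζ • v)) ζ := by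
      intro ζ hζ
      exact (hd _ (hmem w hw ζ hζ)).comp ζ (by fun_prop)
    have h2 : deriv (fun ζ : ℂ => f (w + ζ • v)) 0 = fderiv ℂ f w v := by
      have h3 : HasDerivAt (fun ζ : ℂ => w + ζ • v) v 0 := by
        simpa using ((hasDerivAt_id (0:ℂ)).smul_const v).const_add w
      have h4 : HasFDerivAt f (fderiv ℂ f w) (w + (0:ℂ) • v) := by
        rw [zero_smul, add_zero]
        exact (hd w (Metric.ball_subset_ball (by linarith) hw)).hasFDerivAt
      exact (h4.comp_hasDerivAt (0:ℂ) h3).deriv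
    rw [← h2]
    rw [DifferentiableOn.deriv_eq_smul_circleIntegral hρ0, inv_smul_smul₀]
    · simp [Real.pi_ne_zero]
    intro ζ hζ
    apply DifferentiableAt.differentiableWithinAt
    apply hdif
    simpa using hζ
  have hev : (fun w => fderiv ℂ f w v) =ᶠ[𝓝 z] fun w => (2 * Real.pi * Complex.I : ℂ)⁻¹ •
      ∮ ζ in C(0, ρ), (1 / (ζ - 0) ^ 2) • f (w + ζ • v) :=
    Filter.eventuallyEq_of_mem (Metric.ball_mem_nhds z hε0) key
  refine DifferentiableAt.congr_of_eventuallyEq ?_ hev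
  refine DifferentiableAt.fun_const_smul ?_ _
  simp only [circleIntegral, intervalIntegral.integral_of_le Real.two_pi_pos.le]
  set c : ℝ → ℂ := fun θ => deriv (circleMap 0 ρ) θ * (1 / (circleMap 0 ρ θ - 0) ^ 2) with hcdef
  have hcm : ∀ θ, ‖circleMap 0 ρ θ‖ = ρ := fun θ => by simp [circleMap, abs_of_pos hρ0]
  have hcne : ∀ θ, circleMap 0 ρ θ ≠ 0 := fun θ => by
    rw [← norm_pos_iff, hcm]; exact hρ0
  have hcc : Continuous c := by
    rw [hcdef]
    simp only [deriv_circleMap, sub_zero]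
    refine Continuous.mul (by fun_prop) ?_
    exact continuous_const.div ((continuous_circleMap 0 ρ).pow 2) (fun θ => pow_ne_zero 2 (hcne θ))
  have hcn : ∀ θ, ‖c θ‖ = ρ⁻¹ := by
    intro θ
    simp only [hcdef, deriv_circleMap, norm_mul, sub_zero, norm_div, norm_pow, norm_one, hcm, Complex.norm_I]
    field_simp
  have hmain := hasFDerivAt_integral_of_dominated_of_fderiv_le (𝕜 := ℂ)
    (μ := MeasureTheory.volume.restrict (Set.Ioc 0 (2 * Real.pi))) (x₀ := z)
    (F := fun w θ => c θ • f (w + circleMap 0 ρ θ • v))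
    (F' := fun w θ => c θ • fderiv ℂ f (w + circleMap 0 ρ θ • v))
    (bound := fun _ => ρ⁻¹ * (2 / ε)) (Metric.ball_mem_nhds z hε0) ?_ ?_ ?_ ?_ ?_ ?_
  · convert! hmain.differentiableAt using 2
    congr 1; funext θ
    simp [hcdef, mul_assoc]
  · filter_upwards [Metric.ball_mem_nhds z hε0] with w hw
    apply Continuous.aestronglyMeasurable
    refine hcc.smul ?_
    rw [continuous_iff_continuousAt]
    intro θ
    refine ContinuousAt.comp (f := fun θ => w + circleMap 0 ρ θ • v) (g := f)
      (hd _ (hmem w hw _ (hcm θ).le)).continuousAt ?_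
    fun_prop
  · apply Continuous.integrableOn_Ioc
    refine hcc.smul ?_
    rw [continuous_iff_continuousAt]
    intro θ
    refine ContinuousAt.comp (f := fun θ => z + circleMap 0 ρ θ • v) (g := f)
      (hd _ (hmem z (Metric.mem_ball_self hε0) _ (hcm θ).le)).continuousAt ?_
    fun_prop
  · refine (hcc.aestronglyMeasurable).smul ?_
    have : ProperSpace E := FiniteDimensional.proper ℂ E
    have : FiniteDimensional ℂ (E →L[ℂ] ℂ) := inferInstance
    have : ProperSpace (E →L[ℂ] ℂ) := FiniteDimensional.proper ℂ _
    have hm : Measurable fun θ => fderiv ℂ f (z + circleMap 0 ρ θ • v) :=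
      (measurable_fderiv ℂ f).comp (Continuous.measurable (by fun_prop))
    exact hm.stronglyMeasurable.aestronglyMeasurable
  · refine Filter.Eventually.of_forall fun θ w hw => ?_
    rw [norm_smul, hcn]
    exact mul_le_mul_of_nonneg_left (hb _ (hmem w hw _ (hcm θ).le)) (by positivity)
  · exact MeasureTheory.integrable_const _
  · refine Filter.Eventually.of_forall fun θ w hw => ?_
    have := (hd _ (hmem w hw _ (hcm θ).le)).hasFDerivAt.comp w
      ((hasFDerivAt_id w).add_const (circleMap 0 ρ θ • v))
    simpa using! this.const_smul (c θ)

/-- holomorphic near `z` -/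
def Hol {E : Type*} [NormedAddCommGroup E] [NormedSpace ℂ E] (f : E → ℂ) (z : E) : Prop :=
  ∀ᶠ w in nhds z, DifferentiableAt ℂ f w

section hol
set_option linter.unusedSectionVars false
open Filter Topology
variable {E : Type*} [NormedAddCommGroup E] [NormedSpace ℂ E] [FiniteDimensional ℂ E]
  {f g : E → ℂ} {z : E}

lemma Hol.diff (h : Hol f z) : DifferentiableAt ℂ f z := h.self_of_nhds

lemma Hol.ev (h : Hol f z) : ∀ᶠ w in 𝓝 z, Hol f w := eventually_eventually_nhds.2 h

lemma Hol.congr (h : Hol f z) (hfg : f =ᶠ[𝓝 z] g) : Hol g z := by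
  unfold Hol
  filter_upwards [Filter.Eventually.and h.ev hfg.eventuallyEq_nhds] with w hw
  exact hw.1.diff.congr_of_eventuallyEq hw.2.symm

lemma Hol.fd (h : Hol f z) (v : E) : Hol (fun w => fderiv ℂ f w v) z := by
  filter_upwards [h.ev] with w hw
  exact hol_aux hw v

lemma Hol.mul (h : Hol f z) (h' : Hol g z) : Hol (fun w => f w * g w) z := by
  filter_upwards [h, h'] with w hw hw'
  exact hw.fun_mul hw'

lemma Hol.add (h : Hol f z) (h' : Hol g z) : Hol (fun w => f w + g w) z := by
  filter_upwards [h, h'] with w hw hw'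
  exact hw.fun_add hw'

lemma Hol.const (c : ℂ) : Hol (fun _ : E => c) z :=
  Filter.Eventually.of_forall fun _ => by fun_prop

lemma Hol.sum {ι : Type*} (s : Finset ι) {F : ι → E → ℂ} (h : ∀ i ∈ s, Hol (F i) z) :
    Hol (fun w => ∑ i ∈ s, F i w) z := by
  have : ∀ᶠ w in 𝓝 z, ∀ i ∈ s, DifferentiableAt ℂ (F i) w := (Filter.eventually_all_finset s).2 h
  filter_upwards [this] with w hw
  exact DifferentiableAt.fun_sum hw

lemma Hol.prod {ι : Type*} [DecidableEq ι] (s : Finset ι) {F : ι → E → ℂ}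
    (h : ∀ i ∈ s, Hol (F i) z) : Hol (fun w => ∏ i ∈ s, F i w) z := by
  induction s using Finset.induction_on with
  | empty => simpa using Hol.const 1
  | insert a s ha ih =>
    simp only [Finset.prod_insert ha]
    exact (h a (Finset.mem_insert_self a s)).mul
      (ih fun i hi => h i (Finset.mem_insert_of_mem hi))

lemma Hol.comp {E' : Type*} [NormedAddCommGroup E'] [NormedSpace ℂ E'] {φ : E' → E} {x : E'}
    (h : Hol f (φ x)) (hφ : ∀ᶠ w in 𝓝 x, DifferentiableAt ℂ φ w) : Hol (fun w => f (φ w)) x := by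
  filter_upwards [hφ, hφ.self_of_nhds.continuousAt.eventually h] with w h1 h2
  exact h2.comp w h1

lemma Hol.dfd (h : Hol f z) : DifferentiableAt ℂ (fderiv ℂ f) z := by
  let d := Module.finrank ℂ E
  have hd : d = Module.finrank ℂ (Fin d → ℂ) := (Module.finrank_fin_fun ℂ).symm
  let e₁ := ContinuousLinearEquiv.ofFinrankEq hd
  let e₂ := (e₁.arrowCongr (1 : ℂ ≃L[ℂ] ℂ)).trans (ContinuousLinearEquiv.piRing (Fin d))
  rw [← Function.id_comp (fderiv ℂ f), ← e₂.symm_comp_self]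
  exact e₂.symm.differentiableAt.comp z (differentiableAt_pi.2 fun i => (h.fd _).diff)

lemma Hol.fderiv_comm (h : Hol f z) (v w : E) :
    fderiv ℂ (fun x => fderiv ℂ f x v) z w = fderiv ℂ (fun x => fderiv ℂ f x w) z v := by
  have h2 := h.dfd
  have h3 : ∀ᶠ y in 𝓝 z, HasFDerivAt f (fderiv ℂ f y) y := by
    filter_upwards [h] with y hy using hy.hasFDerivAt
  have := second_derivative_symmetric_of_eventually h3 h2.hasFDerivAt v w
  rw [fderiv_clm_apply h2 (by fun_prop), fderiv_clm_apply h2 (by fun_prop)]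
  simp [this]
end hol

section opers
open Filter Topology
variable {n r : ℕ} {f g : (MIdx n r → ℂ) → ℂ} {z : MIdx n r → ℂ}

lemma pdT_hol (q : MIdx n r) (h : Hol f z) : Hol (pdT q f) z := h.fd _

lemma pdT_congr (q : MIdx n r) (h : f =ᶠ[𝓝 z] g) : pdT q f =ᶠ[𝓝 z] pdT q g := by
  filter_upwards [h.fderiv (𝕜 := ℂ)] with w hw
  simp [pdT, pd, hw]

lemma pdT_comm (q q' : MIdx n r) (h : Hol f z) : pdT q (pdT q' f) =ᶠ[𝓝 z] pdT q' (pdT q f) := by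
  filter_upwards [h.ev] with w hw
  exact hw.fderiv_comm _ _

lemma pdT_iter_hol (q : MIdx n r) (m : ℕ) (h : Hol f z) : Hol ((pdT q)^[m] f) z := by
  induction m with
  | zero => exact h
  | succ m ih => rw [Function.iterate_succ_apply']; exact pdT_hol q ih

lemma pdT_iter_congr (q : MIdx n r) (m : ℕ) (h : f =ᶠ[𝓝 z] g) :
    (pdT q)^[m] f =ᶠ[𝓝 z] (pdT q)^[m] g := by
  induction m with
  | zero => exact h
  | succ m ih => rw [Function.iterate_succ_apply', Function.iterate_succ_apply']; exact pdT_congr q ih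

lemma pdT_iter_comm (q q' : MIdx n r) (m : ℕ) (h : Hol f z) :
    (pdT q)^[m] (pdT q' f) =ᶠ[𝓝 z] pdT q' ((pdT q)^[m] f) := by
  induction m with
  | zero => exact EventuallyEq.rfl
  | succ m ih =>
    rw [Function.iterate_succ_apply', Function.iterate_succ_apply']
    exact (pdT_congr q ih).trans (pdT_comm q q' (pdT_iter_hol q m h))

def opL (l : List (MIdx n r)) (d : MIdx n r →₀ ℕ) :
    ((MIdx n r → ℂ) → ℂ) → ((MIdx n r → ℂ) → ℂ) :=
  l.foldr (fun j g => (pdT j)^[d j] ∘ g) id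

lemma opL_cons (a : MIdx n r) (l : List (MIdx n r)) (d : MIdx n r →₀ ℕ)
    (f : (MIdx n r → ℂ) → ℂ) : opL (a :: l) d f = (pdT a)^[d a] (opL l d f) := rfl

lemma opL_hol (l : List (MIdx n r)) (d : MIdx n r →₀ ℕ) (h : Hol f z) : Hol (opL l d f) z := by
  induction l with
  | nil => exact h
  | cons a l ih => rw [opL_cons]; exact pdT_iter_hol _ _ ih

lemma opL_congr (l : List (MIdx n r)) (d : MIdx n r →₀ ℕ) (h : f =ᶠ[𝓝 z] g) :
    opL l d f =ᶠ[𝓝 z] opL l d g := by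
  induction l with
  | nil => exact h
  | cons a l ih => rw [opL_cons, opL_cons]; exact pdT_iter_congr _ _ ih

lemma opL_comm (l : List (MIdx n r)) (d : MIdx n r →₀ ℕ) (q : MIdx n r) (h : Hol f z) :
    opL l d (pdT q f) =ᶠ[𝓝 z] pdT q (opL l d f) := by
  induction l with
  | nil => exact EventuallyEq.rfl
  | cons a l ih =>
    rw [opL_cons, opL_cons]
    exact (pdT_iter_congr _ _ ih).trans (pdT_iter_comm _ _ _ (opL_hol l d h))

lemma opL_notMem (l : List (MIdx n r)) (d : MIdx n r →₀ ℕ) (q : MIdx n r) (hq : q ∉ l)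
    (f : (MIdx n r → ℂ) → ℂ) : opL l (d + Finsupp.single q 1) f = opL l d f := by
  induction l with
  | nil => rfl
  | cons a l ih =>
    rw [List.mem_cons, not_or] at hq
    rw [opL_cons, opL_cons, ih hq.2]
    simp [Finsupp.single_eq_of_ne (Ne.symm hq.1)]

lemma opL_succ (l : List (MIdx n r)) (hl : l.Nodup) (d : MIdx n r →₀ ℕ) (q : MIdx n r)
    (hq : q ∈ l) (h : Hol f z) :
    opL l (d + Finsupp.single q 1) f =ᶠ[𝓝 z] opL l d (pdT q f) := by
  induction l with
  | nil => simp at hq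
  | cons a l ih =>
    rw [List.nodup_cons] at hl
    rw [opL_cons, opL_cons]
    by_cases hqa : q = a
    · subst hqa
      rw [opL_notMem l d q hl.1]
      simp only [Finsupp.add_apply, Finsupp.single_eq_same, Function.iterate_succ_apply]
      exact pdT_iter_congr _ _ (opL_comm l d q h).symm
    · have hq' : q ∈ l := by simpa [hqa] using hq
      have : (d + Finsupp.single q 1 : MIdx n r →₀ ℕ) a = d a := by simp [Finsupp.single_eq_of_ne (Ne.symm hqa)]
      rw [this]
      exact pdT_iter_congr _ _ (ih hl.2 hq')

lemma monOp_eq (d : MIdx n r →₀ ℕ) : monOp d = opL (Finset.univ.toList) d := rfl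

lemma monOp_zero (f : (MIdx n r → ℂ) → ℂ) : monOp 0 f = f := by
  rw [monOp_eq]
  induction (Finset.univ : Finset (MIdx n r)).toList with
  | nil => rfl
  | cons a l ih => rw [opL_cons, ih]; rfl

lemma monOp_succ (d : MIdx n r →₀ ℕ) (q : MIdx n r) (h : Hol f z) :
    monOp (d + Finsupp.single q 1) f z = monOp d (pdT q f) z :=
  (opL_succ _ (Finset.nodup_toList _) d q (by simp) h).self_of_nhds

lemma polyDOp_eq (Q : MvPolynomial (MIdx n r) ℂ) (f : (MIdx n r → ℂ) → ℂ) (z : MIdx n r → ℂ) :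
    polyDOp Q f z = Finsupp.sum (AddMonoidAlgebra.coeff Q) (fun d c => c * monOp d f z) := rfl

lemma polyDOp_add (Q Q' : MvPolynomial (MIdx n r) ℂ) (f : (MIdx n r → ℂ) → ℂ)
    (z : MIdx n r → ℂ) : polyDOp (Q + Q') f z = polyDOp Q f z + polyDOp Q' f z := by
  rw [polyDOp_eq, polyDOp_eq, polyDOp_eq]
  exact Finsupp.sum_add_index' (by simp) (by intros; ring)

lemma polyDOp_monomial (d : MIdx n r →₀ ℕ) (c : ℂ) (f : (MIdx n r → ℂ) → ℂ)
    (z : MIdx n r → ℂ) : polyDOp (MvPolynomial.monomial d c) f z = c * monOp d f z := by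
  rw [polyDOp_eq]
  exact Finsupp.sum_single_index (by simp)

lemma polyDOp_C (c : ℂ) (f : (MIdx n r → ℂ) → ℂ)
    (z : MIdx n r → ℂ) : polyDOp (MvPolynomial.C c) f z = c * f z := by
  rw [MvPolynomial.C_apply, polyDOp_monomial, monOp_zero]

lemma polyDOp_mul_X (Q : MvPolynomial (MIdx n r) ℂ) (q : MIdx n r) (h : Hol f z) :
    polyDOp (Q * MvPolynomial.X q) f z = polyDOp Q (pdT q f) z := by
  induction Q using MvPolynomial.induction_on' with
  | monomial d c =>
    rw [MvPolynomial.X, MvPolynomial.monomial_mul, polyDOp_monomial, polyDOp_monomial,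
      monOp_succ d q h, mul_one]
  | add p q hp hq => rw [add_mul, polyDOp_add, polyDOp_add, hp, hq]

lemma polyDOp_congr (Q : MvPolynomial (MIdx n r) ℂ) (h : f =ᶠ[𝓝 z] g) :
    polyDOp Q f z = polyDOp Q g z := by
  unfold polyDOp
  refine Finset.sum_congr rfl fun d _ => ?_
  rw [monOp_eq, (opL_congr _ d h).self_of_nhds]

lemma polyDOp_C_mul (c : ℂ) (Q : MvPolynomial (MIdx n r) ℂ) (f : (MIdx n r → ℂ) → ℂ)
    (z : MIdx n r → ℂ) : polyDOp (MvPolynomial.C c * Q) f z = c * polyDOp Q f z := by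
  induction Q using MvPolynomial.induction_on' with
  | monomial d a =>
    rw [MvPolynomial.C_mul_monomial, polyDOp_monomial, polyDOp_monomial, mul_assoc]
  | add p q hp hq => rw [mul_add, polyDOp_add, polyDOp_add, hp, hq, mul_add]

lemma polyDOp_zero (f : (MIdx n r → ℂ) → ℂ) (z : MIdx n r → ℂ) : polyDOp 0 f z = 0 := by
  simp [polyDOp]

lemma polyDOp_sum {ι : Type*} (s : Finset ι) (Q : ι → MvPolynomial (MIdx n r) ℂ)
    (f : (MIdx n r → ℂ) → ℂ) (z : MIdx n r → ℂ) :
    polyDOp (∑ i ∈ s, Q i) f z = ∑ i ∈ s, polyDOp (Q i) f z := by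
  classical
  induction s using Finset.induction_on with
  | empty => simp [polyDOp_zero]
  | insert a s ha ih => rw [Finset.sum_insert ha, Finset.sum_insert ha, polyDOp_add, ih]

lemma polyDOp_hol (Q : MvPolynomial (MIdx n r) ℂ) (h : Hol f z) : Hol (polyDOp Q f) z := by
  unfold polyDOp
  refine Hol.sum _ fun d _ => (Hol.const _).mul ?_
  exact opL_hol _ d h

lemma pdT_add (q : MIdx n r) (h : Hol f z) (h' : Hol g z) :
    pdT q (fun w => f w + g w) =ᶠ[𝓝 z] fun w => pdT q f w + pdT q g w := by
  filter_upwards [h, h'] with w hw hw'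
  simp [pdT, pd, fderiv_fun_add hw hw']

lemma pdT_mul (q : MIdx n r) (h : Hol f z) (h' : Hol g z) :
    pdT q (fun w => f w * g w) =ᶠ[𝓝 z] fun w => f w * pdT q g w + pdT q f w * g w := by
  filter_upwards [h, h'] with w hw hw'
  simp [pdT, pd, fderiv_fun_mul hw hw', mul_comm]

lemma polyDOp_fadd (Q : MvPolynomial (MIdx n r) ℂ) (h : Hol f z) (h' : Hol g z) :
    polyDOp Q (fun w => f w + g w) z = polyDOp Q f z + polyDOp Q g z := by
  induction Q using MvPolynomial.induction_on generalizing f g with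
  | C a => simp only [polyDOp_C]; ring
  | add p q hp hq => rw [polyDOp_add, polyDOp_add, polyDOp_add, hp h h', hq h h']; ring
  | mul_X p q hp =>
    rw [polyDOp_mul_X p q (h.add h'), polyDOp_mul_X p q h, polyDOp_mul_X p q h',
      polyDOp_congr p (pdT_add q h h'), hp (pdT_hol q h) (pdT_hol q h')]

lemma polyDOp_fsmul (Q : MvPolynomial (MIdx n r) ℂ) (c : ℂ) (h : Hol f z) :
    polyDOp Q (fun w => c * f w) z = c * polyDOp Q f z := by
  induction Q using MvPolynomial.induction_on generalizing f with
  | C a => simp only [polyDOp_C]; ring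
  | add p q hp hq => rw [polyDOp_add, polyDOp_add, hp h, hq h]; ring
  | mul_X p q hp =>
    have : pdT q (fun w => c * f w) =ᶠ[𝓝 z] fun w => c * pdT q f w := by
      refine (pdT_mul q (Hol.const c) h).trans ?_
      refine Eventually.of_forall fun w => ?_
      simp [pdT, pd]
    rw [polyDOp_mul_X p q ((Hol.const c).mul h), polyDOp_mul_X p q h,
      polyDOp_congr p this, hp (pdT_hol q h)]

lemma polyDOp_fzero (Q : MvPolynomial (MIdx n r) ℂ) (z : MIdx n r → ℂ) :
    polyDOp Q (fun _ => 0) z = 0 := by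
  simpa using polyDOp_fsmul (z := z) Q 0 (Hol.const (0:ℂ))

lemma polyDOp_fsum {ι : Type*} (s : Finset ι) (Q : MvPolynomial (MIdx n r) ℂ)
    {F : ι → (MIdx n r → ℂ) → ℂ} (h : ∀ i ∈ s, Hol (F i) z) :
    polyDOp Q (fun w => ∑ i ∈ s, F i w) z = ∑ i ∈ s, polyDOp Q (F i) z := by
  classical
  induction s using Finset.induction_on with
  | empty => simp [polyDOp_fzero]
  | insert a s ha ih =>
    have h1 := fun i hi => h i (Finset.mem_insert_of_mem hi)
    simp only [Finset.sum_insert ha]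
    rw [polyDOp_fadd Q (h a (Finset.mem_insert_self a s)) (Hol.sum s h1), ih h1]

def tq (q : MIdx n r) : MIdx n r := (q.1, q.2.2, q.2.1)

lemma hol_coord (a : MIdx n r) : Hol (fun w : MIdx n r → ℂ => w a) z :=
  Eventually.of_forall fun w => by fun_prop

/-- Leibniz rule for multiplication by a coordinate. -/
lemma polyDOp_coord (Q : MvPolynomial (MIdx n r) ℂ) (a : MIdx n r) (h : Hol f z) :
    polyDOp Q (fun w => w (tq a) * f w) z =
      z (tq a) * polyDOp Q f z + polyDOp (MvPolynomial.pderiv a Q) f z := by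
  induction Q using MvPolynomial.induction_on generalizing f with
  | C c => simp only [polyDOp_C, MvPolynomial.pderiv_C, polyDOp_zero]; ring
  | add p q hp hq => rw [polyDOp_add, polyDOp_add, map_add, polyDOp_add, hp h, hq h]; ring
  | mul_X p q hp =>
    have h1 : pdT q (fun w => w (tq a) * f w) =ᶠ[𝓝 z]
        fun w => w (tq a) * pdT q f w + (if q = a then 1 else 0) * f w := by
      refine (pdT_mul q (hol_coord (tq a)) h).trans ?_
      refine Eventually.of_forall fun w => ?_
      have : pdT q (fun w : MIdx n r → ℂ => w (tq a)) w = if q = a then 1 else 0 := by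
        have : HasFDerivAt (fun w : MIdx n r → ℂ => w (tq a))
          (ContinuousLinearMap.proj (R := ℂ) (φ := fun _ : MIdx n r => ℂ) (tq a)) w :=
          hasFDerivAt_apply _ _
        unfold pdT pd
        rw [this.fderiv, ContinuousLinearMap.proj_apply, Pi.single_apply]
        unfold tq
        refine if_congr ?_ rfl rfl
        obtain ⟨i, s, t⟩ := q
        obtain ⟨i', s', t'⟩ := a
        simp only [Prod.mk.injEq]
        tauto
      simp only [this]
    rw [polyDOp_mul_X p q ((hol_coord (tq a)).mul h), polyDOp_mul_X p q h, polyDOp_congr p h1,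
      polyDOp_fadd p ((hol_coord (tq a)).mul (pdT_hol q h)) ((Hol.const _).mul h),
      hp (pdT_hol q h), polyDOp_fsmul p _ h, Derivation.leibniz, polyDOp_add, smul_eq_mul,
      smul_eq_mul, mul_comm (MvPolynomial.X q), polyDOp_mul_X _ q h, MvPolynomial.pderiv_X]
    by_cases hqa : q = a
    · subst hqa; simp; ring
    · simp [hqa, polyDOp_zero]

end opers

section lin
open Filter Topology
variable {n r : ℕ}

/-- linear substitution `h ↦ (a h_i b)_i` -/
def linSub (a b : Matrix (Fin n) (Fin n) ℂ) : (MIdx n r → ℂ) →ₗ[ℂ] (MIdx n r → ℂ) where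
  toFun h := fun p => (a * toMat h p.1 * b) p.2.1 p.2.2
  map_add' h h' := by
    funext p
    have : toMat (h + h') p.1 = toMat h p.1 + toMat h' p.1 := by ext; simp [toMat]
    simp [this, mul_add, add_mul]
  map_smul' c h := by
    funext p
    have : toMat (c • h) p.1 = c • toMat h p.1 := by ext; simp [toMat]
    simp [this]

lemma linSub_single (a b : Matrix (Fin n) (Fin n) ℂ) (q : MIdx n r) :
    linSub a b (Pi.single (tq q) 1) = ∑ p : Fin n, ∑ q' : Fin n,
      (b q.2.1 p * aᵀ q.2.2 q') • (Pi.single (tq (q.1, p, q')) 1 : MIdx n r → ℂ) := by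
  funext x
  obtain ⟨i, s, t⟩ := q
  obtain ⟨j, c, d⟩ := x
  simp only [linSub, LinearMap.coe_mk, AddHom.coe_mk, tq, Finset.sum_apply, Pi.smul_apply,
    Pi.single_apply, Prod.mk.injEq, smul_eq_mul, mul_ite, mul_one, mul_zero, Matrix.transpose_apply]
  by_cases hij : j = i
  · subst hij
    simp only [true_and]
    have : toMat (Pi.single (j, t, s) 1 : MIdx n r → ℂ) j = Matrix.single t s 1 := by
      ext x y
      simp [toMat, Pi.single_apply, Matrix.single_apply, eq_comm]
    rw [this]
    rw [Finset.sum_eq_single d, Finset.sum_eq_single c]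
    · simp [Matrix.mul_apply, Matrix.single_apply, mul_comm, ite_and]
    · intro x _ hx; simp [Ne.symm hx]
    · simp
    · intro x _ hx
      simp [Ne.symm hx]
    · simp
  · have : toMat (Pi.single (i, t, s) 1 : MIdx n r → ℂ) j = 0 := by
      ext x y
      simp [toMat, hij]
    simp [this, hij]

lemma polyDOp_lin (Q : MvPolynomial (MIdx n r) ℂ) (a b : Matrix (Fin n) (Fin n) ℂ)
    (w0 : MIdx n r → ℂ) {G : (MIdx n r → ℂ) → ℂ} (z : MIdx n r → ℂ)
    (h : Hol G (w0 + linSub a b z)) :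
    polyDOp Q (fun x => G (w0 + linSub a b x)) z =
      polyDOp (MvPolynomial.aeval
        (fun q : MIdx n r =>
          ∑ p : Fin n, ∑ q' : Fin n,
            MvPolynomial.C (b q.2.1 p * aᵀ q.2.2 q') * MvPolynomial.X (q.1, p, q')) Q)
        G (w0 + linSub a b z) := by
  have hL : ∀ x, HasFDerivAt (fun x : MIdx n r → ℂ => w0 + linSub a b x)
      (LinearMap.toContinuousLinearMap (linSub a b)) x := fun x =>
    (LinearMap.toContinuousLinearMap (linSub a b)).hasFDerivAt.const_add w0
  have hcomp : ∀ {G : (MIdx n r → ℂ) → ℂ}, Hol G (w0 + linSub a b z) →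
      Hol (fun x => G (w0 + linSub a b x)) z := fun hG =>
    hG.comp (φ := fun x => w0 + linSub a b x) (Eventually.of_forall fun x => (hL x).differentiableAt)
  induction Q using MvPolynomial.induction_on generalizing G with
  | C c => simp only [polyDOp_C, MvPolynomial.algHom_C, MvPolynomial.algebraMap_eq]
  | add p q hp hq => rw [polyDOp_add, map_add, polyDOp_add, hp h, hq h]
  | mul_X p q hp =>
    rw [polyDOp_mul_X p q (hcomp h), map_mul, MvPolynomial.aeval_X]
    have h1 : pdT q (fun x => G (w0 + linSub a b x)) =ᶠ[𝓝 z] fun x =>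
        (fun y => ∑ i : Fin n, ∑ q' : Fin n, (b q.2.1 i * aᵀ q.2.2 q') * pdT (q.1, i, q') G y)
          (w0 + linSub a b x) := by
      filter_upwards [(hL z).continuousAt.eventually h] with x hx
      have := (hx.hasFDerivAt.comp x (hL x)).fderiv
      have h2 : pdT q (fun x => G (w0 + linSub a b x)) x =
        fderiv ℂ G (w0 + linSub a b x) (linSub a b (Pi.single (tq q) 1)) := by
        unfold pdT pd
        exact congrArg (fun l => l (Pi.single (tq q) 1)) this
      rw [h2, linSub_single]
      simp only [map_sum, map_smul, smul_eq_mul]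
      rfl
    have h3 : ∀ i q' : Fin n, Hol (fun y => (b q.2.1 i * aᵀ q.2.2 q') * pdT (q.1, i, q') G y)
        (w0 + linSub a b z) := fun i q' => (Hol.const _).mul (pdT_hol _ h)
    rw [polyDOp_congr p h1, hp (Hol.sum _ fun i _ => Hol.sum _ fun q' _ => h3 i q'),
      polyDOp_fsum _ _ fun i _ => Hol.sum _ fun q' _ => h3 i q', Finset.mul_sum, polyDOp_sum]
    refine Finset.sum_congr rfl fun i _ => ?_
    rw [polyDOp_fsum _ _ fun q' _ => h3 i q', Finset.mul_sum, polyDOp_sum]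
    refine Finset.sum_congr rfl fun q' _ => ?_
    rw [polyDOp_fsmul _ _ (pdT_hol _ h), mul_left_comm, polyDOp_C_mul, polyDOp_mul_X _ _ h]

/-- differentiating under `Q(∂)` with respect to a parameter -/
lemma polyDOp_param (Q : MvPolynomial (MIdx n r) ℂ) {K : ℂ × (MIdx n r → ℂ) → ℂ} {t : ℂ}
    {z : MIdx n r → ℂ} (h : Hol K (t, z)) :
    HasDerivAt (fun s => polyDOp Q (fun x => K (s, x)) z)
      (polyDOp Q (fun x => fderiv ℂ K (t, x) (1, 0)) z) t := by
  have hsl : ∀ {K : ℂ × (MIdx n r → ℂ) → ℂ} {s : ℂ}, Hol K (s, z) → Hol (fun x => K (s, x)) z :=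
    fun {K s} h => h.comp (φ := fun x => (s, x)) (Eventually.of_forall fun x => by fun_prop)
  have hcont : ContinuousAt (fun s : ℂ => (s, z)) t := by fun_prop
  induction Q using MvPolynomial.induction_on generalizing K with
  | C c =>
    simp only [polyDOp_C]
    have h1 : HasDerivAt (fun s : ℂ => (s, z)) ((1 : ℂ), (0 : MIdx n r → ℂ)) t :=
      (hasDerivAt_id t).prodMk (hasDerivAt_const t z)
    exact (h.diff.hasFDerivAt.comp_hasDerivAt t h1).const_mul c
  | add p q hp hq =>
    simp only [polyDOp_add]
    exact (hp h).fun_add (hq h)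
  | mul_X p q hp =>
    have hpd : ∀ {s : ℂ}, Hol K (s, z) → pdT q (fun x => K (s, x)) =ᶠ[𝓝 z]
        fun x => fderiv ℂ K (s, x) (0, Pi.single (tq q) 1) := by
      intro s hs
      have hc : ContinuousAt (fun x : MIdx n r → ℂ => (s, x)) z := by fun_prop
      filter_upwards [hc.eventually hs] with x hx
      have h1 : HasFDerivAt (fun x : MIdx n r → ℂ => (s, x))
          (ContinuousLinearMap.inr ℂ ℂ (MIdx n r → ℂ)) x := hasFDerivAt_prodMk_right s x
      have := (hx.hasFDerivAt.comp x h1).fderiv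
      exact congrArg (fun l => l (Pi.single (tq q) 1)) this
    have hK' := hp (h.fd (0, Pi.single (tq q) 1))
    have e1 : (fun s => polyDOp (p * MvPolynomial.X q) (fun x => K (s, x)) z) =ᶠ[𝓝 t]
        fun s => polyDOp p (fun x => fderiv ℂ K (s, x) (0, Pi.single (tq q) 1)) z := by
      filter_upwards [hcont.eventually h.ev] with s hs
      rw [polyDOp_mul_X _ _ (hsl hs), polyDOp_congr p (hpd hs)]
    refine (hK'.congr_of_eventuallyEq e1).congr_deriv ?_
    rw [polyDOp_mul_X _ _ (hsl (h.fd (1, 0)))]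
    apply polyDOp_congr
    have hc : ContinuousAt (fun x : MIdx n r → ℂ => (t, x)) z := by fun_prop
    filter_upwards [hc.eventually h.ev] with x hx
    have h1 : HasFDerivAt (fun x : MIdx n r → ℂ => (t, x))
        (ContinuousLinearMap.inr ℂ ℂ (MIdx n r → ℂ)) x := hasFDerivAt_prodMk_right t x
    have := ((hx.fd (1, 0)).diff.hasFDerivAt.comp x h1).fderiv
    rw [hx.fderiv_comm]
    exact (congrArg (fun l => l (Pi.single (tq q) 1)) this).symm
end lin

section alg
open MvPolynomial
variable {n r : ℕ}

/-- chain rule for polynomial substitution -/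
lemma pderiv_aeval_chain {σ τ : Type*} [Fintype σ] (g : σ → MvPolynomial τ ℂ) (v : τ)
    (Q : MvPolynomial σ ℂ) :
    pderiv v (aeval g Q) = ∑ q, aeval g (pderiv q Q) * pderiv v (g q) := by
  classical
  induction Q using MvPolynomial.induction_on with
  | C c => simp [algHom_C, algebraMap_eq]
  | add p q hp hq => simp only [map_add, hp, hq, add_mul, Finset.sum_add_distrib]
  | mul_X p q hp =>
    simp only [map_mul, aeval_X, Derivation.leibniz, smul_eq_mul, map_add, hp, add_mul,
      Finset.sum_add_distrib, pderiv_X]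
    congr 1
    · rw [Finset.sum_eq_single q]
      · simp
      · intro b _ hb
        simp [Pi.single_apply, hb]
      · simp
    · rw [Finset.mul_sum]
      exact Finset.sum_congr rfl fun _ _ => by ring

def gP (k : Fin r → ℕ) (q : MIdx n r) : MvPolynomial (PVars n r k) ℂ :=
  ∑ u : Fin (k q.1), X (Sum.inl (q.2.1, ⟨q.1, u⟩)) * X (Sum.inr (q.2.2, ⟨q.1, u⟩))

lemma toP_eq (k : Fin r → ℕ) (Q : MvPolynomial (MIdx n r) ℂ) : toP k Q = aeval (gP k) Q := rfl

lemma pderiv_gP_inr (k : Fin r → ℕ) (q : MIdx n r) (t : Fin n) (i : Fin r) (u : Fin (k i)) :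
    pderiv (Sum.inr (t, ⟨i, u⟩)) (gP k q) =
      if q.1 = i then (if q.2.2 = t then X (Sum.inl (q.2.1, ⟨i, u⟩)) else 0) else 0 := by
  classical
  obtain ⟨j, a, b⟩ := q
  simp only [gP, map_sum, Derivation.leibniz, smul_eq_mul, pderiv_X, Pi.single_apply]
  by_cases h : j = i
  · subst h
    by_cases h2 : b = t
    · subst h2
      simp
    · simp [h2]
  · simp [h]

lemma pderiv_gP_inl (k : Fin r → ℕ) (q : MIdx n r) (s : Fin n) (i : Fin r) (u : Fin (k i)) :
    pderiv (Sum.inl (s, ⟨i, u⟩)) (gP k q) =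
      if q.1 = i then (if q.2.1 = s then X (Sum.inr (q.2.2, ⟨i, u⟩)) else 0) else 0 := by
  classical
  obtain ⟨j, a, b⟩ := q
  simp only [gP, map_sum, Derivation.leibniz, smul_eq_mul, pderiv_X, Pi.single_apply]
  by_cases h : j = i
  · subst h
    by_cases h2 : a = s
    · subst h2
      simp
    · simp [h2]
  · simp [h]

def Dop (k : Fin r → ℕ) (s t : Fin n) (Q : MvPolynomial (MIdx n r) ℂ) :
    MvPolynomial (MIdx n r) ℂ :=
  ∑ i : Fin r, (C (k i : ℂ) * pderiv (i, s, t) Q +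
    ∑ a : Fin n, ∑ b : Fin n, X (i, a, b) * pderiv (i, s, b) (pderiv (i, a, t) Q))

lemma toP_pderiv_inr (k : Fin r → ℕ) (Q : MvPolynomial (MIdx n r) ℂ) (t : Fin n) (i : Fin r)
    (u : Fin (k i)) : pderiv (Sum.inr (t, ⟨i, u⟩)) (toP k Q) =
      ∑ a, toP k (pderiv (i, a, t) Q) * X (Sum.inl (a, ⟨i, u⟩)) := by
  rw [toP_eq, pderiv_aeval_chain]
  simp only [pderiv_gP_inr, Fintype.sum_prod_type, mul_ite, mul_zero]
  rw [Finset.sum_eq_single i]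
  · simp [toP_eq]
  · intro j _ hj; simp [hj]
  · simp

lemma toP_pderiv_inl (k : Fin r → ℕ) (Q : MvPolynomial (MIdx n r) ℂ) (s : Fin n) (i : Fin r)
    (u : Fin (k i)) : pderiv (Sum.inl (s, ⟨i, u⟩)) (toP k Q) =
      ∑ b, toP k (pderiv (i, s, b) Q) * X (Sum.inr (b, ⟨i, u⟩)) := by
  rw [toP_eq, pderiv_aeval_chain]
  simp only [pderiv_gP_inl, Fintype.sum_prod_type, mul_ite, mul_zero]
  rw [Finset.sum_eq_single i]
  · rw [Finset.sum_eq_single s]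
    · simp [toP_eq]
    · intro j _ hj; simp [hj]
    · simp
  · intro j _ hj; simp [hj]
  · simp

lemma toP_Dop (k : Fin r → ℕ) (Q : MvPolynomial (MIdx n r) ℂ) (s t : Fin n) :
    ∑ u : ColIdx r k, pderiv (Sum.inl (s, u)) (pderiv (Sum.inr (t, u)) (toP k Q)) =
      toP k (Dop k s t Q) := by
  classical
  have key : ∀ (i : Fin r) (u : Fin (k i)),
      pderiv (Sum.inl (s, ⟨i, u⟩)) (pderiv (Sum.inr (t, ⟨i, u⟩)) (toP k Q)) =
      toP k (pderiv (i, s, t) Q) + ∑ a, ∑ b, toP k (pderiv (i, s, b) (pderiv (i, a, t) Q)) *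
        (X (Sum.inl (a, ⟨i, u⟩)) * X (Sum.inr (b, ⟨i, u⟩))) := by
    intro i u
    rw [toP_pderiv_inr]
    simp only [map_sum, Derivation.leibniz, smul_eq_mul, pderiv_X, toP_pderiv_inl,
      Finset.sum_add_distrib]
    congr 1
    · rw [Finset.sum_eq_single s]
      · simp
      · intro b _ hb
        simp [Pi.single_apply, hb]
      · simp
    · refine Finset.sum_congr rfl fun a _ => ?_
      rw [Finset.mul_sum]
      exact Finset.sum_congr rfl fun _ _ => by ring
  rw [Fintype.sum_sigma]
  simp only [key]
  simp only [Dop, toP_eq, map_sum, map_add, map_mul, aeval_X, algHom_C, algebraMap_eq,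
    Finset.sum_add_distrib]
  congr 1
  · simp
  · refine Finset.sum_congr rfl fun i _ => ?_
    rw [Finset.sum_comm]
    refine Finset.sum_congr rfl fun a _ => ?_
    rw [Finset.sum_comm]
    refine Finset.sum_congr rfl fun b _ => ?_
    simp only [gP]
    rw [← Finset.mul_sum, mul_comm]

lemma toP_inj (k : Fin r → ℕ) (hk : ∀ i, n ≤ k i) (Q : MvPolynomial (MIdx n r) ℂ)
    (h : toP k Q = 0) : Q = 0 := by
  classical
  apply MvPolynomial.funext
  intro R
  let pt : PVars n r k → ℂ := Sum.elim
    (fun x => if h : (x.2.2 : ℕ) < n then R (x.2.1, x.1, ⟨x.2.2, h⟩) else 0)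
    (fun y => if (y.2.2 : ℕ) = y.1 then 1 else 0)
  have h1 : eval pt (toP k Q) = eval R Q := by
    have : (fun q => eval pt (gP k q)) = R := by
      funext q
      obtain ⟨i, a, b⟩ := q
      simp only [gP, map_sum, map_mul, eval_X, pt, Sum.elim_inl, Sum.elim_inr]
      rw [Finset.sum_eq_single (⟨b, lt_of_lt_of_le b.2 (hk i)⟩ : Fin (k i))]
      · simp
      · intro u _ hu
        have : (u : ℕ) ≠ b := fun h => hu (Fin.ext h)
        simp [this]
      · simp
    rw [toP_eq]
    conv_rhs => rw [← this]
    clear h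
    induction Q using MvPolynomial.induction_on with
    | C c => simp [algHom_C, algebraMap_eq]
    | add p q hp hq => simp only [map_add, hp, hq]
    | mul_X p q hp => simp only [map_mul, hp, aeval_X, eval_X]
  rw [← h1, h, map_zero, map_zero]

lemma Dop_eq_zero (k : Fin r → ℕ) (hk : ∀ i, n ≤ k i) (Q : MvPolynomial (MIdx n r) ℂ)
    (h : Pluriharmonic (toP k Q)) (s t : Fin n) : Dop k s t Q = 0 :=
  toP_inj k hk _ ((toP_Dop k Q s t).symm.trans (h s t))

end alg

section xi
open Filter Topology
variable {n r : ℕ}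

def xi (k : Fin r → ℕ) (S : Matrix (Fin n) (Fin n) ℂ) (G : (MIdx n r → ℂ) → ℂ)
    (h : MIdx n r → ℂ) : ℂ :=
  ∑ c, ∑ d, S c d * ∑ i, ((k i : ℂ) * (h (tq (i, c, d)) * G h) +
    ∑ a, ∑ b, h (tq (i, a, d)) * (h (tq (i, c, b)) * pdT (i, a, b) G h))

lemma polyDOp_coord0 (Q : MvPolynomial (MIdx n r) ℂ) (a : MIdx n r) {f : (MIdx n r → ℂ) → ℂ}
    (h : Hol f 0) : polyDOp Q (fun w => w (tq a) * f w) 0 =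
      polyDOp (MvPolynomial.pderiv a Q) f 0 := by
  rw [polyDOp_coord Q a h]; simp

lemma polyDOp_xi (k : Fin r → ℕ) (S : Matrix (Fin n) (Fin n) ℂ)
    (Q : MvPolynomial (MIdx n r) ℂ) {G : (MIdx n r → ℂ) → ℂ} (h : Hol G 0) :
    polyDOp Q (xi k S G) 0 = ∑ c, ∑ d, S c d * polyDOp (Dop k c d Q) G 0 := by
  have h1 : ∀ q, Hol (fun w : MIdx n r → ℂ => w (tq q) * G w) 0 := fun q => (hol_coord _).mul h
  have h2 : ∀ q q', Hol (fun w : MIdx n r → ℂ => w (tq q) * pdT q' G w) 0 :=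
    fun q q' => (hol_coord _).mul (pdT_hol _ h)
  have h3 : ∀ q q' q'', Hol (fun w : MIdx n r → ℂ => w (tq q'') * (w (tq q) * pdT q' G w)) 0 :=
    fun q q' q'' => (hol_coord _).mul (h2 q q')
  have h4 : ∀ (c : ℂ) q, Hol (fun w : MIdx n r → ℂ => c * (w (tq q) * G w)) 0 :=
    fun c q => (Hol.const c).mul (h1 q)
  have h5 : ∀ (i : Fin r) (c d a : Fin n), Hol (fun w : MIdx n r → ℂ =>
      ∑ b, w (tq (i, a, d)) * (w (tq (i, c, b)) * pdT (i, a, b) G w)) 0 :=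
    fun i c d a => Hol.sum _ fun b _ => h3 _ _ _
  have h6 : ∀ (i : Fin r) (c d : Fin n), Hol (fun w : MIdx n r → ℂ =>
      ∑ a, ∑ b, w (tq (i, a, d)) * (w (tq (i, c, b)) * pdT (i, a, b) G w)) 0 :=
    fun i c d => Hol.sum _ fun b _ => h5 _ _ _ _
  have h7 : ∀ (i : Fin r) (c d : Fin n), Hol (fun w : MIdx n r → ℂ =>
      (k i : ℂ) * (w (tq (i, c, d)) * G w) +
      ∑ a, ∑ b, w (tq (i, a, d)) * (w (tq (i, c, b)) * pdT (i, a, b) G w)) 0 :=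
    fun i c d => (h4 _ _).add (h6 _ _ _)
  have h8 : ∀ (c d : Fin n), Hol (fun w : MIdx n r → ℂ =>
      ∑ i, ((k i : ℂ) * (w (tq (i, c, d)) * G w) +
      ∑ a, ∑ b, w (tq (i, a, d)) * (w (tq (i, c, b)) * pdT (i, a, b) G w))) 0 :=
    fun c d => Hol.sum _ fun i _ => h7 i c d
  have h9 : ∀ (c d : Fin n), Hol (fun w : MIdx n r → ℂ => S c d *
      ∑ i, ((k i : ℂ) * (w (tq (i, c, d)) * G w) +
      ∑ a, ∑ b, w (tq (i, a, d)) * (w (tq (i, c, b)) * pdT (i, a, b) G w))) 0 :=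
    fun c d => (Hol.const _).mul (h8 c d)
  unfold xi
  rw [polyDOp_fsum _ _ fun c _ => Hol.sum _ fun d _ => h9 c d]
  refine Finset.sum_congr rfl fun c _ => ?_
  rw [polyDOp_fsum _ _ fun d _ => h9 c d]
  refine Finset.sum_congr rfl fun d _ => ?_
  rw [polyDOp_fsmul _ _ (h8 c d), polyDOp_fsum _ _ fun i _ => h7 i c d, Dop, polyDOp_sum]
  congr 1
  refine Finset.sum_congr rfl fun i _ => ?_
  rw [polyDOp_fadd _ (h4 _ _) (h6 _ _ _), polyDOp_fsmul _ _ (h1 _), polyDOp_coord0 _ _ h,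
    polyDOp_add, polyDOp_C_mul, polyDOp_fsum _ _ fun a _ => h5 i c d a, polyDOp_sum]
  congr 1
  refine Finset.sum_congr rfl fun a _ => ?_
  rw [polyDOp_fsum _ _ fun b _ => h3 _ _ _, polyDOp_sum]
  refine Finset.sum_congr rfl fun b _ => ?_
  rw [polyDOp_coord0 _ _ (h2 _ _), polyDOp_coord0 _ _ (pdT_hol _ h), mul_comm,
    polyDOp_mul_X _ _ h]

section mat
variable {E : Type*} [NormedAddCommGroup E] [NormedSpace ℂ E] {m : Type*} [Fintype m] [DecidableEq m]

lemma diff_det {φ : E → Matrix m m ℂ} {x : E}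
    (h : ∀ i j, DifferentiableAt ℂ (fun y => φ y i j) x) :
    DifferentiableAt ℂ (fun y => (φ y).det) x := by
  simp only [Matrix.det_apply]
  refine DifferentiableAt.fun_sum fun σ _ => DifferentiableAt.const_smul ?_ _
  have := fun i (_ : i ∈ Finset.univ) => h (σ i) i
  have h2 := HasFDerivAt.finsetProd (u := Finset.univ) (x := x) fun i hi => (this i hi).hasFDerivAt
  exact h2.differentiableAt

lemma diff_inv {φ : E → Matrix m m ℂ} {x : E}
    (h : ∀ i j, DifferentiableAt ℂ (fun y => φ y i j) x) (h0 : (φ x).det ≠ 0) (i j : m) :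
    DifferentiableAt ℂ (fun y => (φ y)⁻¹ i j) x := by
  have : ∀ y, (φ y)⁻¹ i j = (φ y).det⁻¹ * ((φ y).updateRow j (Pi.single i 1)).det := by
    intro y
    rw [Matrix.inv_def, Matrix.smul_apply, Matrix.adjugate_apply, Ring.inverse_eq_inv', smul_eq_mul]
  simp only [this]
  refine ((diff_det h).inv h0).fun_mul (diff_det fun a b => ?_)
  by_cases ha : a = j
  · subst ha
    simp
  · simpa [Matrix.updateRow_apply, ha] using h a b

lemma diff_mul {l p : Type*} {φ : E → Matrix l m ℂ} {ψ : E → Matrix m p ℂ} {x : E}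
    (h : ∀ i j, DifferentiableAt ℂ (fun y => φ y i j) x)
    (h' : ∀ i j, DifferentiableAt ℂ (fun y => ψ y i j) x) (i : l) (j : p) :
    DifferentiableAt ℂ (fun y => (φ y * ψ y) i j) x := by
  simp only [Matrix.mul_apply]
  exact DifferentiableAt.fun_sum fun a _ => (h _ _).fun_mul (h' _ _)

lemma deriv_det0 (M : Matrix m m ℂ) :
    HasDerivAt (fun s : ℂ => (1 + s • M).det) M.trace 0 := by
  rw [show (fun s : ℂ => (1 + s • M).det) = _ from funext fun s => Matrix.det_one_add_smul s M]
  have h1 : HasDerivAt (fun s : ℂ => 1 + M.trace * s) (M.trace) 0 := by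
    simpa using ((hasDerivAt_id (0:ℂ)).const_mul M.trace).const_add 1
  have h2 := (Polynomial.hasDerivAt (p := ((1 + (Polynomial.X : Polynomial ℂ) •
    M.map Polynomial.C).det.divX.divX)) (0:ℂ)).fun_mul (hasDerivAt_pow 2 (0:ℂ))
  simpa using h1.fun_add h2

lemma deriv_inv0 (M : Matrix m m ℂ) (i j : m) :
    HasDerivAt (fun s : ℂ => (1 + s • M)⁻¹ i j) (-M i j) 0 := by
  have hd : ∀ i j, DifferentiableAt ℂ (fun s : ℂ => (1 + s • M) i j) 0 := by
    intro i j
    simp only [Matrix.add_apply, Matrix.smul_apply, smul_eq_mul]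
    fun_prop
  have h0 : (1 + (0:ℂ) • M).det ≠ 0 := by simp
  have hi := diff_inv hd h0
  have hev : ∀ᶠ s in 𝓝 (0:ℂ), (1 + s • M).det ≠ 0 :=
    (diff_det hd).continuousAt.eventually_ne h0
  have heq : (fun s : ℂ => (1 + s • M)⁻¹ i j) =ᶠ[𝓝 0]
      fun s => (1 : Matrix m m ℂ) i j - s * (M * (1 + s • M)⁻¹) i j := by
    filter_upwards [hev] with s hs
    have : (1 + s • M) * (1 + s • M)⁻¹ = 1 :=
      Matrix.mul_nonsing_inv _ (isUnit_iff_ne_zero.2 hs)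
    rw [add_mul, one_mul] at this
    have h2 : (1 + s • M)⁻¹ i j = ((1 : Matrix m m ℂ) - s • M * (1 + s • M)⁻¹) i j :=
      congrFun (congrFun (eq_sub_of_add_eq this) i) j
    rw [h2, Matrix.sub_apply, Matrix.smul_mul, Matrix.smul_apply, smul_eq_mul]
  have hM : DifferentiableAt ℂ (fun s : ℂ => (M * (1 + s • M)⁻¹) i j) 0 :=
    diff_mul (φ := fun _ => M) (fun _ _ => by fun_prop) hi i j
  have := ((hasDerivAt_id (0:ℂ)).fun_mul hM.hasDerivAt).const_sub ((1 : Matrix m m ℂ) i j)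
  refine HasDerivAt.congr_of_eventuallyEq ?_ heq
  simpa using this
end mat

def sg (S : Matrix (Fin n) (Fin n) ℂ) (t : ℂ) (h : MIdx n r → ℂ) : MIdx n r → ℂ :=
  fun p => (toMat h p.1 * (1 + t • (S * toMat h p.1))⁻¹) p.2.1 p.2.2

def mf (k : Fin r → ℕ) (S : Matrix (Fin n) (Fin n) ℂ) (t : ℂ) (h : MIdx n r → ℂ) : ℂ :=
  ∏ i, ((1 + t • (S * toMat h i)).det⁻¹) ^ k i

lemma toMat_sg (S : Matrix (Fin n) (Fin n) ℂ) (t : ℂ) (h : MIdx n r → ℂ) (i : Fin r) :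
    toMat (sg S t h) i = toMat h i * (1 + t • (S * toMat h i))⁻¹ := by
  ext a b; rfl

lemma sg_group_aux (S H : Matrix (Fin n) (Fin n) ℂ) (s t : ℂ)
    (hd : (1 + s • (S * H)).det ≠ 0) :
    (1 + t • (S * (H * (1 + s • (S * H))⁻¹))) =
      (1 + (t + s) • (S * H)) * (1 + s • (S * H))⁻¹ := by
  have h1 : (1 + s • (S * H)) * (1 + s • (S * H))⁻¹ = 1 :=
      Matrix.mul_nonsing_inv _ (isUnit_iff_ne_zero.2 hd)
  generalize (1 + s • (S * H))⁻¹ = V at *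
  rw [← Matrix.mul_assoc, add_smul, ← add_assoc, add_right_comm, Matrix.add_mul _ _ V, h1,
    Matrix.smul_mul]

lemma sg_group (S : Matrix (Fin n) (Fin n) ℂ) (s t : ℂ) (h : MIdx n r → ℂ)
    (hd : ∀ i, (1 + s • (S * toMat h i)).det ≠ 0) : sg S t (sg S s h) = sg S (t + s) h := by
  funext p
  unfold sg
  have := toMat_sg S s h p.1
  unfold sg at this
  rw [this, sg_group_aux _ _ _ _ (hd _), Matrix.mul_inv_rev,
    Matrix.nonsing_inv_nonsing_inv _ (isUnit_iff_ne_zero.2 (hd _)), Matrix.mul_assoc,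
    ← Matrix.mul_assoc (_⁻¹), Matrix.nonsing_inv_mul _ (isUnit_iff_ne_zero.2 (hd _)), Matrix.one_mul]

lemma mf_group (k : Fin r → ℕ) (S : Matrix (Fin n) (Fin n) ℂ) (s t : ℂ) (h : MIdx n r → ℂ)
    (hd : ∀ i, (1 + s • (S * toMat h i)).det ≠ 0) :
    mf k S s h * mf k S t (sg S s h) = mf k S (t + s) h := by
  unfold mf
  rw [← Finset.prod_mul_distrib]
  refine Finset.prod_congr rfl fun i _ => ?_
  rw [toMat_sg, sg_group_aux _ _ _ _ (hd _), ← mul_pow, Matrix.det_mul, Matrix.det_nonsing_inv,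
    Ring.inverse_eq_inv', mul_inv, inv_inv, mul_comm, mul_assoc, mul_inv_cancel₀ (hd i), mul_one]

lemma sg_deriv (S : Matrix (Fin n) (Fin n) ℂ) (h : MIdx n r → ℂ) :
    HasDerivAt (fun s => sg S s h)
      (fun p => -(toMat h p.1 * S * toMat h p.1) p.2.1 p.2.2) 0 := by
  rw [hasDerivAt_pi]
  intro p
  simp only [sg, Matrix.mul_apply]
  have : ∀ j, HasDerivAt (fun s : ℂ => toMat h p.1 p.2.1 j *
      (1 + s • (S * toMat h p.1))⁻¹ j p.2.2) (toMat h p.1 p.2.1 j * -(S * toMat h p.1) j p.2.2) 0 :=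
    fun j => (deriv_inv0 _ _ _).const_mul _
  refine (HasDerivAt.fun_sum fun j _ => this j).congr_deriv ?_
  simp only [← Matrix.mul_apply, mul_neg, Finset.sum_neg_distrib, Matrix.mul_assoc]

lemma mf_deriv (k : Fin r → ℕ) (S : Matrix (Fin n) (Fin n) ℂ) (h : MIdx n r → ℂ) :
    HasDerivAt (fun s => mf k S s h) (-∑ i, (k i : ℂ) * (S * toMat h i).trace) 0 := by
  unfold mf
  have h1 : ∀ i, HasDerivAt (fun s : ℂ => ((1 + s • (S * toMat h i)).det⁻¹) ^ k i)
      (-((k i : ℂ) * (S * toMat h i).trace)) 0 := by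
    intro i
    have := ((deriv_det0 (S * toMat h i)).fun_inv (by simp)).fun_pow (k i)
    refine this.congr_deriv ?_
    simp
  refine (HasDerivAt.fun_finsetProd fun i _ => h1 i).congr_deriv ?_
  simp
end xi

section ode
open Filter Topology
variable {n r : ℕ}

lemma sum5 {N R : ℕ} (f : Fin N → Fin N → Fin R → Fin N → Fin N → ℂ) :
    ∑ c, ∑ d, ∑ i, ∑ a, ∑ b, f c d i a b = ∑ i, ∑ b, ∑ a, ∑ d, ∑ c, f c d i a b := by
  calc _ = ∑ c, ∑ i, ∑ d, ∑ a, ∑ b, f c d i a b :=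
        Finset.sum_congr rfl fun c _ => Finset.sum_comm
    _ = ∑ i, ∑ c, ∑ d, ∑ a, ∑ b, f c d i a b := Finset.sum_comm
    _ = _ := by
      refine Finset.sum_congr rfl fun i _ => ?_
      calc _ = ∑ d, ∑ c, ∑ a, ∑ b, f c d i a b := Finset.sum_comm
        _ = ∑ d, ∑ a, ∑ c, ∑ b, f c d i a b := Finset.sum_congr rfl fun c _ => Finset.sum_comm
        _ = ∑ a, ∑ d, ∑ c, ∑ b, f c d i a b := Finset.sum_comm
        _ = ∑ a, ∑ d, ∑ b, ∑ c, f c d i a b := Finset.sum_congr rfl fun c _ =>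
          Finset.sum_congr rfl fun d _ => Finset.sum_comm
        _ = ∑ a, ∑ b, ∑ d, ∑ c, f c d i a b := Finset.sum_congr rfl fun c _ => Finset.sum_comm
        _ = _ := Finset.sum_comm

lemma xi_eq (k : Fin r → ℕ) (S : Matrix (Fin n) (Fin n) ℂ) (G : (MIdx n r → ℂ) → ℂ)
    (h : MIdx n r → ℂ) : xi k S G h = (∑ i, (k i : ℂ) * (S * toMat h i).trace) * G h +
      fderiv ℂ G h (fun p => (toMat h p.1 * S * toMat h p.1) p.2.1 p.2.2) := by
  have hv : ∀ v : MIdx n r → ℂ, fderiv ℂ G h v = ∑ i, ∑ b, ∑ a, v (i, b, a) * pdT (i, a, b) G h := by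
    intro v
    conv_lhs => rw [pi_eq_sum_univ' v, map_sum]
    simp only [map_smul, Fintype.sum_prod_type]
    refine Finset.sum_congr rfl fun i _ => Finset.sum_congr rfl fun b _ =>
      Finset.sum_congr rfl fun a _ => ?_
    rw [smul_eq_mul]
    congr 2
  rw [hv]
  unfold xi
  simp only [Finset.sum_add_distrib, mul_add, Finset.mul_sum]
  congr 1
  · simp only [Matrix.trace, Matrix.diag, Matrix.mul_apply, Finset.mul_sum, Finset.sum_mul]
    rw [Finset.sum_congr rfl fun d _ => Finset.sum_comm, Finset.sum_comm]
    refine Finset.sum_congr rfl fun i _ => ?_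
    refine Finset.sum_congr rfl fun c _ => Finset.sum_congr rfl fun d _ => ?_
    simp only [tq, toMat, Matrix.of_apply]
    ring
  · rw [sum5]
    refine Finset.sum_congr rfl fun i _ => Finset.sum_congr rfl fun b _ =>
      Finset.sum_congr rfl fun a _ => ?_
    simp only [Matrix.mul_apply, Finset.sum_mul]
    refine Finset.sum_congr rfl fun d _ => Finset.sum_congr rfl fun c _ => ?_
    simp only [tq, toMat, Matrix.of_apply]
    ring

def KK (k : Fin r → ℕ) (S : Matrix (Fin n) (Fin n) ℂ) (G : (MIdx n r → ℂ) → ℂ)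
    (x : ℂ × (MIdx n r → ℂ)) : ℂ := mf k S x.1 x.2 * G (sg S x.1 x.2)

lemma toMat_zero (i : Fin r) : toMat (0 : MIdx n r → ℂ) i = 0 := by ext; rfl

lemma diff_coordmat (S : Matrix (Fin n) (Fin n) ℂ) (i : Fin r) (x : ℂ × (MIdx n r → ℂ))
    (a b : Fin n) : DifferentiableAt ℂ
      (fun y : ℂ × (MIdx n r → ℂ) => (1 + y.1 • (S * toMat y.2 i)) a b) x := by
  simp only [Matrix.add_apply, Matrix.smul_apply, smul_eq_mul, Matrix.mul_apply, toMat,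
    Matrix.of_apply]
  fun_prop

lemma KK_hol (k : Fin r → ℕ) (S : Matrix (Fin n) (Fin n) ℂ) {G : (MIdx n r → ℂ) → ℂ}
    (hG : Hol G 0) (t : ℂ) : Hol (KK k S G) (t, 0) := by
  have hdet : ∀ i (x : ℂ × (MIdx n r → ℂ)), DifferentiableAt ℂ
      (fun y : ℂ × (MIdx n r → ℂ) => (1 + y.1 • (S * toMat y.2 i)).det) x :=
    fun i x => diff_det (diff_coordmat S i x)
  have hev : ∀ᶠ x in 𝓝 (t, (0 : MIdx n r → ℂ)), ∀ i, (1 + x.1 • (S * toMat x.2 i)).det ≠ 0 := by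
    rw [eventually_all]
    intro i
    refine (hdet i _).continuousAt.eventually_ne ?_
    simp [toMat_zero]
  have h0 : sg S t (0 : MIdx n r → ℂ) = 0 := by
    funext p; simp [sg, toMat_zero]
  have H1 : Hol (fun x : ℂ × (MIdx n r → ℂ) => mf k S x.1 x.2) (t, 0) := by
    unfold mf
    refine Hol.prod _ fun i _ => ?_
    filter_upwards [hev] with x hx
    exact ((hdet i x).inv (hx i)).fun_pow _
  have H2 : Hol (fun x : ℂ × (MIdx n r → ℂ) => G (sg S x.1 x.2)) (t, 0) := by
    have hG' : Hol G ((fun x : ℂ × (MIdx n r → ℂ) => sg S x.1 x.2) (t, 0)) := by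
      simp only [h0]; exact hG
    refine Hol.comp hG' ?_
    filter_upwards [hev] with x hx
    rw [differentiableAt_pi]
    intro p
    refine diff_mul (φ := fun y : ℂ × (MIdx n r → ℂ) => toMat y.2 p.1) (fun a b => ?_)
      (diff_inv (diff_coordmat S p.1 x) (hx _)) _ _
    simp only [toMat, Matrix.of_apply]
    fun_prop
  exact H1.mul H2

lemma KK_deriv (k : Fin r → ℕ) (S : Matrix (Fin n) (Fin n) ℂ) {G : (MIdx n r → ℂ) → ℂ}
    {t : ℂ} {h : MIdx n r → ℂ} (hd : DifferentiableAt ℂ (KK k S G) (t, h)) :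
    fderiv ℂ (KK k S G) (t, h) (1, 0) = -xi k S (fun x => KK k S G (t, x)) h := by
  have hs0 : sg S 0 h = h := by funext p; simp [sg, toMat]
  have hm0 : mf k S 0 h = 1 := by simp [mf]
  have h1 : HasDerivAt (fun s : ℂ => (t + s, h)) ((1 : ℂ), (0 : MIdx n r → ℂ)) 0 :=
    ((hasDerivAt_id (0:ℂ)).const_add t).prodMk (hasDerivAt_const _ h)
  have hd0 : HasFDerivAt (KK k S G) (fderiv ℂ (KK k S G) (t, h)) (t + 0, h) := by
    simpa using hd.hasFDerivAt
  have h2 := hd0.comp_hasDerivAt 0 h1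
  have hd' : DifferentiableAt ℂ (fun x => KK k S G (t, x)) h :=
    hd.comp (f := fun x => (t, x)) h (by fun_prop)
  have hd'' : HasFDerivAt (fun x => KK k S G (t, x)) (fderiv ℂ (fun x => KK k S G (t, x)) h)
      (sg S 0 h) := by rw [hs0]; exact hd'.hasFDerivAt
  have h3 := (mf_deriv k S h).fun_mul (hd''.comp_hasDerivAt 0 (sg_deriv S h))
  have hev : ∀ᶠ s in 𝓝 (0 : ℂ), ∀ i, (1 + s • (S * toMat h i)).det ≠ 0 := by
    rw [eventually_all]
    intro i
    refine (deriv_det0 _).continuousAt.eventually_ne ?_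
    simp
  have heq : (fun s => mf k S s h * ((fun x => KK k S G (t, x)) ∘ fun s => sg S s h) s) =ᶠ[𝓝 0]
      (KK k S G ∘ fun s => (t + s, h)) := by
    filter_upwards [hev] with s hs
    simp only [Function.comp, KK]
    rw [← mul_assoc, mf_group k S s t h hs, sg_group S s t h hs]
  have h4 := h2.unique (h3.congr_of_eventuallyEq heq.symm)
  rw [h4, xi_eq]
  simp only [Function.comp, hs0, hm0]
  have : (fun p : MIdx n r => -(toMat h p.1 * S * toMat h p.1) p.2.1 p.2.2) =
    -(fun p : MIdx n r => (toMat h p.1 * S * toMat h p.1) p.2.1 p.2.2) := rfl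
  rw [this, map_neg]
  ring

theorem polyDOp_invariant (k : Fin r → ℕ) (hk : ∀ i, n ≤ k i) (Q : MvPolynomial (MIdx n r) ℂ)
    (hQ : Pluriharmonic (toP k Q)) (S : Matrix (Fin n) (Fin n) ℂ) {G : (MIdx n r → ℂ) → ℂ}
    (hG : Hol G 0) :
    polyDOp Q (fun h => mf k S 1 h * G (sg S 1 h)) 0 = polyDOp Q G 0 := by
  have hK := KK_hol k S hG
  have hder : ∀ t, HasDerivAt (fun s => polyDOp Q (fun x => KK k S G (s, x)) 0) 0 t := by
    intro t
    refine (polyDOp_param Q (hK t)).congr_deriv ?_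
    have hc : ContinuousAt (fun x : MIdx n r → ℂ => (t, x)) 0 := by fun_prop
    have h1 : (fun x => fderiv ℂ (KK k S G) (t, x) (1, 0)) =ᶠ[𝓝 0]
        fun x => xi k (-S) (fun x => KK k S G (t, x)) x := by
      filter_upwards [hc.eventually (hK t)] with x hx
      rw [KK_deriv k S hx, xi, xi]
      simp [Finset.sum_neg_distrib]
    have hsl : Hol (fun x => KK k S G (t, x)) 0 :=
      (hK t).comp (φ := fun x => (t, x)) (Eventually.of_forall fun x => by fun_prop)
    rw [polyDOp_congr Q h1]
    refine (polyDOp_xi k (-S) Q hsl).trans ?_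
    simp [Dop_eq_zero k hk Q hQ, polyDOp_zero]
  have hconst := is_const_of_deriv_eq_zero (fun t => (hder t).differentiableAt)
    (fun t => (hder t).deriv) 1 0
  simp only [KK] at hconst
  rw [hconst]
  congr 1
  funext x
  have hs0 : sg S 0 x = x := by funext p; simp [sg, toMat]
  have hm0 : mf k S 0 x = 1 := by simp [mf]
  rw [hs0, hm0, one_mul]
end ode

section uh
open Filter Topology
variable {n r : ℕ}

lemma mem_UH (Z : Matrix (Fin n) (Fin n) ℂ) :
    Z ∈ UpperHalf n ↔ ∀ x : Fin n → ℂ, x ≠ 0 → 0 < (star x ⬝ᵥ (Z *ᵥ x)).im := by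
  have hH : ((2 * Complex.I)⁻¹ • (Z - Zᴴ)).IsHermitian := by
    unfold Matrix.IsHermitian
    rw [Matrix.conjTranspose_smul, Matrix.conjTranspose_sub, Matrix.conjTranspose_conjTranspose]
    have : star ((2 * Complex.I)⁻¹) = -(2 * Complex.I)⁻¹ := by
      simp
    rw [this, neg_smul, ← smul_neg, neg_sub]
  have hq : ∀ x : Fin n → ℂ, star x ⬝ᵥ (((2 * Complex.I)⁻¹ • (Z - Zᴴ)) *ᵥ x) =
      ((star x ⬝ᵥ (Z *ᵥ x)).im : ℂ) := by
    intro x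
    rw [Matrix.smul_mulVec, dotProduct_smul, Matrix.sub_mulVec, dotProduct_sub, smul_eq_mul]
    have h1 : star x ⬝ᵥ (Zᴴ *ᵥ x) = star (star x ⬝ᵥ (Z *ᵥ x)) := by
      rw [← Matrix.star_dotProduct_star, star_star, Matrix.star_mulVec, dotProduct_comm,
        ← Matrix.dotProduct_mulVec]
      exact dotProduct_comm _ _
    rw [h1]
    generalize star x ⬝ᵥ (Z *ᵥ x) = w
    have : w - star w = 2 * Complex.I * w.im := by
      apply Complex.ext <;> simp
      ring
    rw [this, ← mul_assoc, inv_mul_cancel₀ (by simp), one_mul]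
  unfold UpperHalf
  rw [Set.mem_ofPred_eq, Matrix.posDef_iff_dotProduct_mulVec]
  constructor
  · intro h x hx
    have := h.2 hx
    rw [hq] at this
    exact_mod_cast this
  · intro h
    refine ⟨hH, fun x hx => ?_⟩
    rw [hq]
    exact_mod_cast h x hx

lemma isOpen_UH : IsOpen {z : Fin n × Fin n → ℂ | toSq z ∈ UpperHalf n} := by
  rw [isOpen_iff_eventually]
  intro z hz
  rw [Set.mem_ofPred_eq, mem_UH] at hz
  have hcont : Continuous fun p : (Fin n × Fin n → ℂ) × (Fin n → ℂ) =>
      (star p.2 ⬝ᵥ (toSq p.1 *ᵥ p.2)).im := by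
    simp only [dotProduct, Matrix.mulVec, toSq, Matrix.of_apply, Pi.star_apply]
    fun_prop
  have hK : IsCompact (Metric.sphere (0 : Fin n → ℂ) 1) := isCompact_sphere _ _
  have h1 := hK.eventually_forall_of_forall_eventually (x₀ := z)
    (P := fun z x => 0 < (star x ⬝ᵥ (toSq z *ᵥ x)).im) (fun x hx => by
      refine hcont.continuousAt.eventually (lt_mem_nhds ?_)
      refine hz x ?_
      rintro rfl
      simp at hx)
  filter_upwards [h1] with w hw
  rw [mem_UH]
  intro x hx
  have hx' : 0 < ‖x‖ := norm_pos_iff.2 hx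
  have h2 := hw ((‖x‖⁻¹ : ℂ) • x) (by
    rw [mem_sphere_zero_iff_norm, norm_smul]
    simp [hx'.ne'])
  have h3 : star ((‖x‖⁻¹ : ℂ) • x) ⬝ᵥ (toSq w *ᵥ ((‖x‖⁻¹ : ℂ) • x)) =
      ((‖x‖⁻¹ * ‖x‖⁻¹ : ℝ) : ℂ) * (star x ⬝ᵥ (toSq w *ᵥ x)) := by
    rw [Matrix.mulVec_smul, dotProduct_smul, star_smul, smul_dotProduct]
    simp [mul_assoc]
  rw [h3, Complex.im_ofReal_mul] at h2
  exact pos_of_mul_pos_right h2 (by positivity)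

variable {γ : Matrix (Fin n ⊕ Fin n) (Fin n ⊕ Fin n) ℂ}

lemma unitary_blocks (h : InUnitary n γ) :
    γ.toBlocks₂₁ᴴ * γ.toBlocks₁₁ - γ.toBlocks₁₁ᴴ * γ.toBlocks₂₁ = 0 ∧
    γ.toBlocks₂₁ᴴ * γ.toBlocks₁₂ - γ.toBlocks₁₁ᴴ * γ.toBlocks₂₂ = -1 ∧
    γ.toBlocks₂₂ᴴ * γ.toBlocks₁₁ - γ.toBlocks₁₂ᴴ * γ.toBlocks₂₁ = 1 ∧
    γ.toBlocks₂₂ᴴ * γ.toBlocks₁₂ - γ.toBlocks₁₂ᴴ * γ.toBlocks₂₂ = 0 := by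
  unfold InUnitary at h
  obtain ⟨A, B, C, D, rfl⟩ : ∃ A B C D, γ = Matrix.fromBlocks A B C D :=
    ⟨_, _, _, _, (Matrix.fromBlocks_toBlocks γ).symm⟩
  have hJ : Jmat n = Complex.I • Matrix.fromBlocks 0 (-1) 1 0 := by
    rw [Matrix.fromBlocks_smul]; simp [Jmat]
  rw [hJ, Matrix.mul_smul, Matrix.smul_mul] at h
  have h2 := smul_right_injective _ Complex.I_ne_zero h
  simp only [Matrix.fromBlocks_conjTranspose, Matrix.fromBlocks_multiply, Matrix.fromBlocks_inj] at h2
  simp only [Matrix.toBlocks_fromBlocks₁₁, Matrix.toBlocks_fromBlocks₁₂,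
    Matrix.toBlocks_fromBlocks₂₁, Matrix.toBlocks_fromBlocks₂₂]
  obtain ⟨h11, h12, h21, h22⟩ := h2
  refine ⟨?_, ?_, ?_, ?_⟩
  · rw [← h11]; noncomm_ring
  · rw [← h12]; noncomm_ring
  · rw [← h21]; noncomm_ring
  · rw [← h22]; noncomm_ring

def Pn (γ : Matrix (Fin n ⊕ Fin n) (Fin n ⊕ Fin n) ℂ) (Z : Matrix (Fin n) (Fin n) ℂ) :=
  γ.toBlocks₁₁ * Z + γ.toBlocks₁₂
def Rn (γ : Matrix (Fin n ⊕ Fin n) (Fin n ⊕ Fin n) ℂ) (Z : Matrix (Fin n) (Fin n) ℂ) :=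
  γ.toBlocks₂₁ * Z + γ.toBlocks₂₂

lemma RP (h : InUnitary n γ) (Z : Matrix (Fin n) (Fin n) ℂ) :
    (Rn γ Z)ᴴ * Pn γ Z - (Pn γ Z)ᴴ * Rn γ Z = Z - Zᴴ := by
  obtain ⟨h1, h2, h3, h4⟩ := unitary_blocks h
  unfold Rn Pn
  generalize γ.toBlocks₁₁ = A at *
  generalize γ.toBlocks₁₂ = B at *
  generalize γ.toBlocks₂₁ = C at *
  generalize γ.toBlocks₂₂ = D at *
  have : (C * Z + D)ᴴ * (A * Z + B) - (A * Z + B)ᴴ * (C * Z + D) =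
    Zᴴ * (Cᴴ * A - Aᴴ * C) * Z + Zᴴ * (Cᴴ * B - Aᴴ * D) + (Dᴴ * A - Bᴴ * C) * Z
      + (Dᴴ * B - Bᴴ * D) := by
    simp only [Matrix.conjTranspose_add, Matrix.conjTranspose_mul]
    noncomm_ring
  rw [this, h1, h2, h3, h4]
  noncomm_ring

lemma RP_im (h : InUnitary n γ) (Z : Matrix (Fin n) (Fin n) ℂ) (u : Fin n → ℂ) :
    (star (Rn γ Z *ᵥ u) ⬝ᵥ (Pn γ Z *ᵥ u)).im = (star u ⬝ᵥ (Z *ᵥ u)).im := by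
  have key : ∀ R P : Matrix (Fin n) (Fin n) ℂ, star u ⬝ᵥ ((Rᴴ * P - Pᴴ * R) *ᵥ u) =
      2 * Complex.I * (star (R *ᵥ u) ⬝ᵥ (P *ᵥ u)).im := by
    intro R P
    have h1 : ∀ R P : Matrix (Fin n) (Fin n) ℂ,
        star u ⬝ᵥ ((Rᴴ * P) *ᵥ u) = star (R *ᵥ u) ⬝ᵥ (P *ᵥ u) := by
      intro R P
      rw [Matrix.star_mulVec, ← Matrix.mulVec_mulVec, Matrix.dotProduct_mulVec]
    have h2 : star (P *ᵥ u) ⬝ᵥ (R *ᵥ u) = star (star (R *ᵥ u) ⬝ᵥ (P *ᵥ u)) := by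
      rw [← Matrix.star_dotProduct_star, star_star, dotProduct_comm]
    rw [Matrix.sub_mulVec, dotProduct_sub, h1, h1, h2]
    generalize star (R *ᵥ u) ⬝ᵥ (P *ᵥ u) = w
    apply Complex.ext <;> simp
    ring
  have e1 := key (Rn γ Z) (Pn γ Z)
  have e2 := key 1 Z
  rw [RP h] at e1
  rw [Matrix.conjTranspose_one, one_mul, mul_one, e1, Matrix.one_mulVec] at e2
  have := mul_left_cancel₀ (by simp) e2
  exact_mod_cast this

lemma Rn_det_ne (h : InUnitary n γ) {Z : Matrix (Fin n) (Fin n) ℂ} (hZ : Z ∈ UpperHalf n) :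
    (Rn γ Z).det ≠ 0 := by
  intro h0
  obtain ⟨u, hu, hu0⟩ := Matrix.exists_mulVec_eq_zero_iff.2 h0
  have := (mem_UH Z).1 hZ u hu
  rw [← RP_im h, hu0] at this
  simp at this

lemma act_mem (h : InUnitary n γ) {Z : Matrix (Fin n) (Fin n) ℂ} (hZ : Z ∈ UpperHalf n) :
    actU γ Z ∈ UpperHalf n := by
  have hu : IsUnit (Rn γ Z).det := isUnit_iff_ne_zero.2 (Rn_det_ne h hZ)
  rw [mem_UH]
  intro x hx
  have h1 : x = Rn γ Z *ᵥ ((Rn γ Z)⁻¹ *ᵥ x) := by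
    rw [Matrix.mulVec_mulVec, Matrix.mul_nonsing_inv _ hu, Matrix.one_mulVec]
  have h2 : actU γ Z *ᵥ x = Pn γ Z *ᵥ ((Rn γ Z)⁻¹ *ᵥ x) := by
    rw [Matrix.mulVec_mulVec]; rfl
  rw [h2]
  conv_rhs => enter [1, 1]; rw [h1]
  rw [RP_im h]
  refine (mem_UH Z).1 hZ _ ?_
  intro h3
  rw [h3] at h1
  simp at h1
  exact hx h1

def Sn (γ : Matrix (Fin n ⊕ Fin n) (Fin n ⊕ Fin n) ℂ) (Z : Matrix (Fin n) (Fin n) ℂ) :=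
  (Rn γ Z)⁻¹ * γ.toBlocks₂₁
def an (γ : Matrix (Fin n ⊕ Fin n) (Fin n ⊕ Fin n) ℂ) (Z : Matrix (Fin n) (Fin n) ℂ) :=
  γ.toBlocks₁₁ - actU γ Z * γ.toBlocks₂₁

lemma Rn_add {Z : Matrix (Fin n) (Fin n) ℂ} (hd : (Rn γ Z).det ≠ 0) (H : Matrix (Fin n) (Fin n) ℂ) :
    Rn γ (Z + H) = Rn γ Z * (1 + Sn γ Z * H) := by
  have h1 : Rn γ Z * (Rn γ Z)⁻¹ = 1 := Matrix.mul_nonsing_inv _ (isUnit_iff_ne_zero.2 hd)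
  rw [Sn, mul_add, mul_one, ← mul_assoc, ← mul_assoc, h1, one_mul]
  unfold Rn
  noncomm_ring

lemma act_add {Z : Matrix (Fin n) (Fin n) ℂ} (hd : (Rn γ Z).det ≠ 0) (H : Matrix (Fin n) (Fin n) ℂ)
    (hH : (1 + Sn γ Z * H).det ≠ 0) :
    actU γ (Z + H) = actU γ Z + an γ Z * (H * (1 + Sn γ Z * H)⁻¹) * (Rn γ Z)⁻¹ := by
  have h1 : (Rn γ Z)⁻¹ * Rn γ Z = 1 := Matrix.nonsing_inv_mul _ (isUnit_iff_ne_zero.2 hd)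
  have h1' : Rn γ Z * (Rn γ Z)⁻¹ = 1 := Matrix.mul_nonsing_inv _ (isUnit_iff_ne_zero.2 hd)
  have h2 : (1 + Sn γ Z * H) * (1 + Sn γ Z * H)⁻¹ = 1 :=
    Matrix.mul_nonsing_inv _ (isUnit_iff_ne_zero.2 hH)
  have e1 : actU γ (Z + H) = Pn γ (Z + H) * ((1 + Sn γ Z * H)⁻¹ * (Rn γ Z)⁻¹) := by
    rw [← Matrix.mul_inv_rev, ← Rn_add hd]; rfl
  have e2 : actU γ Z = actU γ Z * Rn γ Z * ((1 + Sn γ Z * H) * (1 + Sn γ Z * H)⁻¹ * (Rn γ Z)⁻¹) := by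
    rw [h2, one_mul, mul_assoc, h1', mul_one]
  have e3 : actU γ Z * Rn γ Z = Pn γ Z := by
    change Pn γ Z * (Rn γ Z)⁻¹ * Rn γ Z = _
    rw [mul_assoc, h1, mul_one]
  have e4 : actU γ Z * Rn γ Z * (1 + Sn γ Z * H) + an γ Z * H = Pn γ (Z + H) := by
    rw [mul_assoc, ← Rn_add hd]
    have : Rn γ (Z + H) = Rn γ Z + γ.toBlocks₂₁ * H := by unfold Rn; noncomm_ring
    rw [this, mul_add, e3, an]
    unfold Pn
    noncomm_ring
  rw [e1, ← e4]
  conv_rhs => enter [1]; rw [e2]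
  noncomm_ring

lemma an_det {Z : Matrix (Fin n) (Fin n) ℂ} (hd : (Rn γ Z).det ≠ 0) :
    (Rn γ Z).det * (an γ Z).det = γ.det := by
  have h1 : γ * Matrix.fromBlocks 1 Z 0 1 =
      Matrix.fromBlocks γ.toBlocks₁₁ (Pn γ Z) γ.toBlocks₂₁ (Rn γ Z) := by
    conv_lhs => rw [← Matrix.fromBlocks_toBlocks γ]
    rw [Matrix.fromBlocks_multiply]
    simp [Pn, Rn]
  have h2 : γ.det = (Matrix.fromBlocks γ.toBlocks₁₁ (Pn γ Z) γ.toBlocks₂₁ (Rn γ Z)).det := by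
    rw [← h1, Matrix.det_mul, Matrix.det_fromBlocks_zero₂₁]; simp
  let _ : Invertible (Rn γ Z) := Matrix.invertibleOfIsUnitDet _ (isUnit_iff_ne_zero.2 hd)
  rw [h2, Matrix.det_fromBlocks₂₂, Matrix.invOf_eq_nonsing_inv]
  rfl
end uh

section wt
open Filter Topology
variable {n r : ℕ}

def Phi (F : Fin r → ((Fin n × Fin n → ℂ) → ℂ)) (w : MIdx n r → ℂ) : ℂ :=
  ∏ i : Fin r, F i (fun p : Fin n × Fin n => w (i, p.1, p.2))

def dg (z : Fin n × Fin n → ℂ) : MIdx n r → ℂ := fun p => z (p.2.1, p.2.2)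

lemma hol_of_on {f : (Fin n × Fin n → ℂ) → ℂ}
    (hf : DifferentiableOn ℂ f {z | toSq z ∈ UpperHalf n}) {z : Fin n × Fin n → ℂ}
    (hz : toSq z ∈ UpperHalf n) : Hol f z := by
  filter_upwards [isOpen_UH.mem_nhds hz] with w hw
  exact hf.differentiableAt (isOpen_UH.mem_nhds hw)

lemma Phi_hol {F : Fin r → ((Fin n × Fin n → ℂ) → ℂ)}
    (hF : ∀ i, DifferentiableOn ℂ (F i) {z | toSq z ∈ UpperHalf n}) {z : MIdx n r → ℂ}
    (hz : ∀ i, toMat z i ∈ UpperHalf n) : Hol (Phi F) z := by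
  refine Hol.prod _ fun i _ => ?_
  refine Hol.comp (φ := fun w : MIdx n r → ℂ => fun p : Fin n × Fin n => w (i, p.1, p.2))
    (hol_of_on (hF i) (hz i)) (Eventually.of_forall fun w => ?_)
  fun_prop

lemma linSub_one (h : MIdx n r → ℂ) : linSub 1 1 h = h := by
  funext p; simp [linSub, toMat]

lemma toMat_add (h h' : MIdx n r → ℂ) (i : Fin r) : toMat (h + h') i = toMat h i + toMat h' i := by
  ext; rfl

lemma polyDOp_translate {v : ℕ} {k : Fin r → ℕ} {Q : MvPolynomial (MIdx n r) ℂ}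
    (hQ : MemH n v r k Q) {f : (MIdx n r → ℂ) → ℂ} (w : MIdx n r → ℂ) (hf : Hol f w) :
    polyDOp Q f w = polyDOp Q (fun h => f (w + h)) 0 := by
  have h1 := polyDOp_lin Q 1 1 w (G := f) 0 (by simpa using hf)
  have h2 := hQ.1 1 1 (by simp) (by simp)
  simp only [linSub_one, Matrix.transpose_one, add_zero] at h1
  rw [h1, h2]
  simp

theorem weight_formula {v : ℕ} {k : Fin r → ℕ} (hk : ∀ i, n ≤ k i) {Q : MvPolynomial (MIdx n r) ℂ}
    (hQ : MemH n v r k Q) {F : Fin r → ((Fin n × Fin n → ℂ) → ℂ)}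
    (hF : ∀ i, DifferentiableOn ℂ (F i) {z | toSq z ∈ UpperHalf n})
    {γ : Matrix (Fin n ⊕ Fin n) (Fin n ⊕ Fin n) ℂ} (hγ : InUnitary n γ) (hγd : γ.det ≠ 0)
    (hinv : ∀ i, ∀ z : Fin n × Fin n → ℂ, toSq z ∈ UpperHalf n →
      F i z = autFactor γ (toSq z) ^ (-(k i : ℤ)) * F i (ofSq (actU γ (toSq z))))
    {z : Fin n × Fin n → ℂ} (hz : toSq z ∈ UpperHalf n) :
    polyDOp Q (Phi F) (dg z) = autFactor γ (toSq z) ^ (-(((∑ i, k i : ℕ) : ℤ) + 2 * v)) *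
      (γ.det ^ v * polyDOp Q (Phi F) (dg (ofSq (actU γ (toSq z))))) := by
  set Z := toSq z with hZ
  set W := actU γ Z with hW
  have hd := Rn_det_ne hγ hz
  have hWm : W ∈ UpperHalf n := act_mem hγ hz
  set j := (Rn γ Z).det with hj
  have hjd : autFactor γ Z = j := rfl
  set S := Sn γ Z
  set a := an γ Z with ha
  set b := (Rn γ Z)⁻¹ with hb
  have hΦz : Hol (Phi F) (dg z) := Phi_hol hF fun i => hz
  have hΦW : Hol (Phi F) (dg (ofSq W) : MIdx n r → ℂ) := Phi_hol hF fun i => hWm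
  set G : (MIdx n r → ℂ) → ℂ := fun h => Phi F (dg (ofSq W) + linSub a b h) with hG
  have hGhol : Hol G 0 := by
    refine Hol.comp (φ := fun h : MIdx n r → ℂ => dg (ofSq W) + linSub a b h)
      (by simpa using hΦW) (Eventually.of_forall fun w => ?_)
    exact (differentiableAt_const _).add
      (LinearMap.toContinuousLinearMap (linSub a b)).differentiableAt
  have hcont : Continuous fun h : MIdx n r → ℂ => (dg z + h) := by fun_prop
  have hev1 : ∀ᶠ h in 𝓝 (0 : MIdx n r → ℂ), ∀ i, toMat (dg z + h) i ∈ UpperHalf n := by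
    rw [eventually_all]
    intro i
    have hc : Continuous fun h : MIdx n r → ℂ =>
        (fun p : Fin n × Fin n => (dg z + h : MIdx n r → ℂ) (i, p.1, p.2)) := by
      simp only [Pi.add_apply]; fun_prop
    refine hc.continuousAt.eventually (isOpen_UH.mem_nhds ?_)
    simpa [dg] using hz
  have hev2 : ∀ᶠ h in 𝓝 (0 : MIdx n r → ℂ), ∀ i, (1 + S * toMat h i).det ≠ 0 := by
    rw [eventually_all]
    intro i
    have : Continuous fun h : MIdx n r → ℂ => (1 + S * toMat h i).det := by
      refine Continuous.matrix_det ?_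
      refine continuous_const.add (continuous_const.matrix_mul ?_)
      refine continuous_matrix fun a b => ?_
      simp only [toMat, Matrix.of_apply]
      fun_prop
    refine this.continuousAt.eventually_ne ?_
    simp [toMat_zero]
  have heq : (fun h => Phi F (dg z + h)) =ᶠ[𝓝 0]
      fun h => (j⁻¹) ^ (∑ i, k i) * (mf k S 1 h * G (sg S 1 h)) := by
    filter_upwards [hev1, hev2] with h h1 h2
    simp only [hG, Phi, mf]
    rw [← Finset.prod_pow_eq_pow_sum, ← Finset.prod_mul_distrib, ← Finset.prod_mul_distrib]
    refine Finset.prod_congr rfl fun i _ => ?_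
    have e0 : toSq (fun p : Fin n × Fin n => (dg z + h : MIdx n r → ℂ) (i, p.1, p.2)) = Z + toMat h i := by
      ext x y; rfl
    have hm : toSq (fun p : Fin n × Fin n => (dg z + h : MIdx n r → ℂ) (i, p.1, p.2)) ∈ UpperHalf n := h1 i
    rw [hinv i _ hm, e0]
    have e1 : autFactor γ (Z + toMat h i) = j * (1 + S * toMat h i).det := by
      change (Rn γ (Z + toMat h i)).det = _
      rw [Rn_add hd, Matrix.det_mul]
    have e2 : ofSq (actU γ (Z + toMat h i)) = fun p : Fin n × Fin n =>
        (dg (ofSq W) + linSub a b (sg S 1 h) : MIdx n r → ℂ) (i, p.1, p.2) := by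
      rw [act_add hd _ (h2 i)]
      funext p
      have := toMat_sg S 1 h i
      simp only [linSub, LinearMap.coe_mk, AddHom.coe_mk, Pi.add_apply, this, one_smul]
      rfl
    rw [e1, e2, one_smul, _root_.zpow_neg, zpow_natCast, ← inv_pow, mul_inv, mul_pow, mul_assoc]
  rw [polyDOp_translate hQ _ hΦz, polyDOp_congr Q heq]
  have hinvt := polyDOp_invariant k hk Q hQ.2 S hGhol
  have hhol : Hol (fun h => mf k S 1 h * G (sg S 1 h)) 0 :=
    (KK_hol k S hGhol 1).comp (φ := fun h => ((1:ℂ), h)) (Eventually.of_forall fun x => by fun_prop)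
  rw [polyDOp_fsmul _ _ hhol, hinvt, hG, polyDOp_lin Q a b _ 0 (by simpa using hΦW)]
  have hadet : j * a.det = γ.det := an_det hd
  have ha0 : a.det ≠ 0 := fun h => hγd (by rw [← hadet, h, mul_zero])
  have hb0 : b.det = j⁻¹ := by rw [hb, Matrix.det_nonsing_inv, Ring.inverse_eq_inv']
  rw [hQ.1 b aᵀ (by rw [hb0]; exact isUnit_iff_ne_zero.2 (inv_ne_zero hd))
    (by rw [Matrix.det_transpose]; exact isUnit_iff_ne_zero.2 ha0), polyDOp_C_mul, hb0,
    Matrix.det_transpose, map_zero, add_zero, hjd, ← hadet]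
  have hd' : j ≠ 0 := hd
  have : j ^ (-(((∑ i, k i : ℕ) : ℤ) + 2 * v)) = (j⁻¹) ^ (∑ i, k i) * ((j⁻¹) ^ v * (j⁻¹) ^ v) := by
    rw [_root_.zpow_neg, zpow_add₀ hd', zpow_natCast, mul_inv, inv_pow, inv_pow, mul_comm (2:ℤ), _root_.zpow_mul,
      zpow_natCast, zpow_ofNat, sq, mul_inv]
  rw [this, mul_pow, inv_pow j v]
  have hjv : j ^ v ≠ 0 := pow_ne_zero _ hd'
  field_simp
end wt

section nt
open ComplexConjugate

lemma mem_OL {L : Subfield ℂ} {x : ℂ} : x ∈ OL L ↔ IsIntegral ℤ x ∧ x ∈ L := by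
  rw [OL, Subring.mem_inf]; rfl

variable {Lp L : Subfield ℂ}

lemma cm_basis (h : IsCMExtension Lp L) :
    ∃ x0 ∈ L, x0.im ≠ 0 ∧ ∀ y ∈ L, ∃ a ∈ Lp, ∃ b ∈ Lp, y = a + b * x0 := by
  obtain ⟨hle, hR, hI, hfin, hdeg⟩ := h
  have hre : ∀ x : Lp, (x : ℂ).im = 0 := fun x => hR Lp.subtype x
  obtain ⟨x0, hx0⟩ := hI L.subtype
  refine ⟨x0, x0.2, hx0, ?_⟩
  let _ : Algebra Lp L := (Subfield.inclusion hle).toAlgebra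
  have hsm : ∀ (a : Lp) (y : L), ((a • y : L) : ℂ) = (a : ℂ) * (y : ℂ) := by
    intro a y
    rw [Algebra.smul_def]; rfl
  have hmul := Module.finrank_mul_finrank ℚ Lp L
  have hpos : 0 < Module.finrank ℚ L := Module.finrank_pos
  have h2 : Module.finrank Lp L = 2 := by
    rw [hdeg] at hmul hpos
    have : 0 < Module.finrank ℚ Lp := by omega
    rw [mul_comm] at hmul
    exact Nat.eq_of_mul_eq_mul_right this hmul
  have hli : LinearIndependent Lp ![(1 : L), x0] := by
    rw [LinearIndependent.pair_iff]
    intro s t hst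
    have h3 : (s : ℂ) * 1 + (t : ℂ) * (x0 : ℂ) = 0 := by
      have := congrArg (fun y : L => (y : ℂ)) hst
      simpa [hsm] using this
    have h4 := congrArg Complex.im h3
    simp [hre s, hre t] at h4
    have ht : (t : ℂ) = 0 := by
      apply Complex.ext
      · simpa using h4.resolve_right hx0
      · simpa using hre t
    rw [ht] at h3
    simp at h3
    exact ⟨h3, by exact_mod_cast ht⟩
  have hsp := hli.span_eq_top_of_card_eq_finrank (by simp [h2])
  intro y hy
  have : (⟨y, hy⟩ : L) ∈ Submodule.span Lp (Set.range ![(1 : L), x0]) := by rw [hsp]; trivial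
  rw [Matrix.range_cons, Matrix.range_cons, Matrix.range_empty, Set.union_empty,
    Set.singleton_union, Submodule.mem_span_pair] at this
  obtain ⟨a, b, hab⟩ := this
  refine ⟨a, a.2, b, b.2, ?_⟩
  have := congrArg (fun y : L => (y : ℂ)) hab
  simpa [hsm] using this.symm

lemma conj_mem_L (h : IsCMExtension Lp L) {y : ℂ} (hy : y ∈ L) : conj y ∈ L := by
  have hre : ∀ x ∈ Lp, (x : ℂ).im = 0 := fun x hx => h.2.1 Lp.subtype ⟨x, hx⟩
  have hco : ∀ x ∈ Lp, conj x = x := fun x hx => Complex.conj_eq_iff_im.2 (hre x hx)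
  obtain ⟨x0, hx0, him, hspan⟩ := cm_basis h
  obtain ⟨a, ha, b, hb, hab⟩ := hspan (x0 * x0) (mul_mem hx0 hx0)
  have hc0 : conj x0 = b - x0 := by
    have h1 := congrArg Complex.im hab
    simp [hre a ha, hre b hb] at h1
    have h2 : b.re = 2 * x0.re := by
      have : (b.re - 2 * x0.re) * x0.im = 0 := by linarith
      rcases mul_eq_zero.1 this with h | h
      · linarith
      · exact absurd h him
    apply Complex.ext
    · simp [h2]; ring
    · simp [hre b hb]
  obtain ⟨c, hc, d, hd, rfl⟩ := hspan y hy
  rw [map_add, map_mul, hco c hc, hco d hd, hc0]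
  exact add_mem (h.1 hc) (mul_mem (h.1 hd) (sub_mem (h.1 hb) hx0))

lemma conj_mem_OL (h : IsCMExtension Lp L) {y : ℂ} (hy : y ∈ OL L) : conj y ∈ OL L := by
  rw [mem_OL] at hy ⊢
  exact ⟨hy.1.map ((starRingEnd ℂ).toIntAlgHom), conj_mem_L h hy.2⟩

lemma exists_nonreal (h : IsCMExtension Lp L) : ∃ x ∈ OL L, x.im ≠ 0 := by
  obtain ⟨x0, hx0⟩ := h.2.2.1 L.subtype
  have := h.2.2.2.1
  have halg : IsAlgebraic ℚ (x0 : ℂ) :=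
    (Algebra.IsAlgebraic.isAlgebraic (R := ℚ) x0).algebraMap
  have halg2 : IsAlgebraic ℤ (x0 : ℂ) := (IsFractionRing.isAlgebraic_iff ℤ ℚ ℂ).2 halg
  obtain ⟨d, hd, hi⟩ := halg2.exists_integral_multiple
  refine ⟨d • (x0 : ℂ), mem_OL.2 ⟨hi, zsmul_mem x0.2 d⟩, ?_⟩
  simpa [hd] using hx0

variable {n : ℕ} {γ : Matrix (Fin n ⊕ Fin n) (Fin n ⊕ Fin n) ℂ}

lemma Jmat_det : (Jmat n).det ≠ 0 := by
  have h : Jmat n * Jmat n = 1 := by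
    rw [Jmat, Matrix.fromBlocks_multiply, ← Matrix.fromBlocks_one]
    simp [smul_smul]
  intro h0
  have := congrArg Matrix.det h
  rw [Matrix.det_mul, h0] at this
  simp at this

lemma unitary_det (h : InUnitary n γ) : conj γ.det * γ.det = 1 := by
  have := congrArg Matrix.det h
  rw [Matrix.det_mul, Matrix.det_mul, Matrix.det_conjTranspose, mul_right_comm] at this
  have h2 : star γ.det * γ.det = 1 := mul_right_cancel₀ Jmat_det (this.trans (one_mul _).symm)
  exact h2

/-- `det γ ≡ 1` modulo any `δ` such that conjugation is trivial mod `δ` -/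
lemma det_congr_one (h : InUnitary n γ) (hent : ∀ p q, γ p q ∈ OL L) {δ : ℂ} (hδ : δ ∈ OL L)
    (hcm : ∀ x ∈ OL L, ∃ c ∈ OL L, conj x = x + δ * c) :
    ∃ c ∈ OL L, γ.det = 1 + δ * c := by
  let R := OL L ⧸ Ideal.span {(⟨δ, hδ⟩ : OL L)}
  let π : OL L →+* R := Ideal.Quotient.mk _
  let γ' : Matrix (Fin n ⊕ Fin n) (Fin n ⊕ Fin n) (OL L) := Matrix.of fun p q => ⟨γ p q, hent p q⟩
  have hc' : ∀ x ∈ OL L, conj x ∈ OL L := by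
    intro x hx
    obtain ⟨c, hc, e⟩ := hcm x hx
    rw [e]
    exact add_mem hx (mul_mem hδ hc)
  let γc : Matrix (Fin n ⊕ Fin n) (Fin n ⊕ Fin n) (OL L) :=
    Matrix.of fun p q => ⟨conj (γ q p), hc' _ (hent q p)⟩
  have hγ' : (OL L).subtype.mapMatrix γ' = γ := by ext p q; rfl
  have hγc : (OL L).subtype.mapMatrix γc = γᴴ := by ext p q; rfl
  have hinj : Function.Injective ((OL L).subtype.mapMatrix : Matrix (Fin n ⊕ Fin n) (Fin n ⊕ Fin n) (OL L) →+* _) := by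
    intro A B hAB
    ext p q
    exact congrFun (congrFun hAB p) q
  have hπc : π.mapMatrix γc = (π.mapMatrix γ')ᵀ := by
    ext p q
    obtain ⟨c, hc, e⟩ := hcm _ (hent q p)
    change π ⟨conj (γ q p), _⟩ = π ⟨γ q p, _⟩
    refine Ideal.Quotient.eq.2 (Ideal.mem_span_singleton'.2 ⟨⟨c, hc⟩, ?_⟩)
    apply Subtype.ext
    change c * δ = conj (γ q p) - γ q p
    rw [e]; ring
  have hJ0 : Matrix.J (Fin n) ℂ = (OL L).subtype.mapMatrix (Matrix.J (Fin n) (OL L)) := by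
    rw [RingHom.mapMatrix_apply, Matrix.J, Matrix.J, Matrix.fromBlocks_map]
    congr 1 <;> ext i j <;> simp [Matrix.one_apply, apply_ite]
  have hJ1 : Matrix.J (Fin n) R = π.mapMatrix (Matrix.J (Fin n) (OL L)) := by
    rw [RingHom.mapMatrix_apply, Matrix.J, Matrix.J, Matrix.fromBlocks_map]
    congr 1 <;> ext i j <;> by_cases hij : i = j <;> simp [Matrix.one_apply, hij]
  have hJ : Jmat n = Complex.I • Matrix.J (Fin n) ℂ := by
    rw [Matrix.J, Matrix.fromBlocks_smul]; simp [Jmat]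
  have hsym : γc * Matrix.J (Fin n) (OL L) * γ' = Matrix.J (Fin n) (OL L) := by
    apply hinj
    rw [map_mul, map_mul, hγ', hγc, ← hJ0]
    have h' := h
    unfold InUnitary at h'
    rw [hJ, Matrix.mul_smul, Matrix.smul_mul] at h'
    exact smul_right_injective _ Complex.I_ne_zero h'
  have hmem : π.mapMatrix γ' ∈ Matrix.symplecticGroup (Fin n) R := by
    rw [SymplecticGroup.mem_iff', ← hπc, hJ1, ← map_mul, ← map_mul, hsym]
  have hdet := SymplecticGroup.det_eq_one hmem
  rw [← RingHom.map_det, ← map_one π] at hdet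
  obtain ⟨c, hc⟩ := Ideal.mem_span_singleton'.1 (Ideal.Quotient.eq.1 hdet)
  refine ⟨c, c.2, ?_⟩
  have e1 := congrArg (OL L).subtype hc
  rw [map_mul, map_sub, map_one, RingHom.map_det, hγ'] at e1
  change (c : ℂ) * δ = γ.det - 1 at e1
  linear_combination -e1
end nt

section nt2
open ComplexConjugate
variable {Lp L : Subfield ℂ}

lemma int_data (h : IsCMExtension Lp L)
    (hint : ∀ a ∈ OL L, a.im = 0 → ∃ m : ℤ, a = m) {x : ℂ} (hx : x ∈ OL L) :
    ∃ t N : ℤ, 2 * x.re = t ∧ (2 * x.im) ^ 2 = (4 * N - t ^ 2 : ℤ) := by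
  have hc := conj_mem_OL h hx
  obtain ⟨t, ht⟩ := hint (x + conj x) (add_mem hx hc) (by simp)
  obtain ⟨N, hN⟩ := hint (x * conj x) (mul_mem hx hc) (by simp; ring)
  have h1 := congrArg Complex.re ht
  have h2 := congrArg Complex.re hN
  simp at h1 h2
  refine ⟨t, N, by linarith, ?_⟩
  push_cast
  rw [← h1, ← h2]; ring

lemma exists_gen (h : IsCMExtension Lp L)
    (hint : ∀ a ∈ OL L, a.im = 0 → ∃ m : ℤ, a = m) :
    ∃ x0 ∈ OL L, x0.im ≠ 0 ∧ ∀ x ∈ OL L, ∃ m : ℤ, x.im = m * x0.im := by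
  classical
  have hex : ∃ M : ℕ, 0 < M ∧ ∃ x ∈ OL L, (2 * x.im) ^ 2 = M := by
    obtain ⟨x, hx, him⟩ := exists_nonreal h
    obtain ⟨t, N, -, h2⟩ := int_data h hint hx
    have hp : 0 < (2 * x.im) ^ 2 := by positivity
    rw [h2] at hp
    have hp' : 0 < 4 * N - t ^ 2 := by exact_mod_cast hp
    obtain ⟨M, hM⟩ := Int.eq_ofNat_of_zero_le hp'.le
    refine ⟨M, by omega, x, hx, ?_⟩
    rw [h2, hM]; simp
  obtain ⟨hpos, x0, hx0, hM⟩ := Nat.find_spec hex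
  have hmin := fun m => @Nat.find_min _ _ hex m
  set M := Nat.find hex
  have hne : x0.im ≠ 0 := by
    intro h0
    rw [h0] at hM
    have : (M : ℝ) = 0 := by rw [← hM]; ring
    have : M = 0 := by exact_mod_cast this
    omega
  refine ⟨x0, hx0, hne, ?_⟩
  intro x hx
  let m : ℤ := round (x.im / x0.im)
  refine ⟨m, ?_⟩
  by_contra hcon
  let y := x - m * x0
  have hy : y ∈ OL L := sub_mem hx (mul_mem (intCast_mem _ m) hx0)
  have hyim : y.im = x.im - m * x0.im := by simp [y]
  have hy0 : y.im ≠ 0 := by rw [hyim]; intro h0; exact hcon (by linarith)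
  obtain ⟨t, N, -, h2⟩ := int_data h hint hy
  have hp : 0 < (2 * y.im) ^ 2 := by positivity
  rw [h2] at hp
  have hp' : 0 < 4 * N - t ^ 2 := by exact_mod_cast hp
  obtain ⟨M', hM'⟩ := Int.eq_ofNat_of_zero_le hp'.le
  have hM'' : (2 * y.im) ^ 2 = M' := by rw [h2, hM']; simp
  refine hmin M' ?_ ⟨by omega, y, hy, hM''⟩
  have hle : |x.im / x0.im - m| ≤ 1 / 2 := abs_sub_round _
  have e : y.im = (x.im / x0.im - m) * x0.im := by rw [hyim]; field_simp
  have hsq : (x.im / x0.im - m) ^ 2 ≤ (1/2) ^ 2 := by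
    rw [← sq_abs]; exact pow_le_pow_left₀ (abs_nonneg _) hle 2
  have hMpos : (0:ℝ) < M := by exact_mod_cast hpos
  have : (M' : ℝ) < M := by
    rw [← hM'', e]
    have e2 : (2 * ((x.im / x0.im - m) * x0.im)) ^ 2 = (x.im / x0.im - m) ^ 2 * (2 * x0.im)^2 := by ring
    rw [e2, hM]
    nlinarith
  exact_mod_cast this

lemma order_dvd {x : ℂ} (hx : x ∈ OL L) {q : ℕ} (hq : 0 < q) (ho : orderOf x = q) :
    q ∣ Nat.card (CommGroup.torsion (OL L)ˣ) := by
  have hp : (⟨x, hx⟩ : OL L) ^ q = 1 := by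
    apply Subtype.ext
    change x ^ q = 1
    rw [← ho]; exact pow_orderOf_eq_one x
  let u : (OL L)ˣ := Units.ofPowEqOne _ q hp hq.ne'
  have hou : orderOf u = q := by
    rw [← orderOf_units, Units.val_ofPowEqOne, ← ho]
    exact (orderOf_injective (OL L).subtype.toMonoidHom Subtype.val_injective _).symm
  have hut : u ∈ CommGroup.torsion (OL L)ˣ := by
    rw [CommGroup.mem_torsion, ← orderOf_pos_iff, hou]; exact hq
  have := orderOf_dvd_natCard (⟨u, hut⟩ : CommGroup.torsion (OL L)ˣ)
  rwa [Subgroup.orderOf_mk, hou] at this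

variable {n : ℕ} {γ : Matrix (Fin n ⊕ Fin n) (Fin n ⊕ Fin n) ℂ}

lemma det_pow_one (h : IsCMExtension Lp L) {v : ℕ} (hvd : WeightCond Lp L h.1 v)
    (hint : ∀ a ∈ OL L, a.im = 0 → ∃ m : ℤ, a = m)
    (hγ : InUnitary n γ) (hent : ∀ p q, γ p q ∈ OL L) : γ.det ^ v = 1 := by
  obtain ⟨x0, hx0, him, hgen⟩ := exists_gen h hint
  have hc0 := conj_mem_OL h hx0
  obtain ⟨c, hc, hd⟩ := det_congr_one hγ hent (δ := x0 - conj x0) (sub_mem hx0 hc0) (by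
    intro x hx
    obtain ⟨m, hm⟩ := hgen x hx
    refine ⟨((-m : ℤ) : ℂ), intCast_mem _ _, ?_⟩
    apply Complex.ext <;> simp [hm]
    ring)
  have hu := unitary_det hγ
  have hdm : γ.det ∈ OL L := by
    rw [hd]; exact add_mem (one_mem _) (mul_mem (sub_mem hx0 hc0) hc)
  have hmv : Nat.card (CommGroup.torsion (OL L)ˣ) / 2 ∣ v := dvd_of_mul_right_dvd hvd
  set d := γ.det
  obtain ⟨t0, N0, ht0, hN0⟩ := int_data h hint hx0
  obtain ⟨t, N, ht, -⟩ := int_data h hint hdm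
  obtain ⟨m, hm⟩ := hgen c hc
  have hu1 := congrArg Complex.re hu
  simp at hu1
  have hdre := congrArg Complex.re hd
  simp [hm] at hdre
  set M : ℤ := 4 * N0 - t0 ^ 2 with hMdef
  have hMpos : 0 < M := by
    have : 0 < (2 * x0.im) ^ 2 := by positivity
    rw [hN0] at this; exact_mod_cast this
  have hrel : 2 - t = m * M := by
    have : (2 - t : ℝ) = m * M := by rw [← ht, ← hN0, hdre]; ring
    exact_mod_cast this
  have htb : -2 ≤ t ∧ t ≤ 2 := by
    have h1 : d.re ≤ 1 := by nlinarith [sq_nonneg d.im]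
    have h2 : -1 ≤ d.re := by nlinarith [sq_nonneg d.im]
    constructor
    · have : (-2:ℝ) ≤ t := by linarith
      exact_mod_cast this
    · have : (t:ℝ) ≤ 2 := by linarith
      exact_mod_cast this
  have hmod : M % 4 = 0 ∨ M % 4 = 3 := by
    rcases Int.even_or_odd' t0 with ⟨s, hs | hs⟩
    · left; rw [hMdef, hs]; ring_nf; omega
    · right; rw [hMdef, hs]; ring_nf; omega
  have h2m : 2 ∣ Nat.card (CommGroup.torsion (OL L)ˣ) := by
    refine order_dvd (x := -1) (neg_mem (one_mem _)) two_pos ?_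
    refine orderOf_eq_prime (by norm_num) (by norm_num)
  have hcases : t = 2 ∨ (M = 3 ∧ t = -1) ∨ (M = 4 ∧ t = -2) := by
    obtain ⟨h1, h2⟩ := htb
    by_cases hm0 : m ≤ 0
    · left; nlinarith
    · have hm1 : 1 ≤ m := by omega
      have hM4 : M ≤ 4 := by nlinarith
      have : M = 3 ∨ M = 4 := by omega
      rcases this with e | e <;> rw [e] at hrel ⊢ <;> omega
  rcases hcases with e | ⟨e1, e2⟩ | ⟨e1, e2⟩
  · have hr : d.re = 1 := by rw [e] at ht; push_cast at ht; linarith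
    have hi : d.im = 0 := by rw [hr] at hu1; nlinarith
    have : d = 1 := Complex.ext (by simpa using hr) (by simpa using hi)
    rw [this, one_pow]
  · have hr : d.re = -1/2 := by rw [e2] at ht; push_cast at ht; linarith
    have hd3 : d ^ 3 = 1 := by
      have hq : d ^ 2 + d + 1 = 0 := by
        have h1 : conj d = -1 - d := by apply Complex.ext <;> simp [hr]; norm_num
        rw [h1] at hu; linear_combination -hu
      linear_combination (d - 1) * hq
    have hd1 : d ≠ 1 := by intro h1; rw [h1] at hr; norm_num at hr
    have h3 := order_dvd hdm (by norm_num) (orderOf_eq_prime hd3 hd1)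
    have : 3 ∣ v := (by omega : 3 ∣ Nat.card (CommGroup.torsion (OL L)ˣ) / 2).trans hmv
    obtain ⟨w, rfl⟩ := this
    rw [pow_mul, hd3, one_pow]
  · have hr : d.re = -1 := by rw [e2] at ht; push_cast at ht; linarith
    have hi : d.im = 0 := by rw [hr] at hu1; nlinarith
    have hdn : d = -1 := Complex.ext (by simpa using hr) (by simpa using hi)
    have hev : ∃ s, t0 = 2 * s := by
      rcases Int.even_or_odd' t0 with ⟨s, hs | hs⟩
      · exact ⟨s, hs⟩
      · exfalso; rw [hMdef, hs] at e1; ring_nf at e1; omega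
    obtain ⟨s, hs⟩ := hev
    let y : ℂ := x0 - s
    have hy : y ∈ OL L := sub_mem hx0 (intCast_mem _ s)
    have hy2 : y ^ 2 = -1 := by
      have hyre : y.re = 0 := by
        simp [y]; rw [hs] at ht0; push_cast at ht0; linarith
      have hyim : y.im ^ 2 = 1 := by
        have : y.im = x0.im := by simp [y]
        rw [this]; rw [e1] at hN0; push_cast at hN0; linarith
      apply Complex.ext
      · simp [sq, hyre]; linarith
      · simp [sq, hyre]
    have h4 : 4 ∣ Nat.card (CommGroup.torsion (OL L)ˣ) := by
      refine order_dvd hy (by norm_num) ?_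
      have := orderOf_eq_prime_pow (p := 2) (n := 1) (x := y) (by
        rw [pow_one, hy2]; norm_num) (by
        norm_num; rw [show (4:ℕ) = 2 * 2 by rfl, pow_mul, hy2]; norm_num)
      simpa using this
    have : 2 ∣ v := (by omega : 2 ∣ Nat.card (CommGroup.torsion (OL L)ˣ) / 2).trans hmv
    obtain ⟨w, rfl⟩ := this
    rw [pow_mul, hdn]; norm_num
end nt2

section case1
open ComplexConjugate
variable {Lp L : Subfield ℂ} {n : ℕ}

lemma irr_of {a : ℂ} (ha : a ∈ OL L) (him : a.im = 0) (hni : ¬ ∃ m : ℤ, a = m) :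
    Irrational a.re := by
  rintro ⟨q, hq⟩
  have haq : a = algebraMap ℚ ℂ q := by
    apply Complex.ext
    · simp [← hq]
    · simp [him]
  have hi := (mem_OL.1 ha).1
  rw [haq, isIntegral_algebraMap_iff (algebraMap ℚ ℂ).injective,
    IsIntegrallyClosed.isIntegral_iff] at hi
  obtain ⟨y, hy⟩ := hi
  apply hni
  refine ⟨y, ?_⟩
  rw [haq, ← hy]; simp

lemma transl_mem {S Z : Matrix (Fin n) (Fin n) ℂ} (hS : Sᴴ = S) (hZ : Z ∈ UpperHalf n) :
    Z + S ∈ UpperHalf n := by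
  unfold UpperHalf at hZ ⊢
  simp only [Set.mem_ofPred_eq, conjTranspose_add, hS] at hZ ⊢
  rwa [add_sub_add_right_eq_sub]

lemma transl_unitary {S : Matrix (Fin n) (Fin n) ℂ} (hS : Sᴴ = S) :
    InUnitary n (fromBlocks 1 S 0 1) := by
  unfold InUnitary Jmat
  rw [fromBlocks_conjTranspose, fromBlocks_multiply, fromBlocks_multiply]
  simp [hS]

lemma lower_unitary (c : ℝ) :
    InUnitary n (fromBlocks 1 0 ((c : ℂ) • 1) 1) := by
  unfold InUnitary Jmat
  rw [fromBlocks_conjTranspose, fromBlocks_multiply, fromBlocks_multiply]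
  simp
  rw [smul_comm, add_neg_cancel]

variable {Γ : Set (Matrix (Fin n ⊕ Fin n) (Fin n ⊕ Fin n) ℂ)} {F : (Fin n × Fin n → ℂ) → ℂ} {k : ℤ}

lemma transl_inv (hF : IsHMF n Γ k F) {S : Matrix (Fin n) (Fin n) ℂ}
    (hm : fromBlocks 1 S 0 1 ∈ Γ) {z : Fin n × Fin n → ℂ} (hz : toSq z ∈ UpperHalf n) :
    F (z + ofSq S) = F z := by
  rw [hF.2 _ hm z hz]
  simp [autFactor, actU]
  congr 1

lemma dense_pair {N : ℕ} (hN : 0 < N) {a : ℝ} (ha : Irrational a) :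
    Dense (AddSubgroup.closure {(N : ℝ) * a, (N : ℝ)} : Set ℝ) := by
  rw [dense_addSubgroupClosure_pair_iff]
  have : (N : ℝ) ≠ 0 := by positivity
  rwa [mul_div_cancel_left₀ _ this]

lemma transl_real (hF : IsHMF n Γ k F) {S : Matrix (Fin n) (Fin n) ℂ} (hS : Sᴴ = S)
    {N : ℕ} (hN : 0 < N) {a : ℝ} (ha : Irrational a)
    (h1 : fromBlocks 1 (((N : ℝ) : ℂ) • S) 0 1 ∈ Γ)
    (h2 : fromBlocks 1 ((((N : ℝ) * a : ℝ) : ℂ) • S) 0 1 ∈ Γ)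
    {z : Fin n × Fin n → ℂ} (hz : toSq z ∈ UpperHalf n) (s : ℝ) :
    F (z + (s : ℂ) • ofSq S) = F z := by
  have hmem : ∀ (s : ℝ) (z : Fin n × Fin n → ℂ), toSq z ∈ UpperHalf n →
      toSq (z + (s : ℂ) • ofSq S) ∈ UpperHalf n := by
    intro s z hz
    have := transl_mem (S := (s : ℂ) • S) (by rw [conjTranspose_smul, hS]; simp) hz
    exact this
  let G : AddSubgroup ℝ :=
    { carrier := {s | ∀ z, toSq z ∈ UpperHalf n → F (z + (s : ℂ) • ofSq S) = F z}
      zero_mem' := by intro z hz; simp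
      add_mem' := by
        intro a b ha hb z hz
        have := ha _ (hmem b z hz)
        rw [hb z hz] at this
        rw [← this]; congr 1; push_cast; rw [add_smul]; abel
      neg_mem' := by
        intro a ha z hz
        have := ha _ (hmem (-a) z hz)
        rw [← this]; congr 1; push_cast; rw [neg_smul]; abel }
  have hG : AddSubgroup.closure {(N : ℝ) * a, (N : ℝ)} ≤ G := by
    rw [AddSubgroup.closure_le]
    rintro x (rfl | rfl)
    · exact fun z hz => transl_inv hF h2 hz
    · exact fun z hz => transl_inv hF h1 hz
  have hcont : Continuous fun s : ℝ => F (z + (s : ℂ) • ofSq S) := by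
    have h0 : ContinuousOn F {z | toSq z ∈ UpperHalf n} := hF.1.continuousOn
    exact h0.comp_continuous (by fun_prop) (fun s => hmem s z hz)
  have := Continuous.ext_on (dense_pair hN ha) hcont
    (continuous_const (y := F z)) (fun s hs => hG hs z hz)
  exact congrFun this s

lemma fderiv_herm (hF : IsHMF n Γ k F) {S : Matrix (Fin n) (Fin n) ℂ} (hS : Sᴴ = S)
    {N : ℕ} (hN : 0 < N) {a : ℝ} (ha : Irrational a)
    (h1 : fromBlocks 1 (((N : ℝ) : ℂ) • S) 0 1 ∈ Γ)
    (h2 : fromBlocks 1 ((((N : ℝ) * a : ℝ) : ℂ) • S) 0 1 ∈ Γ)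
    {z : Fin n × Fin n → ℂ} (hz : toSq z ∈ UpperHalf n) (hd : DifferentiableAt ℂ F z) :
    fderiv ℂ F z (ofSq S) = 0 := by
  have hl := hd.hasFDerivAt.hasLineDerivAt (ofSq S)
  unfold HasLineDerivAt at hl
  have hr := hl.comp_ofReal
  have hc : HasDerivAt (fun _ : ℝ => F z) 0 (0:ℝ) := hasDerivAt_const _ _
  refine hr.unique ?_
  have e : (fun y : ℝ => F (z + (y : ℂ) • ofSq S)) = fun _ => F z :=
    funext fun s => transl_real hF hS hN ha h1 h2 hz s
  rw [e]
  exact hc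

lemma fderiv_HMF_zero (hCM : IsCMExtension Lp L) (hΓ : IsCongruenceSubgroup n L Γ)
    (hF : IsHMF n Γ k F) {a : ℂ} (ha : a ∈ OL L) (him : a.im = 0) (hni : ¬ ∃ m : ℤ, a = m)
    {z : Fin n × Fin n → ℂ} (hz : toSq z ∈ UpperHalf n) (hd : DifferentiableAt ℂ F z) :
    fderiv ℂ F z = 0 := by
  obtain ⟨-, -, -, -, N, hN, hcong⟩ := hΓ
  have hir := irr_of ha him hni
  have hare : ((a.re : ℝ) : ℂ) = a := by apply Complex.ext <;> simp [him]
  have hmemS : ∀ (S : Matrix (Fin n) (Fin n) ℂ) (c : ℂ), Sᴴ = S → (∀ i j, S i j ∈ OL L) →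
      c ∈ OL L → c.im = 0 → fromBlocks 1 (((N : ℂ) * c) • S) 0 1 ∈ Γ := by
    intro S c hS hSm hc hci
    apply hcong
    · apply transl_unitary
      rw [conjTranspose_smul, hS]
      congr 1
      simp [Complex.conj_eq_iff_im.2 hci]
    · rintro (i | i) (j | j)
      · simp only [fromBlocks_apply₁₁, one_apply]; split_ifs <;> simp
      · simp only [fromBlocks_apply₁₂, Matrix.smul_apply, smul_eq_mul]
        exact mul_mem (mul_mem (natCast_mem _ N) hc) (hSm i j)
      · simp
      · simp only [fromBlocks_apply₂₂, one_apply]; split_ifs <;> simp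
    · rintro (i | i) (j | j)
      · exact ⟨0, zero_mem _, by simp [one_apply]⟩
      · exact ⟨c * S i j, mul_mem hc (hSm i j), by simp; ring⟩
      · exact ⟨0, zero_mem _, by simp⟩
      · exact ⟨0, zero_mem _, by simp [one_apply]⟩
  have hSz : ∀ (S : Matrix (Fin n) (Fin n) ℂ), Sᴴ = S → (∀ i j, S i j ∈ OL L) →
      fderiv ℂ F z (ofSq S) = 0 := by
    intro S hS hSm
    refine fderiv_herm hF hS hN hir ?_ ?_ hz hd
    · simpa using hmemS S 1 hS hSm (one_mem _) (by simp)
    · have := hmemS S a hS hSm ha him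
      convert this using 3
      push_cast; rw [hare]
  obtain ⟨x, hx, hxi⟩ := exists_nonreal hCM
  have hsplit : ∀ (s t : Fin n) (y : ℂ), ofSq (single s t y) =
      y • (Pi.single (s, t) 1 : Fin n × Fin n → ℂ) := by
    intro s t y
    funext ⟨i, j⟩
    by_cases h1 : s = i <;> by_cases h2 : t = j <;>
      simp [ofSq, single_apply, Pi.single_apply, h1, h2, eq_comm]
  have hbase : ∀ s t : Fin n, fderiv ℂ F z (Pi.single (s, t) 1) = 0 := by
    intro s t
    have key : ∀ y ∈ OL L, y * fderiv ℂ F z (Pi.single (s, t) 1) +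
        conj y * fderiv ℂ F z (Pi.single (t, s) 1) = 0 := by
      intro y hy
      have hyc := conj_mem_OL hCM hy
      have := hSz (single s t y + single t s (conj y)) (by
        rw [conjTranspose_add, conjTranspose_single, conjTranspose_single, add_comm]
        simp) (by
        intro i j
        rw [Matrix.add_apply, single_apply, single_apply]
        refine add_mem ?_ ?_ <;> split_ifs <;> first | assumption | exact zero_mem _)
      have e : ofSq (single s t y + single t s (conj y)) =
        ofSq (single s t y) + ofSq (single t s (conj y)) := rfl
      rw [e, hsplit, hsplit, map_add, map_smul, map_smul] at this
      simpa using this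
    have k1 := key 1 (one_mem _)
    have k2 := key x hx
    simp only [map_one] at k1
    have k3 : (x - conj x) * fderiv ℂ F z (Pi.single (s, t) 1) = 0 := by
      linear_combination k2 - conj x * k1
    rcases mul_eq_zero.1 k3 with h0 | h0
    · exfalso
      apply hxi
      exact Complex.conj_eq_iff_im.1 (sub_eq_zero.1 h0).symm
    · exact h0
  ext w
  rw [pi_eq_sum_univ' w, map_sum]
  simp only [map_smul]
  refine Finset.sum_eq_zero fun p _ => ?_
  have : (fun j => if p = j then (1:ℂ) else 0) = Pi.single (p.1, p.2) 1 := by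
    funext j; simp [Pi.single_apply, eq_comm]
  simp [this, hbase]

lemma iOne_mem : (Complex.I • (1 : Matrix (Fin n) (Fin n) ℂ)) ∈ UpperHalf n := by
  unfold UpperHalf
  rw [Set.mem_ofPred_eq, conjTranspose_smul]
  have : (2 * Complex.I)⁻¹ • (Complex.I • (1 : Matrix (Fin n) (Fin n) ℂ) - star Complex.I • (1 : Matrix (Fin n) (Fin n) ℂ)ᴴ) = 1 := by
    simp only [conjTranspose_one, ← sub_smul, smul_smul]
    rw [show (2 * Complex.I)⁻¹ * (Complex.I - star Complex.I) = 1 by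
      simp; field_simp; norm_num]
    simp
  rw [this]
  exact PosDef.one

lemma UH_preconn : IsPreconnected {z : Fin n × Fin n → ℂ | toSq z ∈ UpperHalf n} := by
  apply Convex.isPreconnected
  intro z hz w hw a b ha hb hab
  simp only [Set.mem_ofPred_eq, mem_UH] at hz hw ⊢
  intro x hx
  have e : toSq (a • z + b • w) = (a : ℂ) • toSq z + (b : ℂ) • toSq w := by
    ext i j; simp [toSq]
  have h1 := hz x hx
  have h2 := hw x hx
  rw [e, add_mulVec, smul_mulVec, smul_mulVec, dotProduct_add, dotProduct_smul, dotProduct_smul]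
  simp only [smul_eq_mul, Complex.add_im, Complex.re_ofReal_mul, Complex.im_ofReal_mul]
  rcases ha.eq_or_lt with h | h
  · have : b = 1 := by linarith
    rw [← h, this]; simpa using h2
  · have := mul_pos h h1
    have := mul_nonneg hb h2.le
    linarith

end case1

section case1b
variable {Lp L : Subfield ℂ} {n : ℕ}
variable {Γ : Set (Matrix (Fin n ⊕ Fin n) (Fin n ⊕ Fin n) ℂ)} {F : (Fin n × Fin n → ℂ) → ℂ} {k : ℤ}

lemma lower_mem {N : ℕ}
    (hcong : ∀ γ : Matrix (Fin n ⊕ Fin n) (Fin n ⊕ Fin n) ℂ,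
        InUnitary n γ → (∀ p q, γ p q ∈ OL L) →
        (∀ p q, ∃ a ∈ OL L,
          γ p q - (1 : Matrix (Fin n ⊕ Fin n) (Fin n ⊕ Fin n) ℂ) p q = (N : ℂ) * a) →
        γ ∈ Γ) : (fromBlocks 1 0 (((N : ℝ) : ℂ) • 1) 1) ∈ Γ := by
  apply hcong _ (lower_unitary (n := n) (N : ℝ))
  · rintro (i | i) (j | j)
    · simp only [fromBlocks_apply₁₁, one_apply]; split_ifs <;> simp
    · simp
    · by_cases hij : i = j
      · simp [hij]
      · simp [hij]
    · simp only [fromBlocks_apply₂₂, one_apply]; split_ifs <;> simp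
  · rintro (i | i) (j | j)
    · exact ⟨0, zero_mem _, by simp [one_apply]⟩
    · exact ⟨0, zero_mem _, by simp⟩
    · by_cases hij : i = j
      · exact ⟨1, one_mem _, by simp [hij]⟩
      · exact ⟨0, zero_mem _, by simp [hij]⟩
    · exact ⟨0, zero_mem _, by simp [one_apply]⟩

lemma lower_aut (N : ℕ) : autFactor (fromBlocks 1 0 (((N : ℝ) : ℂ) • 1) 1)
    ((Complex.I • 1 : Matrix (Fin n) (Fin n) ℂ)) = (N * Complex.I + 1) ^ n := by
  rw [autFactor, toBlocks_fromBlocks₂₁, toBlocks_fromBlocks₂₂, smul_mul_assoc, one_mul, smul_smul]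
  have : (((N : ℝ) : ℂ) * Complex.I) • (1 : Matrix (Fin n) (Fin n) ℂ) + 1 =
      ((N : ℂ) * Complex.I + 1) • (1 : Matrix (Fin n) (Fin n) ℂ) := by
    rw [add_smul, one_smul]; simp
  rw [this, det_smul, det_one, mul_one, Fintype.card_fin]

lemma lower_ne (hn : 1 ≤ n) (hk : 0 < k) {N : ℕ} (hN : 0 < N) :
    ((N * Complex.I + 1 : ℂ) ^ n) ^ (-k) ≠ 1 := by
  intro h1
  have hgt : 1 < ‖(N * Complex.I + 1 : ℂ)‖ := by
    have hN1 : (1:ℝ) ≤ N := by exact_mod_cast hN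
    rw [← sq_lt_sq₀ zero_le_one (norm_nonneg _), ← Complex.normSq_eq_norm_sq, Complex.normSq_apply]
    simp; positivity
  have h2 := congrArg norm h1
  rw [norm_zpow, norm_pow, norm_one, _root_.zpow_neg, inv_eq_one] at h2
  have h3 : 1 < ‖(N * Complex.I + 1 : ℂ)‖ ^ n := one_lt_pow₀ hgt (by omega)
  exact (one_lt_zpow₀ h3 hk).ne' h2

lemma F_const (hCM : IsCMExtension Lp L) (hΓ : IsCongruenceSubgroup n L Γ)
    (hF : IsHMF n Γ k F) {a : ℂ} (ha : a ∈ OL L) (him : a.im = 0) (hni : ¬ ∃ m : ℤ, a = m)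
    {z w : Fin n × Fin n → ℂ} (hz : toSq z ∈ UpperHalf n) (hw : toSq w ∈ UpperHalf n) :
    F z = F w := by
  have hop : IsOpen {z : Fin n × Fin n → ℂ | toSq z ∈ UpperHalf n} := isOpen_UH
  refine hop.is_const_of_fderiv_eq_zero (𝕜 := ℂ) UH_preconn hF.1 ?_ hz hw
  intro y hy
  exact fderiv_HMF_zero hCM hΓ hF ha him hni hy (hF.1.differentiableAt (hop.mem_nhds hy))

lemma F_zero (hCM : IsCMExtension Lp L) (hΓ : IsCongruenceSubgroup n L Γ) (hn : 1 ≤ n) (hk : 0 < k)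
    (hF : IsHMF n Γ k F) {a : ℂ} (ha : a ∈ OL L) (him : a.im = 0) (hni : ¬ ∃ m : ℤ, a = m)
    {z : Fin n × Fin n → ℂ} (hz : toSq z ∈ UpperHalf n) : F z = 0 := by
  obtain ⟨N, hN, hcong⟩ := hΓ.2.2.2.2
  have hm := lower_mem hcong
  have hU := lower_unitary (n := n) (N : ℝ)
  have hz0m : toSq (ofSq (Complex.I • (1 : Matrix (Fin n) (Fin n) ℂ))) ∈ UpperHalf n := iOne_mem
  have heq := hF.2 _ hm _ hz0m
  have ham := act_mem hU hz0m
  have hc := F_const hCM hΓ hF ha him hni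
    (z := ofSq (actU (fromBlocks 1 0 (((N : ℝ) : ℂ) • 1) 1)
      (toSq (ofSq (Complex.I • (1 : Matrix (Fin n) (Fin n) ℂ)))))) ham hz0m
  rw [hc] at heq
  have haf : autFactor (fromBlocks 1 0 (((N : ℝ) : ℂ) • 1) 1)
    (toSq (ofSq (Complex.I • (1 : Matrix (Fin n) (Fin n) ℂ)))) = (N * Complex.I + 1) ^ n := lower_aut N
  rw [haf] at heq
  rw [F_const hCM hΓ hF ha him hni hz hz0m]
  by_contra hne
  exact lower_ne hn hk hN (mul_right_cancel₀ hne (heq.symm.trans (one_mul _).symm))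
end case1b

/-- Corollary of Theorem A: let `L/L⁺` be a quadratic imaginary extension of a totally real
number field, `n, r ≥ 1`, `k₁, …, k_r` positive integers with each `k_i ≥ n`, and `v > 0`
divisible by `(|μ(L)|/2)·[O_L^× : μ(L)O_{L⁺}^×]`.  If `F₁, …, F_r` are scalar-valued
Hermitian modular forms of weights `k₁, …, k_r` and level `Γ`, and `Q ∈ H_{n,v}(k₁,…,k_r)`,
then `Z ↦ Q(∂/∂Z)(F₁(Z₁)⋯F_r(Z_r))|_{Z₁=⋯=Z_r=Z}` is a scalar-valued Hermitian modular form
of weight `k₁ + ⋯ + k_r + 2v` and level `Γ`. -/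
theorem stmt1 (Lp L : Subfield ℂ) (hCM : IsCMExtension Lp L)
    (n r v : ℕ) (hn : 1 ≤ n) (hr : 1 ≤ r) (k : Fin r → ℕ) (hk : ∀ i, n ≤ k i)
    (hv : 0 < v) (hvd : WeightCond Lp L hCM.1 v)
    (Γ : Set (Matrix (Fin n ⊕ Fin n) (Fin n ⊕ Fin n) ℂ))
    (hΓ : IsCongruenceSubgroup n L Γ)
    (F : Fin r → ((Fin n × Fin n → ℂ) → ℂ))
    (hF : ∀ i : Fin r, IsHMF n Γ ((k i : ℤ)) (F i))
    (Q : MvPolynomial (MIdx n r) ℂ) (hQ : MemH n v r k Q) :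
    IsHMF n Γ (((∑ i, k i : ℕ) : ℤ) + 2 * v)
      (fun z : Fin n × Fin n → ℂ =>
        polyDOp Q (fun w : MIdx n r → ℂ => ∏ i : Fin r, F i (fun p : Fin n × Fin n => w (i, p.1, p.2)))
          (fun p : MIdx n r => z (p.2.1, p.2.2))) := by
  change IsHMF n Γ (((∑ i, k i : ℕ) : ℤ) + 2 * v) (fun z => polyDOp Q (Phi F) (dg z))
  have hF1 := fun i => (hF i).1
  refine ⟨?_, ?_⟩
  · intro z hz
    have h1 : Hol (polyDOp Q (Phi F)) (dg z) := polyDOp_hol Q (Phi_hol hF1 fun _ => hz)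
    have h2 : DifferentiableAt ℂ (polyDOp Q (Phi F)) (dg z) := h1.self_of_nhds
    have h3 : DifferentiableAt ℂ (fun z => (dg z : MIdx n r → ℂ)) z := by
      unfold dg; fun_prop
    exact (DifferentiableAt.comp z h2 h3).differentiableWithinAt
  · intro γ hγ z hz
    obtain ⟨hU, hent⟩ := hΓ.1 γ hγ
    by_cases hint : ∀ a ∈ OL L, a.im = 0 → ∃ m : ℤ, a = m
    · have hd := det_pow_one hCM hvd hint hU hent
      have hd0 : γ.det ≠ 0 := by
        intro h0
        have := unitary_det hU
        rw [h0, mul_zero] at this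
        exact zero_ne_one this
      have := weight_formula hk hQ hF1 hU hd0 (fun i z hz => (hF i).2 γ hγ z hz) hz
      rw [hd, one_mul] at this
      exact this
    · push Not at hint
      obtain ⟨a, ha, him, hni⟩ := hint
      have hni' : ¬ ∃ m : ℤ, a = m := fun ⟨m, hm⟩ => hni m hm
      have hzero : ∀ z : Fin n × Fin n → ℂ, toSq z ∈ UpperHalf n →
          polyDOp Q (Phi F) (dg z) = 0 := by
        intro z hz
        rw [← polyDOp_fzero Q (dg z)]
        apply polyDOp_congr
        let i0 : Fin r := ⟨0, hr⟩
        have hcont : ContinuousAt (fun w : MIdx n r → ℂ => fun p : Fin n × Fin n => w (i0, p.1, p.2)) (dg z) := by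
          exact (continuous_pi fun p => continuous_apply _).continuousAt
        filter_upwards [hcont.preimage_mem_nhds (isOpen_UH.mem_nhds hz)] with w hw
        refine Finset.prod_eq_zero (Finset.mem_univ i0) ?_
        exact F_zero hCM hΓ hn (by exact_mod_cast hn.trans (hk i0)) (hF i0) ha him hni' hw
      change polyDOp Q (Phi F) (dg z) = _ * polyDOp Q (Phi F) (dg _)
      have hts : ∀ Z : Matrix (Fin n) (Fin n) ℂ, toSq (ofSq Z) = Z := fun _ => rfl
      have hw : toSq (ofSq (actU γ (toSq z))) ∈ UpperHalf n := by
        rw [hts]; exact act_mem hU hz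
      rw [hzero z hz, hzero _ hw, mul_zero]
end
end
end

section
/- For every integer n ≥ 1 and every integer v ≥ 0, the dimension of Q_{n,v}(2) as a vector space over ℂ equals the binomial coefficient C(n+v, v). -/
noncomputable section

/-- Variables for polynomials in the entries of two `n × n` matrices `W` (`Sum.inl`) and
`Z` (`Sum.inr`). -/
abbrev WZVars (n : ℕ) := (Fin n × Fin n) ⊕ (Fin n × Fin n)

/-- The polynomial `Q_a(W,Z)` defined by `det(W + λ Z) = Σ_a Q_a(W,Z) λ^a`. -/
def Qpoly (n a : ℕ) : MvPolynomial (WZVars n) ℂ :=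
  Polynomial.coeff
    (Matrix.det (Matrix.of fun s t : Fin n =>
      Polynomial.C (MvPolynomial.X (Sum.inl (s, t))) +
        Polynomial.X * Polynomial.C (MvPolynomial.X (Sum.inr (s, t))))) a

/-- The substitution `Q(W,Z) ↦ Q(A W ᵗB, A Z ᵗB)` on polynomials. -/
def substWZ {n : ℕ} (A B : Matrix (Fin n) (Fin n) ℂ) :
    MvPolynomial (WZVars n) ℂ →ₐ[ℂ] MvPolynomial (WZVars n) ℂ :=
  MvPolynomial.aeval
    (Sum.elim
      (fun st : Fin n × Fin n =>
        ∑ p : Fin n, ∑ q : Fin n,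
          MvPolynomial.C (A st.1 p * B st.2 q) * MvPolynomial.X (Sum.inl (p, q)))
      (fun st : Fin n × Fin n =>
        ∑ p : Fin n, ∑ q : Fin n,
          MvPolynomial.C (A st.1 p * B st.2 q) * MvPolynomial.X (Sum.inr (p, q))))

/-- Membership in `Q_{n,v}(2)`: `Q(A W ᵗB, A Z ᵗB) = det(A)^v det(B)^v Q(W,Z)` for all
invertible `A, B`. -/
def MemQ (n v : ℕ) (Q : MvPolynomial (WZVars n) ℂ) : Prop :=
  ∀ A B : Matrix (Fin n) (Fin n) ℂ, IsUnit A.det → IsUnit B.det →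
    substWZ A B Q = MvPolynomial.C (A.det ^ v * B.det ^ v) * Q

/-- The space `Q_{n,v}(2)`, as a ℂ-submodule of the polynomial ring. -/
def QSub (n v : ℕ) : Submodule ℂ (MvPolynomial (WZVars n) ℂ) where
  carrier := {Q | MemQ n v Q}
  zero_mem' := by intro A B hA hB; simp
  add_mem' := by
    intro a b ha hb A B hA hB
    simp [map_add, ha A B hA hB, hb A B hA hB, mul_add]
  smul_mem' := by
    intro c Q hQ A B hA hB
    simp [map_smul, hQ A B hA hB, mul_smul_comm]


/-! Evaluation -/

def pt {n : ℕ} (W Z : Matrix (Fin n) (Fin n) ℂ) : WZVars n → ℂ :=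
  Sum.elim (fun p => W p.1 p.2) (fun p => Z p.1 p.2)

def ev {n : ℕ} (W Z : Matrix (Fin n) (Fin n) ℂ) : MvPolynomial (WZVars n) ℂ →+* ℂ :=
  MvPolynomial.eval (pt W Z)

lemma pt_surj {n : ℕ} (x : WZVars n → ℂ) : ∃ W Z, x = pt W Z :=
  ⟨Matrix.of fun i j => x (Sum.inl (i, j)), Matrix.of fun i j => x (Sum.inr (i, j)), by
    funext y; rcases y with ⟨i, j⟩ | ⟨i, j⟩ <;> simp [pt]⟩

lemma ev_ext {n : ℕ} {p q : MvPolynomial (WZVars n) ℂ} (h : ∀ W Z, ev W Z p = ev W Z q) : p = q := by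
  apply MvPolynomial.funext
  intro x
  obtain ⟨W, Z, rfl⟩ := pt_surj x
  exact h W Z

lemma ev_subst {n : ℕ} (A B W Z : Matrix (Fin n) (Fin n) ℂ) (Q : MvPolynomial (WZVars n) ℂ) :
    ev W Z (substWZ A B Q) = ev (A * W * B.transpose) (A * Z * B.transpose) Q := by
  unfold ev substWZ
  induction Q using MvPolynomial.induction_on with
  | C a => simp
  | add p q hp hq => simp only [map_add, hp, hq]
  | mul_X p x hp =>
    rw [map_mul, map_mul, map_mul, hp]
    congr 1
    rcases x with ⟨i, j⟩ | ⟨i, j⟩ <;>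
    · simp [pt, Matrix.mul_apply, Finset.sum_mul]
      rw [Finset.sum_comm]
      refine Finset.sum_congr rfl fun _ _ => Finset.sum_congr rfl fun _ _ => ?_
      ring

lemma mem_ev {n v : ℕ} {Q : MvPolynomial (WZVars n) ℂ} (hQ : MemQ n v Q)
    (A B W Z : Matrix (Fin n) (Fin n) ℂ) (hA : IsUnit A.det) (hB : IsUnit B.det) :
    ev (A * W * B.transpose) (A * Z * B.transpose) Q = (A.det ^ v * B.det ^ v) * ev W Z Q := by
  rw [← ev_subst, hQ A B hA hB, map_mul]
  simp [ev]

lemma mem_of_ev {n v : ℕ} {Q : MvPolynomial (WZVars n) ℂ}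
    (h : ∀ A B W Z : Matrix (Fin n) (Fin n) ℂ,
    ev (A * W * B.transpose) (A * Z * B.transpose) Q = (A.det ^ v * B.det ^ v) * ev W Z Q) :
    MemQ n v Q := by
  intro A B _ _
  apply ev_ext
  intro W Z
  rw [ev_subst, h, map_mul]
  simp [ev]

/-! The determinant coefficients -/

lemma ev_Qpoly {n : ℕ} (a : ℕ) (W Z : Matrix (Fin n) (Fin n) ℂ) :
    ev W Z (Qpoly n a) = (Matrix.det (W.map Polynomial.C +
      (Polynomial.X : Polynomial ℂ) • Z.map Polynomial.C)).coeff a := by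
  unfold Qpoly
  rw [← Polynomial.coeff_map, ← Polynomial.coe_mapRingHom, RingHom.map_det]
  congr 2
  ext1 i j
  simp [ev, pt]

lemma Qpoly_mem {n : ℕ} (a : ℕ) : MemQ n 1 (Qpoly n a) := by
  apply mem_of_ev
  intro A B W Z
  rw [ev_Qpoly, ev_Qpoly]
  have : (A * W * B.transpose).map Polynomial.C +
      (Polynomial.X : Polynomial ℂ) • (A * Z * B.transpose).map Polynomial.C
      = A.map Polynomial.C * (W.map Polynomial.C +
      (Polynomial.X : Polynomial ℂ) • Z.map Polynomial.C) * B.transpose.map Polynomial.C := by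
    simp only [Matrix.map_mul, Matrix.mul_add, Matrix.add_mul, Matrix.mul_smul, Matrix.smul_mul]
  rw [this, Matrix.det_mul, Matrix.det_mul]
  have h1 : ∀ M : Matrix (Fin n) (Fin n) ℂ, (M.map Polynomial.C).det = Polynomial.C M.det := by
    intro M
    rw [RingHom.map_det]; rfl
  rw [h1, h1, mul_right_comm, ← Polynomial.C_mul, Polynomial.coeff_C_mul, Matrix.det_transpose]
  simp

lemma MemQ_mul {n v w : ℕ} {P Q : MvPolynomial (WZVars n) ℂ} (hP : MemQ n v P) (hQ : MemQ n w Q) :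
    MemQ n (v + w) (P * Q) := by
  intro A B hA hB
  rw [map_mul, hP A B hA hB, hQ A B hA hB]
  simp only [map_mul, pow_add]
  ring

lemma MemQ_prod {n : ℕ} (s : Multiset (Fin (n + 1))) :
    MemQ n (Multiset.card s) (s.map fun a : Fin (n + 1) => Qpoly n a).prod := by
  induction s using Multiset.induction_on with
  | empty => intro A B _ _; simp
  | cons a s ih =>
    rw [Multiset.map_cons, Multiset.prod_cons, Multiset.card_cons, add_comm]
    exact MemQ_mul (Qpoly_mem _) ih

/-! Restriction to `W = 1`, `Z` diagonal -/

def resVar (n : ℕ) : WZVars n → MvPolynomial (Fin n) ℂ :=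
  Sum.elim (fun p => if p.1 = p.2 then 1 else 0)
    (fun p => if p.1 = p.2 then MvPolynomial.X p.1 else 0)

def res (n : ℕ) : MvPolynomial (WZVars n) ℂ →ₐ[ℂ] MvPolynomial (Fin n) ℂ :=
  MvPolynomial.aeval (resVar n)

lemma eval_res {n : ℕ} (z : Fin n → ℂ) (Q : MvPolynomial (WZVars n) ℂ) :
    MvPolynomial.eval z (res n Q) = ev 1 (Matrix.diagonal z) Q := by
  unfold res ev
  induction Q using MvPolynomial.induction_on with
  | C a => simp
  | add p q hp hq => simp only [map_add, hp, hq]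
  | mul_X p x hp =>
    simp only [map_mul, hp]
    congr 1
    rcases x with ⟨i, j⟩ | ⟨i, j⟩ <;>
    · by_cases h : i = j <;> simp [pt, resVar, Matrix.one_apply, Matrix.diagonal_apply, h]

lemma res_Qpoly {n : ℕ} (a : ℕ) : res n (Qpoly n a) = MvPolynomial.esymm (Fin n) ℂ a := by
  apply MvPolynomial.funext
  intro z
  rw [eval_res, ev_Qpoly]
  have : ((1 : Matrix (Fin n) (Fin n) ℂ).map Polynomial.C +
      (Polynomial.X : Polynomial ℂ) • (Matrix.diagonal z).map Polynomial.C)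
      = Matrix.diagonal fun i => 1 + Polynomial.X * Polynomial.C (z i) := by
    ext1 i j
    by_cases h : i = j <;> simp [h, Matrix.diagonal_apply, Matrix.one_apply]
  rw [this, Matrix.det_diagonal, Finset.prod_one_add, Polynomial.finsetSum_coeff,
    MvPolynomial.esymm, map_sum, Finset.powersetCard_eq_filter, Finset.sum_filter]
  refine Finset.sum_congr rfl fun s _ => ?_
  rw [Finset.prod_mul_distrib, ← map_prod, Finset.prod_const, Polynomial.coeff_mul_C,
    Polynomial.coeff_X_pow]
  by_cases h : s.card = a
  · simp [h]
  · simp [h, Ne.symm h]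

def tof {n : ℕ} (s : Multiset (Fin (n + 1))) : Fin n →₀ ℕ :=
  Finsupp.equivFunOnFinite.symm fun i => s.count i.succ

lemma res_prod {n : ℕ} (s : Multiset (Fin (n + 1))) :
    res n (s.map fun a : Fin (n + 1) => Qpoly n a).prod =
      MvPolynomial.aeval (fun i : Fin n => MvPolynomial.esymm (Fin n) ℂ (i + 1))
        (MvPolynomial.monomial (tof s) (1 : ℂ)) := by
  rw [MvPolynomial.aeval_monomial, map_one, one_mul, map_multiset_prod, Multiset.map_map,
    Finset.prod_multiset_map_count, Finsupp.prod_fintype _ _ (by simp)]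
  rw [Finset.prod_subset (Finset.subset_univ _) (by
    intro x _ hx
    rw [Multiset.mem_toFinset] at hx
    rw [Multiset.count_eq_zero_of_notMem hx, pow_zero]), Fin.prod_univ_succ]
  simp only [Function.comp]
  rw [res_Qpoly]
  simp only [Fin.val_zero, MvPolynomial.esymm_zero, one_pow, one_mul]
  refine Finset.prod_congr rfl fun i _ => ?_
  rw [res_Qpoly]
  simp [tof]

lemma tof_inj {n v : ℕ} : Function.Injective fun s : Sym (Fin (n + 1)) v => tof (s : Multiset (Fin (n + 1))) := by
  intro s t h
  have h1 : ∀ i : Fin n, (s : Multiset (Fin (n + 1))).count i.succ = (t : Multiset (Fin (n + 1))).count i.succ := by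
    intro i
    have := DFunLike.congr_fun h i
    simpa [tof] using this
  have hs : ∑ i, (s : Multiset (Fin (n + 1))).count i = v := by
    rw [Multiset.sum_count_eq_card (by simp)]; exact s.2
  have ht : ∑ i, (t : Multiset (Fin (n + 1))).count i = v := by
    rw [Multiset.sum_count_eq_card (by simp)]; exact t.2
  rw [Fin.sum_univ_succ] at hs ht
  simp only [h1] at hs
  apply Sym.coe_injective
  apply Multiset.ext.2
  intro a
  refine Fin.cases ?_ h1 a
  omega

lemma lower_li (n v : ℕ) : LinearIndependent ℂ (fun s : Sym (Fin (n + 1)) v =>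
    (⟨((s : Multiset (Fin (n + 1))).map fun a : Fin (n + 1) => Qpoly n a).prod, by
      have := MemQ_prod (s : Multiset (Fin (n + 1)))
      have h2 : Multiset.card (s : Multiset (Fin (n + 1))) = v := s.2
      rwa [h2] at this⟩ : QSub n v)) := by
  apply LinearIndependent.of_comp ((res n).toLinearMap ∘ₗ (QSub n v).subtype)
  have h0 : LinearIndependent ℂ (fun s : Sym (Fin (n + 1)) v =>
      MvPolynomial.monomial (tof (s : Multiset (Fin (n + 1)))) (1 : ℂ)) := by
    have := (MvPolynomial.basisMonomials (Fin n) ℂ).linearIndependent.comp _ (tof_inj (n := n) (v := v))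
    simpa [Function.comp_def] using this
  have hinj : Function.Injective
      (MvPolynomial.aeval (fun i : Fin n => MvPolynomial.esymm (Fin n) ℂ (i + 1)) :
        MvPolynomial (Fin n) ℂ →ₐ[ℂ] MvPolynomial (Fin n) ℂ) := by
    intro p q h
    apply MvPolynomial.esymmAlgHom_fin_injective (R := ℂ) (le_refl n)
    apply Subtype.ext
    rw [MvPolynomial.esymmAlgHom_apply, MvPolynomial.esymmAlgHom_apply]
    exact h
  have := h0.map' (AlgHom.toLinearMap (MvPolynomial.aeval
    (fun i : Fin n => MvPolynomial.esymm (Fin n) ℂ (i + 1)))) (LinearMap.ker_eq_bot.2 hinj)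
  have h3 : LinearIndependent ℂ (fun s : Sym (Fin (n + 1)) v =>
      res n ((s : Multiset (Fin (n + 1))).map fun a : Fin (n + 1) => Qpoly n a).prod) := by
    simp only [res_prod]
    exact this
  exact h3

/-! Triangularization -/

def bord {n : ℕ} (P : Matrix (Fin n) (Fin n) ℂ) : Matrix (Fin (n + 1)) (Fin (n + 1)) ℂ :=
  Matrix.of (Fin.cons (Fin.cons 1 0) (fun i => Fin.cons 0 (P i)))

lemma bord_mul {n : ℕ} (P R : Matrix (Fin n) (Fin n) ℂ) (h : P * R = 1) : bord P * bord R = 1 := by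
  ext i j
  have h2 : ∀ i j, ∑ k, P i k * R k j = (1 : Matrix (Fin n) (Fin n) ℂ) i j := by
    intro i j
    rw [← h, Matrix.mul_apply]
  rw [Matrix.mul_apply, Fin.sum_univ_succ]
  refine Fin.cases ?_ (fun i => ?_) i <;> refine Fin.cases ?_ (fun j => ?_) j <;>
    simp [bord, h2, Matrix.one_apply, Fin.succ_ne_zero, (Fin.succ_ne_zero _).symm]

lemma tri : ∀ (n : ℕ) (M : Matrix (Fin n) (Fin n) ℂ), ∃ P R : Matrix (Fin n) (Fin n) ℂ,
    P * R = 1 ∧ ∀ i j, j < i → (R * M * P) i j = 0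
  | 0, M => ⟨1, 1, by simp, fun i => i.elim0⟩
  | n + 1, M => by
    obtain ⟨μ, hμ⟩ := Module.End.exists_eigenvalue (Matrix.toLin' M)
    obtain ⟨v, hv⟩ := hμ.exists_hasEigenvector
    obtain ⟨e, he⟩ := SeparatingDual.exists_continuousLinearEquiv_apply_eq (R := ℂ)
      (x := (Pi.single 0 1 : Fin (n + 1) → ℂ)) (y := v) (by simp) hv.2
    let P0 := LinearMap.toMatrix' (e.toLinearEquiv : (Fin (n + 1) → ℂ) →ₗ[ℂ] (Fin (n + 1) → ℂ))
    let R0 := LinearMap.toMatrix' (e.symm.toLinearEquiv : (Fin (n + 1) → ℂ) →ₗ[ℂ] (Fin (n + 1) → ℂ))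
    have hPR : P0 * R0 = 1 := by
      rw [← LinearMap.toMatrix'_comp, ← LinearMap.toMatrix'_id]
      congr 1
      ext; simp
    set N := R0 * M * P0 with hN
    have hN0 : N.mulVec (Pi.single 0 1) = μ • Pi.single 0 1 := by
      rw [hN, ← Matrix.mulVec_mulVec, ← Matrix.mulVec_mulVec]
      have h1 : P0.mulVec (Pi.single 0 1) = v := by
        rw [← he]; exact LinearMap.toMatrix'_mulVec _ _
      have h2 : M.mulVec v = μ • v := by
        have := hv.apply_eq_smul
        simpa using this
      have h3 : R0.mulVec v = Pi.single 0 1 := by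
        have : R0.mulVec v = e.symm v := LinearMap.toMatrix'_mulVec _ _
        rw [this, ← he]; simp
      rw [h1, h2, Matrix.mulVec_smul, h3]
    have hN1 : ∀ i : Fin n, N i.succ 0 = 0 := by
      intro i
      have := congrFun hN0 i.succ
      simpa [Fin.succ_ne_zero] using this
    obtain ⟨P, R, h, ht⟩ := tri n (N.submatrix Fin.succ Fin.succ)
    refine ⟨P0 * bord P, bord R * R0, ?_, ?_⟩
    · rw [Matrix.mul_assoc, ← Matrix.mul_assoc (bord P), bord_mul _ _ h, Matrix.one_mul, hPR]
    · intro i j hij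
      have : bord R * R0 * M * (P0 * bord P) = bord R * N * bord P := by
        simp only [hN, Matrix.mul_assoc]
      rw [this]
      revert hij
      refine Fin.cases ?_ (fun i => ?_) i
      · intro h; exact absurd h (by simp)
      refine Fin.cases ?_ (fun j => ?_) j
      · intro _
        simp [Matrix.mul_apply, Fin.sum_univ_succ, bord, hN1]
      · intro hij
        have := ht i j (by simpa using hij)
        simpa [Matrix.mul_apply, Fin.sum_univ_succ, bord, hN1] using this

/-! Injectivity of the restriction -/

lemma ev_conj {n v : ℕ} {Q : MvPolynomial (WZVars n) ℂ} (hQ : MemQ n v Q)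
    (P R Z : Matrix (Fin n) (Fin n) ℂ) (h : P * R = 1) :
    ev 1 (R * Z * P) Q = ev 1 Z Q := by
  have h' : R * P = 1 := mul_eq_one_comm.1 h
  have hd : R.det * P.det = 1 := by rw [← Matrix.det_mul, h', Matrix.det_one]
  have := mem_ev hQ R P.transpose 1 Z (IsUnit.of_mul_eq_one _ hd)
    (by rw [Matrix.det_transpose]; exact IsUnit.of_mul_eq_one _ ((mul_comm _ _).trans hd))
  rw [Matrix.det_transpose, Matrix.transpose_transpose, ← mul_pow, hd, one_pow, one_mul,
    Matrix.mul_one, h'] at this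
  exact this

lemma tri_eq {n v : ℕ} {Q : MvPolynomial (WZVars n) ℂ} (hQ : MemQ n v Q)
    (T : Matrix (Fin n) (Fin n) ℂ) (hT : ∀ i j, j < i → T i j = 0) :
    ev 1 T Q = ev 1 (Matrix.diagonal fun i => T i i) Q := by
  let G : Polynomial ℂ := MvPolynomial.aeval (Sum.elim (fun p : Fin n × Fin n =>
    Polynomial.C ((1 : Matrix (Fin n) (Fin n) ℂ) p.1 p.2))
    (fun p : Fin n × Fin n => Polynomial.C (T p.1 p.2) * Polynomial.X ^ ((p.2 : ℕ) - (p.1 : ℕ)))) Q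
  have hG : ∀ s : ℂ, G.eval s = ev 1 (Matrix.of fun i j => T i j * s ^ ((j : ℕ) - (i : ℕ))) Q := by
    intro s
    unfold ev
    simp only [G]
    clear hQ
    induction Q using MvPolynomial.induction_on with
    | C a => simp
    | add p q hp hq => simp only [map_add, Polynomial.eval_add, hp, hq]
    | mul_X p x hp =>
      rw [map_mul, map_mul, Polynomial.eval_mul, hp]
      congr 1
      rcases x with ⟨i, j⟩ | ⟨i, j⟩ <;> simp [pt]
  have hs : ∀ s : ℂ, s ≠ 0 → G.eval s = ev 1 T Q := by
    intro s hs
    rw [hG, ← ev_conj hQ (Matrix.diagonal fun i : Fin n => s ^ (i : ℕ))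
      (Matrix.diagonal fun i : Fin n => (s⁻¹) ^ (i : ℕ)) T]
    · congr 2
      ext i j
      rw [Matrix.mul_diagonal, Matrix.diagonal_mul, Matrix.of_apply]
      rcases lt_or_ge j i with h | h
      · simp [hT i j h]
      · have h2 : (j : ℕ) = (j - i : ℕ) + i := by
          have : (i : ℕ) ≤ j := h
          omega
        conv_rhs => rw [h2, pow_add]
        rw [inv_pow]
        field_simp
    · rw [Matrix.diagonal_mul_diagonal, ← Matrix.diagonal_one]
      congr 1
      funext i
      rw [inv_pow]
      field_simp
  have hc : G = Polynomial.C (ev 1 T Q) := by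
    apply Polynomial.eq_of_infinite_eval_eq
    refine Set.Infinite.mono (s := {0}ᶜ) ?_ (Set.finite_singleton (0 : ℂ)).infinite_compl
    intro s h
    simp only [Set.mem_ofPred_eq, Polynomial.eval_C]
    exact hs s h
  have h0 := hG 0
  rw [hc, Polynomial.eval_C] at h0
  rw [h0]
  congr 2
  ext i j
  rw [Matrix.of_apply, Matrix.diagonal_apply]
  rcases lt_trichotomy i j with h | h | h
  · have h3 : (j : ℕ) - i ≠ 0 := by
      have : (i : ℕ) < j := h
      omega
    rw [zero_pow h3, if_neg h.ne, mul_zero]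
  · subst h; simp
  · rw [hT i j h, zero_mul, if_neg h.ne']

lemma res_inj {n v : ℕ} {Q : MvPolynomial (WZVars n) ℂ} (hQ : MemQ n v Q) (h : res n Q = 0) :
    Q = 0 := by
  have h1 : ∀ Z, ev 1 Z Q = 0 := by
    intro Z
    obtain ⟨P, R, hPR, ht⟩ := tri n Z
    rw [← ev_conj hQ P R Z hPR, tri_eq hQ _ ht, ← eval_res, h, map_zero]
  have h2 : ∀ W Z, ev W Z (Qpoly n 0 * Q) = ev W Z 0 := by
    intro W Z
    rw [map_mul, map_zero]
    have hq : ev W Z (Qpoly n 0) = W.det := by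
      rw [ev_Qpoly, Polynomial.coeff_zero_eq_eval_zero, ← Polynomial.coe_evalRingHom,
        RingHom.map_det]
      congr 1
      ext i j
      simp
    rw [hq]
    by_cases hW : W.det = 0
    · rw [hW, zero_mul]
    · have hu : IsUnit W.det := isUnit_iff_ne_zero.2 hW
      have := mem_ev hQ W 1 1 (W⁻¹ * Z) hu (by simp)
      rw [h1, mul_zero, Matrix.transpose_one, Matrix.mul_one, Matrix.mul_one, Matrix.mul_one,
        Matrix.mul_nonsing_inv_cancel_left _ _ hu] at this
      rw [this, mul_zero]
  rcases mul_eq_zero.1 (ev_ext h2) with h3 | h3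
  · exfalso
    have h4 := res_Qpoly (n := n) 0
    rw [h3, map_zero, MvPolynomial.esymm_zero] at h4
    exact zero_ne_one h4
  · exact h3

/-! Symmetry and degree bound -/

lemma res_symm {n v : ℕ} {Q : MvPolynomial (WZVars n) ℂ} (hQ : MemQ n v Q) :
    (res n Q).IsSymmetric := by
  intro σ
  apply MvPolynomial.funext
  intro z
  rw [MvPolynomial.eval_rename, eval_res, eval_res]
  let P : Matrix (Fin n) (Fin n) ℂ := (1 : Matrix (Fin n) (Fin n) ℂ).submatrix id σ
  let R : Matrix (Fin n) (Fin n) ℂ := (1 : Matrix (Fin n) (Fin n) ℂ).submatrix σ id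
  have hPR : P * R = 1 := by
    simp only [P, R]
    rw [Matrix.submatrix_mul_equiv]
    simp
  rw [← ev_conj hQ P R (Matrix.diagonal z) hPR]
  congr 2
  ext i j
  simp [P, R, Matrix.mul_apply, Matrix.diagonal_apply, Matrix.one_apply]
  by_cases hij : i = j
  · subst hij; simp
  · simp [hij]

def rowOf {n : ℕ} : WZVars n → Fin n := Sum.elim (fun p => p.1) (fun p => p.1)

lemma coeff_scale {τ : Type} [Fintype τ] (c : τ → ℂ) (Q : MvPolynomial τ ℂ) (m : τ →₀ ℕ) :
    MvPolynomial.coeff m (MvPolynomial.aeval (fun x => MvPolynomial.C (c x) * MvPolynomial.X x) Q)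
      = MvPolynomial.coeff m Q * ∏ x, c x ^ m x := by
  classical
  induction Q using MvPolynomial.induction_on' with
  | monomial d a =>
    have : MvPolynomial.aeval (fun x => MvPolynomial.C (c x) * MvPolynomial.X x)
        (MvPolynomial.monomial d a) = MvPolynomial.monomial d (a * ∏ x, c x ^ d x) := by
      rw [MvPolynomial.aeval_monomial, Finsupp.prod_fintype _ _ (by simp),
        MvPolynomial.monomial_eq, Finsupp.prod_fintype _ _ (by simp)]
      simp only [mul_pow, Finset.prod_mul_distrib, map_mul, map_prod, map_pow,
        MvPolynomial.algebraMap_eq, mul_assoc]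
    rw [this, MvPolynomial.coeff_monomial, MvPolynomial.coeff_monomial]
    by_cases h : d = m
    · simp [h]
    · simp [h]
  | add p q hp hq => rw [map_add, MvPolynomial.coeff_add, hp, hq, MvPolynomial.coeff_add, add_mul]

lemma row_deg {n v : ℕ} {Q : MvPolynomial (WZVars n) ℂ} (hQ : MemQ n v Q) (i : Fin n)
    (m : WZVars n →₀ ℕ) (hm : m ∈ Q.support) :
    ∑ x, (if rowOf x = i then m x else 0) = v := by
  classical
  let c : Fin n → ℂ := fun k => if k = i then 2 else 1
  have hdet : (Matrix.diagonal c).det = 2 := by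
    rw [Matrix.det_diagonal]; simp [c]
  have h := hQ (Matrix.diagonal c) 1 (by rw [hdet]; simp) (by simp)
  have hs : substWZ (Matrix.diagonal c) 1 =
      MvPolynomial.aeval (fun x : WZVars n => MvPolynomial.C (c (rowOf x)) * MvPolynomial.X x) := by
    unfold substWZ
    congr 1
    funext x
    rcases x with ⟨k, l⟩ | ⟨k, l⟩ <;>
    · simp only [Sum.elim_inl, Sum.elim_inr, rowOf]
      rw [Finset.sum_eq_single k, Finset.sum_eq_single l]
      · simp
      · intro b _ hb; simp [Matrix.one_apply, hb.symm]
      · simp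
      · intro b _ hb; simp [Matrix.diagonal_apply, hb.symm]
      · simp
  rw [hs, hdet] at h
  have h2 := congrArg (MvPolynomial.coeff m) h
  rw [coeff_scale, MvPolynomial.coeff_C_mul, Matrix.det_one, one_pow, mul_one, mul_comm] at h2
  have h3 := mul_right_cancel₀ (MvPolynomial.mem_support_iff.1 hm) h2
  have h4 : ∏ x, c (rowOf x) ^ m x = (2 : ℂ) ^ ∑ x, (if rowOf x = i then m x else 0) := by
    rw [← Finset.prod_pow_eq_pow_sum]
    refine Finset.prod_congr rfl fun x _ => ?_
    by_cases hx : rowOf x = i <;> simp [c, hx]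
  rw [h4] at h3
  have h5 : (2 : ℕ) ^ (∑ x, (if rowOf x = i then m x else 0)) = 2 ^ v := by exact_mod_cast h3
  exact Nat.pow_right_injective (le_refl 2) h5

lemma res_deg {n v : ℕ} {Q : MvPolynomial (WZVars n) ℂ} (hQ : MemQ n v Q) (i : Fin n) :
    (res n Q).degreeOf i ≤ v := by
  classical
  unfold res
  rw [MvPolynomial.aeval_def, MvPolynomial.eval₂_eq']
  refine (MvPolynomial.degreeOf_sum_le _ _ _).trans (Finset.sup_le fun m hm => ?_)
  rw [MvPolynomial.algebraMap_eq]
  refine (MvPolynomial.degreeOf_C_mul_le _ _ _).trans ?_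
  refine (MvPolynomial.degreeOf_prod_le _ _ _).trans ?_
  rw [← row_deg hQ i m hm]
  refine Finset.sum_le_sum fun x _ => ?_
  refine (MvPolynomial.degreeOf_pow_le _ _ _).trans ?_
  have : (resVar n x).degreeOf i ≤ if rowOf x = i then 1 else 0 := by
    rcases x with ⟨k, l⟩ | ⟨k, l⟩
    · by_cases h : k = l <;> simp [resVar, h]
    · by_cases h : k = l
      · simp [resVar, h, rowOf, MvPolynomial.degreeOf_X, eq_comm]
      · simp [resVar, h]
  refine (Nat.mul_le_mul_left _ this).trans ?_
  split_ifs <;> simp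

/-! Dimension bound -/

def expo {n v : ℕ} (s : Sym (Fin (v + 1)) n) : Fin n →₀ ℕ :=
  Finsupp.equivFunOnFinite.symm fun i =>
    ((s : Multiset (Fin (v + 1))).toList.get (i.cast (by
      rw [Multiset.length_toList]; exact s.2.symm)) : ℕ)

lemma expo_spec {n v : ℕ} (d : Fin n →₀ ℕ) (hd : ∀ i, d i ≤ v) :
    ∃ (s : Sym (Fin (v + 1)) n) (σ : Equiv.Perm (Fin n)), d = (expo s).mapDomain σ := by
  let f : Fin n → Fin (v + 1) := fun i => ⟨d i, Nat.lt_succ_of_le (hd i)⟩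
  let s : Sym (Fin (v + 1)) n := ⟨(List.ofFn f : Multiset (Fin (v + 1))), by simp⟩
  have hl : (s : Multiset (Fin (v + 1))).toList.length = n := by
    rw [Multiset.length_toList]; exact s.2
  let g : Fin n → Fin (v + 1) := fun i =>
    (s : Multiset (Fin (v + 1))).toList.get (i.cast hl.symm)
  have hp : (List.ofFn g).Perm (List.ofFn f) := by
    rw [← Multiset.coe_eq_coe]
    have : List.ofFn g = (s : Multiset (Fin (v + 1))).toList := by
      apply List.ext_get
      · simp [hl]
      · intro k h1 h2
        simp [g]
    rw [this, Multiset.coe_toList]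
    rfl
  have hq : List.ofFn (g ∘ Tuple.sort g) = List.ofFn (f ∘ Tuple.sort f) := by
    refine List.Perm.eq_of_sortedLE ?_ ?_
      (((Equiv.Perm.ofFn_comp_perm _ _).trans hp).trans (Equiv.Perm.ofFn_comp_perm _ _).symm)
    · exact (Tuple.monotone_sort g).sortedLE_ofFn
    · exact (Tuple.monotone_sort f).sortedLE_ofFn
  have hfg := List.ofFn_injective hq
  refine ⟨s, ((Tuple.sort f).symm.trans (Tuple.sort g)).symm, ?_⟩
  ext i
  rw [Finsupp.mapDomain_equiv_apply]
  have h1 := congrFun hfg ((Tuple.sort f).symm i)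
  simp only [Function.comp, Equiv.apply_symm_apply] at h1
  have h2 := congrArg Fin.val h1
  exact h2.symm

lemma upper (n v : ℕ) : Module.Finite ℂ (QSub n v) ∧
    Module.finrank ℂ (QSub n v) ≤ Fintype.card (Sym (Fin (v + 1)) n) := by
  let F : QSub n v →ₗ[ℂ] (Sym (Fin (v + 1)) n → ℂ) :=
    LinearMap.pi fun s => (MvPolynomial.lcoeff ℂ (expo s)) ∘ₗ (res n).toLinearMap ∘ₗ
      (QSub n v).subtype
  have hF : Function.Injective F := by
    rw [← LinearMap.ker_eq_bot, LinearMap.ker_eq_bot']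
    rintro ⟨Q, hQ⟩ h
    apply Subtype.ext
    refine res_inj (v := v) hQ ?_
    have hc : ∀ s, MvPolynomial.coeff (expo s) (res n Q) = 0 := fun s => congrFun h s
    ext d
    rw [MvPolynomial.coeff_zero]
    by_contra hne
    have hd : ∀ i, d i ≤ v := fun i =>
      (MvPolynomial.monomial_le_degreeOf i (MvPolynomial.mem_support_iff.2 hne)).trans
        (res_deg hQ i)
    obtain ⟨s, σ, rfl⟩ := expo_spec d hd
    apply hne
    rw [← res_symm hQ σ, MvPolynomial.coeff_rename_mapDomain _ σ.injective]
    exact hc s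
  refine ⟨Module.Finite.of_injective F hF, ?_⟩
  have := LinearMap.finrank_le_finrank_of_injective hF
  simpa using this

/-- For every `n ≥ 1` and `v ≥ 0`, the dimension of `Q_{n,v}(2)` over ℂ is `(n+v choose v)`. -/
theorem stmt5 (n v : ℕ) (hn : 1 ≤ n) :
    Module.finrank ℂ (QSub n v) = (n + v).choose v := by
  obtain ⟨hfin, hle⟩ := upper n v
  have hge := (lower_li n v).fintype_card_le_finrank
  rw [Sym.card_sym_eq_choose, Fintype.card_fin] at hle hge
  have h1 : v + 1 + n - 1 = n + v := by omega
  have h2 : n + 1 + v - 1 = n + v := by omega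
  rw [h1, Nat.choose_symm_add] at hle
  rw [h2] at hge
  exact le_antisymm hle hge
end
end

section
/- For every integer n ≥ 1, the graded ring Q_n(2) = ⊕_{v≥0} Q_{n,v}(2) equals the polynomial algebra ℂ[Q₀,…,Q_n] generated by Q₀,…,Q_n, and for each v ≥ 0 the space Q_{n,v}(2) equals the span of the degree-v monomials in Q₀,…,Q_n; these C(n+v, v) monomials form a ℂ-basis of Q_{n,v}(2). -/
noncomputable section

theorem eval_aeval' {σ τ : Type} (p : τ → ℂ) (g : σ → MvPolynomial τ ℂ)
    (f : MvPolynomial σ ℂ) :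
    MvPolynomial.eval p (MvPolynomial.aeval g f) =
      MvPolynomial.eval (fun i => MvPolynomial.eval p (g i)) f := by
  induction f using MvPolynomial.induction_on with
  | C a => simp
  | add f g hf hg => rw [map_add, map_add, hf, hg, map_add]
  | mul_X f i hf => rw [map_mul, map_mul, hf, map_mul, MvPolynomial.aeval_X, MvPolynomial.eval_X]

/-- the point with coordinates the entries of `W`, `Z` -/
def ptWZ {R : Type} {n : ℕ} (W Z : Matrix (Fin n) (Fin n) R) : WZVars n → R :=
  Sum.elim (fun p => W p.1 p.2) (fun p => Z p.1 p.2)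

theorem aeval_Qpoly {R : Type} [CommRing R] [Algebra ℂ R] {n : ℕ}
    (W Z : Matrix (Fin n) (Fin n) R) (a : ℕ) :
    MvPolynomial.aeval (ptWZ W Z) (Qpoly n a) =
      (Matrix.det (Matrix.of fun s t : Fin n =>
        Polynomial.C (W s t) + Polynomial.X * Polynomial.C (Z s t))).coeff a := by
  unfold Qpoly
  have h := Polynomial.coeff_map (MvPolynomial.aeval (R := ℂ) (ptWZ W Z)).toRingHom
    (p := (Matrix.det (Matrix.of fun s t : Fin n =>
      Polynomial.C (MvPolynomial.X (Sum.inl (s, t))) +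
        Polynomial.X * Polynomial.C (MvPolynomial.X (Sum.inr (s, t)))))) a
  refine Eq.trans h.symm ?_
  congr 1
  rw [← Polynomial.coe_mapRingHom, RingHom.map_det]
  congr 1
  ext1 s t
  simp [ptWZ]

theorem substWZ_eq {n : ℕ} (A B : Matrix (Fin n) (Fin n) ℂ) :
    substWZ A B = MvPolynomial.aeval (ptWZ
      (A.map MvPolynomial.C * (Matrix.of fun s t => MvPolynomial.X (Sum.inl (s, t))) *
        (B.map MvPolynomial.C).transpose)
      (A.map MvPolynomial.C * (Matrix.of fun s t => MvPolynomial.X (Sum.inr (s, t))) *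
        (B.map MvPolynomial.C).transpose)) := by
  unfold substWZ
  congr 1
  ext1 i
  rcases i with ⟨s, t⟩ | ⟨s, t⟩ <;>
  · simp only [ptWZ, Sum.elim_inl, Sum.elim_inr, Matrix.mul_apply, Matrix.map_apply,
      Matrix.transpose_apply, Matrix.of_apply, map_mul, Finset.sum_mul]
    rw [Finset.sum_comm]
    refine Finset.sum_congr rfl fun p _ => Finset.sum_congr rfl fun q _ => ?_
    ring

theorem pencil_det {R : Type} [CommRing R] {n : ℕ}
    (A B W Z : Matrix (Fin n) (Fin n) R) :
    (Matrix.det (Matrix.of fun s t : Fin n =>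
        Polynomial.C ((A * W * B.transpose) s t) +
          Polynomial.X * Polynomial.C ((A * Z * B.transpose) s t))) =
     Polynomial.C (A.det * B.det) * (Matrix.det (Matrix.of fun s t : Fin n =>
        Polynomial.C (W s t) + Polynomial.X * Polynomial.C (Z s t))) := by
  have key : ∀ W Z : Matrix (Fin n) (Fin n) R, (Matrix.of fun s t : Fin n =>
        Polynomial.C (W s t) + Polynomial.X * Polynomial.C (Z s t)) =
      (Polynomial.C : R →+* _).mapMatrix W +
        (Polynomial.X : Polynomial R) • (Polynomial.C : R →+* _).mapMatrix Z := by
    intro W Z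
    ext1 s t
    simp
  rw [key, key]
  have hB : (Polynomial.C : R →+* Polynomial R).mapMatrix B.transpose =
    ((Polynomial.C : R →+* Polynomial R).mapMatrix B).transpose := by
    ext1 s t; simp
  have : (Polynomial.C : R →+* _).mapMatrix (A * W * B.transpose) +
        (Polynomial.X : Polynomial R) • (Polynomial.C : R →+* _).mapMatrix (A * Z * B.transpose)
      = (Polynomial.C : R →+* _).mapMatrix A * ((Polynomial.C : R →+* _).mapMatrix W +
        (Polynomial.X : Polynomial R) • (Polynomial.C : R →+* _).mapMatrix Z) *
        ((Polynomial.C : R →+* Polynomial R).mapMatrix B).transpose := by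
    rw [map_mul, map_mul, map_mul, map_mul, hB, mul_add, add_mul, Matrix.mul_smul,
      Matrix.smul_mul]
  rw [this, Matrix.det_mul, Matrix.det_mul, Matrix.det_transpose, ← RingHom.map_det,
    ← RingHom.map_det, map_mul]
  ring

theorem substWZ_Qpoly {n : ℕ} (A B : Matrix (Fin n) (Fin n) ℂ) (a : ℕ) :
    substWZ A B (Qpoly n a) = MvPolynomial.C (A.det * B.det) * Qpoly n a := by
  have hd : ∀ A : Matrix (Fin n) (Fin n) ℂ,
      (A.map (MvPolynomial.C (σ := WZVars n))).det = MvPolynomial.C A.det := by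
    intro A
    rw [RingHom.map_det]; rfl
  rw [substWZ_eq, aeval_Qpoly, pencil_det, Polynomial.coeff_C_mul, hd, hd, ← map_mul]
  rfl

theorem monoQ_mem {n : ℕ} (α : Fin (n + 1) → ℕ) :
    ∏ j : Fin (n + 1), Qpoly n (j : ℕ) ^ α j ∈ QSub n (∑ j, α j) := by
  intro A B _ _
  rw [map_prod]
  simp_rw [map_pow, substWZ_Qpoly, mul_pow]
  rw [Finset.prod_mul_distrib, Finset.prod_pow_eq_pow_sum, ← map_pow, mul_pow]

theorem eval_inv {n v : ℕ} {Q : MvPolynomial (WZVars n) ℂ} (hQ : Q ∈ QSub n v)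
    (A B W Z : Matrix (Fin n) (Fin n) ℂ) (hA : A.det ≠ 0) (hB : B.det ≠ 0) :
    MvPolynomial.eval (ptWZ (A * W * B.transpose) (A * Z * B.transpose)) Q =
      (A.det * B.det) ^ v * MvPolynomial.eval (ptWZ W Z) Q := by
  have h := congrArg (MvPolynomial.eval (ptWZ W Z)) (hQ A B hA.isUnit hB.isUnit)
  rw [map_mul, MvPolynomial.eval_C, ← mul_pow] at h
  rw [← h]
  unfold substWZ
  rw [eval_aeval']
  congr 2
  ext1 i
  rcases i with ⟨s, t⟩ | ⟨s, t⟩ <;>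
  · simp only [ptWZ, Sum.elim_inl, Sum.elim_inr, Matrix.mul_apply,
      Matrix.transpose_apply, map_mul, map_sum, Finset.sum_mul, MvPolynomial.eval_X,
      MvPolynomial.eval_C]
    rw [Finset.sum_comm]
    refine Finset.sum_congr rfl fun p _ => Finset.sum_congr rfl fun q _ => ?_
    ring

/-- companion pencil, first part -/
def Wc {R : Type} [CommRing R] {m : ℕ} (c : Fin (m + 2) → R) :
    Matrix (Fin (m + 1)) (Fin (m + 1)) R :=
  Matrix.diagonal fun i => if i = Fin.last m then c 0 else 1

/-- companion pencil, second part -/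
def Zc {R : Type} [CommRing R] {m : ℕ} (c : Fin (m + 2) → R) :
    Matrix (Fin (m + 1)) (Fin (m + 1)) R :=
  Matrix.of fun i j => Fin.lastCases ((-1) ^ (i.rev : ℕ) * c i.rev.succ)
    (fun j' : Fin m => if i = j'.succ then 1 else 0) j

theorem det_pencil {R : Type} [CommRing R] {m : ℕ} (c : Fin (m + 2) → R) (x : R) :
    (Wc c + x • Zc c).det = ∑ a : Fin (m + 2), c a * x ^ (a : ℕ) := by
  have h := Matrix.det_updateRow_sum (Wc c + x • Zc c) (Fin.last m)
    (fun i => (-x) ^ (i.rev : ℕ))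
  simp only [Fin.rev_last, Fin.val_zero, pow_zero, one_smul] at h
  rw [← h]
  have hrow : (∑ k : Fin (m + 1), (-x) ^ (k.rev : ℕ) • (Wc c + x • Zc c) k) =
      Pi.single (Fin.last m) (∑ a : Fin (m + 2), c a * x ^ (a : ℕ)) := by
    ext j
    rw [Finset.sum_apply]
    induction j using Fin.lastCases with
    | last =>
      rw [Pi.single_eq_same, Fin.sum_univ_succ (n := m + 1)]
      simp only [Pi.smul_apply, Matrix.add_apply, Matrix.smul_apply, Wc, Zc,
        Matrix.diagonal_apply, Matrix.of_apply, Fin.lastCases_last, smul_eq_mul, mul_add,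
        Finset.sum_add_distrib]
      congr 1
      · rw [Finset.sum_eq_single (Fin.last m)] <;> simp +contextual
      · rw [← Equiv.sum_comp Fin.revPerm]
        refine Finset.sum_congr rfl fun k _ => ?_
        simp only [Fin.revPerm_apply, Fin.rev_rev, Fin.val_succ]
        rw [neg_pow x]
        have : ((-1 : R) ^ (k : ℕ)) * (-1) ^ (k : ℕ) = 1 := by
          rw [← mul_pow]; simp
        linear_combination (x ^ ((k : ℕ) + 1) * c k.succ) * this
    | cast j =>
      rw [Pi.single_eq_of_ne (Fin.castSucc_lt_last j).ne]
      simp only [Pi.smul_apply, Matrix.add_apply, Matrix.smul_apply, Wc, Zc,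
        Matrix.diagonal_apply, Matrix.of_apply, Fin.lastCases_castSucc, smul_eq_mul, mul_add,
        Finset.sum_add_distrib]
      rw [Finset.sum_eq_single j.castSucc, Finset.sum_eq_single j.succ]
      · simp [Fin.rev_castSucc, Fin.rev_succ, pow_succ, (Fin.castSucc_lt_last j).ne]
      · simp +contextual
      · simp
      · simp +contextual
      · simp
  rw [hrow, Matrix.det_succ_row _ (Fin.last m), Finset.sum_eq_single (Fin.last m)]
  · simp only [Matrix.updateRow_self, Pi.single_eq_same]
    have : (((Wc c + x • Zc c).updateRow (Fin.last m)
      (Pi.single (Fin.last m) (∑ a : Fin (m + 2), c a * x ^ (a : ℕ)))).submatrix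
        (Fin.last m).succAbove (Fin.last m).succAbove).det = 1 := by
      rw [Matrix.det_of_isLowerTriangular]
      · refine Finset.prod_eq_one fun i _ => ?_
        have : i.castSucc ≠ i.succ := Fin.castSucc_lt_succ.ne
        simp [Wc, Zc, Matrix.updateRow_apply, (Fin.castSucc_lt_last i).ne, this]
      · intro i j hij
        have hij : i < j := hij
        have h1 : i.castSucc ≠ j.succ := by
          intro h; have := congrArg Fin.val h; simp at this; omega
        simp [Wc, Zc, Matrix.updateRow_apply, (Fin.castSucc_lt_last i).ne, h1,
          Matrix.diagonal_apply, hij.ne]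
    rw [this, ← two_mul, pow_mul]
    simp
  · intro j _ hj
    simp [hj]
  · simp

theorem aeval_comp_Qpoly {R : Type} [CommRing R] [Algebra ℂ R] {m : ℕ} (c : Fin (m + 2) → R)
    (a : Fin (m + 2)) :
    MvPolynomial.aeval (ptWZ (Wc c) (Zc c)) (Qpoly (m + 1) a) = c a := by
  rw [aeval_Qpoly]
  have : (Matrix.of fun s t : Fin (m + 1) =>
        Polynomial.C (Wc c s t) + Polynomial.X * Polynomial.C (Zc c s t)) =
      Wc (fun i => Polynomial.C (c i)) +
        (Polynomial.X : Polynomial R) • Zc (fun i => Polynomial.C (c i)) := by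
    ext1 i j
    simp only [Matrix.of_apply, Matrix.add_apply, Matrix.smul_apply, smul_eq_mul, Wc, Zc,
      Matrix.diagonal_apply]
    congr 1
    · split_ifs <;> simp
    · congr 1
      induction j using Fin.lastCases with
      | last => simp
      | cast j => simp
  rw [this, det_pencil]
  simp only [Polynomial.finset_sum_coeff, Polynomial.coeff_C_mul, Polynomial.coeff_X_pow]
  rw [Finset.sum_eq_single a]
  · simp
  · intro b _ hb
    have : (a : ℕ) ≠ b := fun h => hb (Fin.ext h.symm)
    simp [this]
  · simp

/-- restriction to the companion pencil -/
def psi (m : ℕ) : MvPolynomial (WZVars (m + 1)) ℂ →ₐ[ℂ] MvPolynomial (Fin (m + 2)) ℂ :=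
  MvPolynomial.aeval (ptWZ (Wc MvPolynomial.X) (Zc MvPolynomial.X))

theorem psi_Qpoly (m : ℕ) (a : Fin (m + 2)) :
    psi m (Qpoly (m + 1) a) = MvPolynomial.X a := aeval_comp_Qpoly _ a

theorem eval_psi {m : ℕ} (c : Fin (m + 2) → ℂ) (Q : MvPolynomial (WZVars (m + 1)) ℂ) :
    MvPolynomial.eval c (psi m Q) = MvPolynomial.eval (ptWZ (Wc c) (Zc c)) Q := by
  unfold psi
  rw [eval_aeval']
  congr 2
  ext1 i
  rcases i with ⟨s, t⟩ | ⟨s, t⟩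
  · simp only [ptWZ, Sum.elim_inl, Wc, Matrix.diagonal_apply]
    split_ifs <;> simp
  · simp only [ptWZ, Sum.elim_inr, Zc, Matrix.of_apply]
    induction t using Fin.lastCases with
    | last => simp
    | cast j => simp

theorem psi_scale {m v : ℕ} {Q : MvPolynomial (WZVars (m + 1)) ℂ} (hQ : Q ∈ QSub (m + 1) v)
    (c : Fin (m + 2) → ℂ) (t : ℂ) (ht : t ≠ 0) :
    MvPolynomial.eval (fun a => t * c a) (psi m Q) = t ^ v * MvPolynomial.eval c (psi m Q) := by
  rw [eval_psi, eval_psi]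
  have hdet : (Matrix.diagonal fun i => if i = Fin.last m then t else 1).det = t := by
    rw [Matrix.det_diagonal]; simp
  have h := eval_inv hQ 1 (Matrix.diagonal fun i => if i = Fin.last m then t else 1)
    (Wc c) (Zc c) (by simp) (by rw [hdet]; exact ht)
  rw [hdet, Matrix.det_one, one_mul t] at h
  rw [← h]
  congr 2
  rw [Matrix.diagonal_transpose, one_mul, one_mul]
  congr 1
  · ext i j
    simp only [Wc, Matrix.diagonal_mul_diagonal, Matrix.diagonal_apply]
    split_ifs <;> ring
  · ext i j
    rw [Matrix.mul_diagonal]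
    induction j using Fin.lastCases with
    | last => simp [Zc]; ring
    | cast j => simp [Zc, (Fin.castSucc_lt_last j).ne]

theorem psi_homog {m v : ℕ} {Q : MvPolynomial (WZVars (m + 1)) ℂ} (hQ : Q ∈ QSub (m + 1) v) :
    (psi m Q).IsHomogeneous v := by
  set f := psi m Q with hf
  have h1 : MvPolynomial.aeval (fun a => MvPolynomial.C (2 : ℂ) * MvPolynomial.X a) f
      = MvPolynomial.C ((2 : ℂ) ^ v) * f := by
    apply MvPolynomial.funext
    intro c
    rw [map_mul, MvPolynomial.eval_C, ← psi_scale hQ c 2 two_ne_zero, ← hf, eval_aeval']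
    congr 2
    ext1 i
    simp
  have h2 : ∀ (g : MvPolynomial (Fin (m + 2)) ℂ) (d : Fin (m + 2) →₀ ℕ),
      (MvPolynomial.aeval (fun a => MvPolynomial.C (2 : ℂ) * MvPolynomial.X a) g).coeff d
      = 2 ^ d.degree * g.coeff d := by
    intro g d
    induction g using MvPolynomial.induction_on' with
    | monomial u a =>
      have : MvPolynomial.aeval (fun a => MvPolynomial.C (2 : ℂ) * MvPolynomial.X a)
          (MvPolynomial.monomial u a) = MvPolynomial.monomial u (2 ^ u.degree * a) := by
        rw [MvPolynomial.aeval_monomial, MvPolynomial.monomial_eq]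
        simp only [mul_pow, Finsupp.prod_mul, Finsupp.prod, Finset.prod_mul_distrib]
        rw [Finset.prod_pow_eq_pow_sum, map_mul, map_pow]
        rw [MvPolynomial.algebraMap_eq, Finsupp.degree]
        ring_nf
        rfl
      rw [this, MvPolynomial.coeff_monomial, MvPolynomial.coeff_monomial]
      split_ifs with h
      · rw [h]
      · simp
    | add p q hp hq => rw [map_add, MvPolynomial.coeff_add, hp, hq, MvPolynomial.coeff_add, mul_add]
  intro d hd
  have h3 := h2 f d
  rw [h1, MvPolynomial.coeff_C_mul] at h3
  have h4 := mul_right_cancel₀ hd h3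
  have h5 : (2 : ℕ) ^ v = 2 ^ d.degree := by exact_mod_cast h4
  have h6 := Nat.pow_right_injective (le_refl 2) h5
  rw [h6, Finsupp.degree_eq_weight_one]; rfl

/-- Krylov matrix -/
def Kry {R : Type} [CommRing R] {m : ℕ} (M : Matrix (Fin (m + 1)) (Fin (m + 1)) R) :
    Matrix (Fin (m + 1)) (Fin (m + 1)) R := Matrix.of fun i j => (M ^ (j : ℕ)) i 0

theorem eval_eq {m v : ℕ} {Q : MvPolynomial (WZVars (m + 1)) ℂ} (hQ : Q ∈ QSub (m + 1) v)
    (W M : Matrix (Fin (m + 1)) (Fin (m + 1)) ℂ) (hW : W.det ≠ 0) (hK : (Kry M).det ≠ 0) :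
    MvPolynomial.eval (ptWZ W (W * M)) Q =
      MvPolynomial.eval (fun a : Fin (m + 2) =>
        MvPolynomial.eval (ptWZ W (W * M)) (Qpoly (m + 1) a)) (psi m Q) := by
  set K := Kry M with hKdef
  set w : Fin (m + 1) → ℂ := (K⁻¹).mulVec (fun i => (M ^ (m + 1)) i 0) with hw
  set c : Fin (m + 2) → ℂ := Fin.cons 1 (fun k => (-1) ^ (k : ℕ) * w k.rev) with hc
  have hWc : Wc c = 1 := by
    simp [Wc, hc]
  have hKK : K * K⁻¹ = 1 := Matrix.mul_nonsing_inv K hK.isUnit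
  have hKZ : K * Zc c = M * K := by
    ext i j
    induction j using Fin.lastCases with
    | last =>
      have h1 : (K * Zc c) i (Fin.last m) = K.mulVec w i := by
        simp only [Matrix.mul_apply, Matrix.mulVec, dotProduct]
        refine Finset.sum_congr rfl fun k _ => ?_
        simp only [Zc, hc, Matrix.of_apply, Fin.lastCases_last, Fin.cons_succ, Fin.rev_rev]
        have : ((-1 : ℂ) ^ (k.rev : ℕ)) * (-1) ^ (k.rev : ℕ) = 1 := by
          rw [← mul_pow]; simp
        linear_combination (K i k * w k) * this
      rw [h1, hw, Matrix.mulVec_mulVec, hKK, Matrix.one_mulVec, pow_succ']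
      simp [Matrix.mul_apply, hKdef, Kry]
    | cast j =>
      have h1 : (K * Zc c) i j.castSucc = K i j.succ := by
        simp [Matrix.mul_apply, Zc]
      rw [h1]
      simp [Matrix.mul_apply, hKdef, Kry, pow_succ']
  have hWeq : W = (W * K) * Wc c * ((K⁻¹).transpose).transpose := by
    rw [hWc, Matrix.transpose_transpose, mul_one, mul_assoc, hKK, mul_one]
  have hZeq : W * M = (W * K) * Zc c * ((K⁻¹).transpose).transpose := by
    rw [Matrix.transpose_transpose, mul_assoc W, hKZ, mul_assoc, mul_assoc, hKK, mul_one]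
  have hA : (W * K).det ≠ 0 := by rw [Matrix.det_mul]; exact mul_ne_zero hW hK
  have hB : (K⁻¹).transpose.det ≠ 0 := by
    rw [Matrix.det_transpose]
    intro h
    have := congrArg Matrix.det hKK
    rw [Matrix.det_mul, h] at this
    simp at this
  have hQa : ∀ a : Fin (m + 2), Qpoly (m + 1) a ∈ QSub (m + 1) 1 := by
    intro a A B _ _
    rw [substWZ_Qpoly, pow_one, pow_one]
  have h1 : ∀ a : Fin (m + 2), MvPolynomial.eval (ptWZ W (W * M)) (Qpoly (m + 1) a) =
      ((W * K).det * (K⁻¹).transpose.det) * c a := by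
    intro a
    have := eval_inv (hQa a) (W * K) (K⁻¹).transpose (Wc c) (Zc c) hA hB
    rw [← hWeq, ← hZeq, pow_one] at this
    rw [this, ← aeval_comp_Qpoly c a, MvPolynomial.aeval_eq_eval]
  simp_rw [h1]
  rw [psi_scale hQ _ _ (mul_ne_zero hA hB), eval_psi]
  have := eval_inv hQ (W * K) (K⁻¹).transpose (Wc c) (Zc c) hA hB
  rw [← hWeq, ← hZeq] at this
  exact this

theorem Kry_map {R S : Type} [CommRing R] [CommRing S] (f : R →+* S) {m : ℕ}
    (M : Matrix (Fin (m + 1)) (Fin (m + 1)) R) :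
    f (Kry M).det = (Kry (f.mapMatrix M)).det := by
  rw [RingHom.map_det]
  congr 1
  ext i j
  simp only [Kry, RingHom.mapMatrix_apply, Matrix.map_apply, Matrix.of_apply]
  have h := map_pow f.mapMatrix M (j : ℕ)
  simp only [RingHom.mapMatrix_apply] at h
  rw [← h, Matrix.map_apply]

theorem Kry_smul {R : Type} [CommRing R] {m : ℕ} (d : R)
    (M : Matrix (Fin (m + 1)) (Fin (m + 1)) R) :
    (Kry (d • M)).det = (∏ j : Fin (m + 1), d ^ (j : ℕ)) * (Kry M).det := by
  rw [← Matrix.det_mul_row]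
  congr 1
  ext i j
  simp only [Kry, smul_pow, Matrix.of_apply, Matrix.smul_apply, smul_eq_mul]

/-- shift -/
def shiftMat (m : ℕ) : Matrix (Fin (m + 1)) (Fin (m + 1)) ℂ :=
  Matrix.of fun i j => if (i : ℕ) = j + 1 then 1 else 0

theorem Kry_shift (m : ℕ) : Kry (shiftMat m) = 1 := by
  have : ∀ (k : ℕ) (hk : k < m + 1) (i : Fin (m + 1)),
      ((shiftMat m) ^ k) i 0 = if (i : ℕ) = k then 1 else 0 := by
    intro k
    induction k with
    | zero =>
      intro _ i
      rw [pow_zero, Matrix.one_apply]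
      exact if_congr Fin.ext_iff rfl rfl
    | succ k ih =>
      intro hk i
      rw [pow_succ', Matrix.mul_apply]
      simp_rw [ih (by omega)]
      rw [Finset.sum_eq_single ⟨k, by omega⟩]
      · simp [shiftMat]
      · intro b _ hb
        have : (b : ℕ) ≠ k := fun h => hb (Fin.ext h)
        simp [this]
      · simp
  ext i j
  simp only [Kry, Matrix.of_apply]
  rw [this j j.2, Matrix.one_apply]
  simp [Fin.ext_iff]

theorem main_eq {m v : ℕ} {Q : MvPolynomial (WZVars (m + 1)) ℂ} (hQ : Q ∈ QSub (m + 1) v) :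
    Q = MvPolynomial.aeval (fun a : Fin (m + 2) => Qpoly (m + 1) a) (psi m Q) := by
  let Wg : Matrix (Fin (m + 1)) (Fin (m + 1)) (MvPolynomial (WZVars (m + 1)) ℂ) :=
    Matrix.of fun s t => MvPolynomial.X (Sum.inl (s, t))
  let Zg : Matrix (Fin (m + 1)) (Fin (m + 1)) (MvPolynomial (WZVars (m + 1)) ℂ) :=
    Matrix.of fun s t => MvPolynomial.X (Sum.inr (s, t))
  let D := Wg.det * (Kry (Wg.adjugate * Zg)).det
  have hWg : ∀ p, (MvPolynomial.eval p).mapMatrix Wg = Matrix.of fun s t => p (Sum.inl (s, t)) := by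
    intro p; ext s t; simp [Wg]
  have hZg : ∀ p, (MvPolynomial.eval p).mapMatrix Zg = Matrix.of fun s t => p (Sum.inr (s, t)) := by
    intro p; ext s t; simp [Zg]
  have hD : ∀ p, MvPolynomial.eval p D = (Matrix.of fun s t => p (Sum.inl (s, t))).det *
      (Kry ((Matrix.of fun s t => p (Sum.inl (s, t))).adjugate *
        (Matrix.of fun s t => p (Sum.inr (s, t))))).det := by
    intro p
    simp only [D]
    rw [map_mul, RingHom.map_det, Kry_map, map_mul, RingHom.map_adjugate, hWg, hZg]
  have hD0 : D ≠ 0 := by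
    intro h
    have h1 := hD (ptWZ 1 (shiftMat m))
    have e1 : (Matrix.of fun s t => ptWZ (1 : Matrix (Fin (m + 1)) (Fin (m + 1)) ℂ)
      (shiftMat m) (Sum.inl (s, t))) = 1 := rfl
    have e2 : (Matrix.of fun s t => ptWZ (1 : Matrix (Fin (m + 1)) (Fin (m + 1)) ℂ)
      (shiftMat m) (Sum.inr (s, t))) = shiftMat m := rfl
    rw [h, e1, e2, Matrix.adjugate_one, one_mul, Kry_shift] at h1
    simp at h1
  apply mul_left_cancel₀ hD0
  apply MvPolynomial.funext
  intro p
  rw [map_mul _ D, map_mul _ D]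
  by_cases hp : MvPolynomial.eval p D = 0
  · rw [hp, zero_mul, zero_mul]
  congr 1
  rw [hD] at hp
  set W : Matrix (Fin (m + 1)) (Fin (m + 1)) ℂ := Matrix.of fun s t => p (Sum.inl (s, t)) with hW
  set Z : Matrix (Fin (m + 1)) (Fin (m + 1)) ℂ := Matrix.of fun s t => p (Sum.inr (s, t)) with hZ
  have hWd : W.det ≠ 0 := left_ne_zero_of_mul hp
  have hKd := right_ne_zero_of_mul hp
  have hadj : W.adjugate * Z = W.det • (W⁻¹ * Z) := by
    rw [Matrix.inv_def, Ring.inverse_eq_inv', Matrix.smul_mul, smul_smul, mul_inv_cancel₀ hWd,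
      one_smul]
  rw [hadj, Kry_smul] at hKd
  have hWZ : W * (W⁻¹ * Z) = Z := by
    rw [← mul_assoc, Matrix.mul_nonsing_inv W hWd.isUnit, one_mul]
  have key := eval_eq hQ W (W⁻¹ * Z) hWd (right_ne_zero_of_mul hKd)
  rw [hWZ] at key
  have hpt : ptWZ W Z = p := by
    ext i
    rcases i with ⟨s, t⟩ | ⟨s, t⟩ <;> rfl
  rw [hpt] at key
  rw [eval_aeval']
  exact key

theorem aeval_Q_sum (m : ℕ) (f : MvPolynomial (Fin (m + 2)) ℂ) :
    MvPolynomial.aeval (fun a : Fin (m + 2) => Qpoly (m + 1) a) f =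
      ∑ d ∈ f.support, f.coeff d • ∏ j : Fin (m + 2), Qpoly (m + 1) (j : ℕ) ^ d j := by
  rw [MvPolynomial.aeval_def, MvPolynomial.eval₂_eq']
  simp only [Algebra.smul_def]


/-- For every `n ≥ 1`: the graded ring `Q_n(2) = ⊕_{v ≥ 0} Q_{n,v}(2)` equals the polynomial
algebra `ℂ[Q₀, …, Q_n]`; for each `v ≥ 0` the space `Q_{n,v}(2)` is the span of the degree-`v`
monomials in `Q₀, …, Q_n`; and these monomials are linearly independent, hence form a
ℂ-basis of `Q_{n,v}(2)`. -/
theorem stmt6 (n : ℕ) (hn : 1 ≤ n) :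
    (⨆ v : ℕ, QSub n v) =
        Subalgebra.toSubmodule
          (Algebra.adjoin ℂ (Set.range fun a : Fin (n + 1) => Qpoly n (a : ℕ))) ∧
      (∀ v : ℕ,
        QSub n v =
          Submodule.span ℂ
            {R | ∃ α : Fin (n + 1) → ℕ,
              (∑ j, α j = v) ∧ R = ∏ j : Fin (n + 1), Qpoly n (j : ℕ) ^ α j}) ∧
      (∀ v : ℕ,
        LinearIndependent ℂ
          (fun α : {α : Fin (n + 1) → ℕ // ∑ j, α j = v} =>
            ∏ j : Fin (n + 1), Qpoly n (j : ℕ) ^ α.1 j)) := by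
  obtain ⟨m, rfl⟩ : ∃ m, n = m + 1 := ⟨n - 1, by omega⟩
  have hspan : ∀ v : ℕ,
        QSub (m + 1) v =
          Submodule.span ℂ
            {R | ∃ α : Fin (m + 1 + 1) → ℕ,
              (∑ j, α j = v) ∧ R = ∏ j : Fin (m + 1 + 1), Qpoly (m + 1) (j : ℕ) ^ α j} := by
    intro v
    apply le_antisymm
    · intro Q hQ
      rw [main_eq hQ, aeval_Q_sum]
      refine Submodule.sum_mem _ fun d hd => Submodule.smul_mem _ _ (Submodule.subset_span ?_)
      refine ⟨d, ?_, rfl⟩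
      have := psi_homog hQ (MvPolynomial.mem_support_iff.1 hd)
      rw [← Finsupp.degree_eq_sum, ← this, Finsupp.degree_eq_weight_one]
      rfl
    · rw [Submodule.span_le]
      rintro R ⟨α, rfl, rfl⟩
      exact monoQ_mem α
  refine ⟨?_, hspan, ?_⟩
  · apply le_antisymm
    · refine iSup_le fun v => ?_
      rw [hspan v, Submodule.span_le]
      rintro R ⟨α, -, rfl⟩
      exact Subalgebra.prod_mem _ fun j _ => Subalgebra.pow_mem _
        (Algebra.subset_adjoin (Set.mem_range_self j)) _
    · intro Q hQ
      rw [Subalgebra.mem_toSubmodule, Algebra.adjoin_range_eq_range_aeval] at hQ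
      obtain ⟨f, rfl⟩ := hQ
      have := aeval_Q_sum m f
      refine this ▸ ?_
      refine Submodule.sum_mem _ fun d _ => Submodule.smul_mem _ _ ?_
      exact Submodule.mem_iSup_of_mem _ (monoQ_mem d)
  · intro v
    apply LinearIndependent.of_comp (psi m).toLinearMap
    have hinj : Function.Injective
        (fun α : {α : Fin (m + 1 + 1) → ℕ // ∑ j, α j = v} => Finsupp.equivFunOnFinite.symm α.1) :=
      fun a b h => Subtype.ext (Finsupp.equivFunOnFinite.symm.injective h)
    have h := (MvPolynomial.basisMonomials (Fin (m + 2)) ℂ).linearIndependent.comp _ hinj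
    have he : ((psi m).toLinearMap ∘ fun α : {α : Fin (m + 1 + 1) → ℕ // ∑ j, α j = v} =>
        ∏ j : Fin (m + 1 + 1), Qpoly (m + 1) (j : ℕ) ^ α.1 j) =
        (fun α => MvPolynomial.monomial (Finsupp.equivFunOnFinite.symm α.1) 1) := by
      ext1 α
      simp only [Function.comp_apply, AlgHom.toLinearMap_apply, map_prod, map_pow, psi_Qpoly]
      rw [MvPolynomial.monomial_eq, Finsupp.prod_fintype _ _ (by simp)]
      simp
    rw [he]
    rw [MvPolynomial.coe_basisMonomials] at h
    exact h
end
end
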